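/- Let (i_t, j_t), t ∈ ℕ, be a countable family of pairs of real numbers with 0 < i_t, j_t < 1 and i_t + j_t = 1, and let θ_t ∈ ℝ² for each t. Let I ⊂ ℝ be a compact interval with nonempty interior and let f : ℝ → ℝ be twice continuously differentiable on I such that f″(x) ≠ 0 for some x ∈ I (i.e., the curve C_f := {(x, f(x)) : x ∈ I} is not a straight line segment). Then the Hausdorff dimension of ⋂_{t∈ℕ} ( Bad_{θ_t}(i_t, j_t) ∩ C_f ) equals 1. -/

import Mathlib

open Filter Set

/-- Distance from a real number to the nearest integer. -/
noncomputable def distNearestInt (t : ℝ) : ℝ := |t - round t|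

/-- The inhomogeneous set `Bad_θ(i,j)` of `(i,j)`-badly approximable pairs. -/
def badPair (i j : ℝ) (θ : ℝ × ℝ) : Set (ℝ × ℝ) :=
  {p : ℝ × ℝ | ∃ c : ℝ, 0 < c ∧ ∀ q : ℕ, 0 < q →
    c / (q : ℝ) < max (distNearestInt ((q : ℝ) * p.1 - θ.1) ^ (1 / i))
                      (distNearestInt ((q : ℝ) * p.2 - θ.2) ^ (1 / j))}


/-- The `c`-th grid interval of level `n`. -/
def gI (x0 lam : ℝ) (R n c : ℕ) : Set ℝ :=
  Icc (x0 + lam * c / (R : ℝ) ^ n) (x0 + lam * (c + 1) / (R : ℝ) ^ n)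

theorem gI_child {x0 lam : ℝ} (hl : 0 < lam) {R : ℕ} (hR : 0 < R) (n c e : ℕ) (he : e < R) :
    gI x0 lam R (n + 1) (R * c + e) ⊆ gI x0 lam R n c := by
  have hR' : (0 : ℝ) < R := by exact_mod_cast hR
  have he' : (e : ℝ) + 1 ≤ R := by exact_mod_cast he
  have h1 : lam * (c : ℝ) / (R : ℝ) ^ n = lam * (R * c) / (R : ℝ) ^ (n + 1) := by
    rw [pow_succ]; field_simp
  have h2 : lam * ((c : ℝ) + 1) / (R : ℝ) ^ n = lam * (R * (c + 1)) / (R : ℝ) ^ (n + 1) := by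
    rw [pow_succ]; field_simp
  unfold gI
  apply Icc_subset_Icc
  · rw [h1]; push_cast; gcongr; linarith [(Nat.cast_nonneg e : (0:ℝ) ≤ e)]
  · rw [h2]; push_cast; gcongr; nlinarith

theorem exists_nested_point (l r : ℕ → ℝ) (hl : ∀ n, l n ≤ l (n + 1)) (hr : ∀ n, r (n + 1) ≤ r n)
    (hlr : ∀ n, l n ≤ r n) : ∃ x, ∀ n, x ∈ Icc (l n) (r n) := by
  have hlm : Monotone l := monotone_nat_of_le_succ hl
  have hrm : Antitone r := antitone_nat_of_succ_le hr
  have hb : ∀ n m, l n ≤ r m := fun n m =>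
    ((hlm (le_max_left n m)).trans (hlr _)).trans (hrm (le_max_right n m))
  refine ⟨⨆ n, l n, fun n => ⟨?_, ?_⟩⟩
  · exact le_ciSup (f := l) ⟨r 0, by rintro _ ⟨k, rfl⟩; exact hb k 0⟩ n
  · exact ciSup_le fun k => hb k n

open Classical in
/-- Choosing `b` children which are pairwise non-adjacent. -/
theorem choose_children (p : ℕ) (hp : 3 ≤ p) (P : ℕ → Prop)
    (h : 2 ^ p ≤ 3 * ((Finset.range (2 ^ p)).filter (fun e => P e)).card) :
    ∃ ch : Fin (2 ^ (p - 3)) → ℕ, (∀ a, ch a < 2 ^ p ∧ P (ch a)) ∧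
      ∀ a a', a ≠ a' → ch a + 2 ≤ ch a' ∨ ch a' + 2 ≤ ch a := by
  set S := (Finset.range (2 ^ p)).filter (fun e => P e) with hS
  have hSc : 2 ^ p ≤ 3 * S.card := h
  have h0 := Finset.card_filter_add_card_filter_not (s := S) (fun e => e % 2 = 0)
  have hpp : 2 ^ p = 8 * 2 ^ (p - 3) := by
    rw [show (8:ℕ) = 2 ^ 3 by norm_num, ← pow_add]; congr 1; omega
  have key : ∃ T ⊆ S, 2 ^ (p - 3) ≤ T.card ∧ ∃ z, ∀ e ∈ T, e % 2 = z := by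
    by_cases hc : 2 ^ (p - 3) ≤ (S.filter (fun e => e % 2 = 0)).card
    · exact ⟨_, Finset.filter_subset _ _, hc, 0, fun e he => (Finset.mem_filter.1 he).2⟩
    · refine ⟨S.filter (fun e => ¬ e % 2 = 0), Finset.filter_subset _ _, by omega, 1, fun e he => ?_⟩
      have := (Finset.mem_filter.1 he).2
      omega
  obtain ⟨T, hTS, hTc, z, hz⟩ := key
  obtain ⟨T', hT'T, hT'c⟩ := Finset.exists_subset_card_eq hTc
  refine ⟨fun a => T'.orderEmbOfFin hT'c a, fun a => ?_, fun a a' haa => ?_⟩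
  · have := hTS (hT'T (Finset.orderEmbOfFin_mem T' hT'c a))
    rw [hS, Finset.mem_filter, Finset.mem_range] at this
    exact this
  · have h1 := hz _ (hT'T (Finset.orderEmbOfFin_mem T' hT'c a))
    have h2 := hz _ (hT'T (Finset.orderEmbOfFin_mem T' hT'c a'))
    have h3 : T'.orderEmbOfFin hT'c a ≠ T'.orderEmbOfFin hT'c a' := by
      intro h; exact haa ((T'.orderEmbOfFin hT'c).injective h)
    dsimp only
    generalize T'.orderEmbOfFin hT'c a = A1 at *
    generalize T'.orderEmbOfFin hT'c a' = A2 at *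
    omega

open Classical in
theorem tree_dim (p : ℕ) (hp : 4 ≤ p) (x0 lam : ℝ) (hl : 0 < lam) (Good : ℕ → ℕ → Prop)
    (h0 : Good 0 0)
    (hs : ∀ n c, Good n c →
      2 ^ p ≤ 3 * ((Finset.range (2 ^ p)).filter
        (fun e => Good (n + 1) (2 ^ p * c + e))).card) :
    ENNReal.ofReal (((p : ℝ) - 3) / p) ≤
      dimH {x | ∀ n, ∃ c, Good n c ∧ x ∈ gI x0 lam (2 ^ p) n c} := by
  set R : ℕ := 2 ^ p with hRdef
  set b : ℕ := 2 ^ (p - 3) with hbdef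
  have hR : 0 < R := by positivity
  have hRr : (0 : ℝ) < R := by exact_mod_cast hR
  have hb1 : 1 < b := by
    rw [hbdef]; exact Nat.one_lt_two_pow (by omega)
  have hch : ∀ n c, ∃ ch : Fin b → ℕ, Good n c → ((∀ a, ch a < R ∧ Good (n + 1) (R * c + ch a)) ∧
      ∀ a a', a ≠ a' → ch a + 2 ≤ ch a' ∨ ch a' + 2 ≤ ch a) := by
    intro n c
    by_cases hg : Good n c
    · obtain ⟨ch, h1, h2⟩ := choose_children p (by omega) (fun e => Good (n + 1) (R * c + e)) (hs n c hg)
      exact ⟨ch, fun _ => ⟨h1, h2⟩⟩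
    · exact ⟨fun _ => 0, fun h => absurd h hg⟩
  choose ch hch using hch
  let cc : (ℕ → Fin b) → ℕ → ℕ := fun a n => Nat.rec 0 (fun n c => R * c + ch n c (a n)) n
  have cc0 : ∀ a, cc a 0 = 0 := fun a => rfl
  have ccs : ∀ a n, cc a (n + 1) = R * cc a n + ch n (cc a n) (a n) := fun a n => rfl
  have hgood : ∀ a n, Good n (cc a n) := by
    intro a n
    induction n with
    | zero => exact h0
    | succ n ih => rw [ccs]; exact ((hch n _ ih).1 _).2
  have hnest : ∀ a n, gI x0 lam R (n + 1) (cc a (n + 1)) ⊆ gI x0 lam R n (cc a n) := by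
    intro a n
    rw [ccs]
    exact gI_child hl hR n _ _ ((hch n _ (hgood a n)).1 _).1
  have hle : ∀ n c, x0 + lam * (c : ℝ) / (R : ℝ) ^ n ≤ x0 + lam * (c + 1) / (R : ℝ) ^ n := by
    intro n c; gcongr; linarith
  have hpt : ∀ a, ∃ x, ∀ n, x ∈ gI x0 lam R n (cc a n) := by
    intro a
    refine exists_nested_point (fun n : ℕ => x0 + lam * (Nat.cast (cc a n) : ℝ) / (R : ℝ) ^ n)
      (fun n : ℕ => x0 + lam * ((Nat.cast (cc a n) : ℝ) + 1) / (R : ℝ) ^ n) ?_ ?_ ?_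
    rotate_left 2
    · intro n; exact hle n (Nat.cast (cc a n))
    · intro n
      have := (Icc_subset_Icc_iff (hle (n+1) (Nat.cast (cc a (n+1))))).1 (hnest a n)
      exact this.1
    · intro n
      have := (Icc_subset_Icc_iff (hle (n+1) (Nat.cast (cc a (n+1))))).1 (hnest a n)
      exact this.2
  choose π hπ using hpt
  -- separation
  have hsep : ∀ a a' n, (∀ k < n, a k = a' k) → a n ≠ a' n →
      lam / (R : ℝ) ^ (n + 1) ≤ |π a - π a'| := by
    intro a a' n hk hn
    have hcc : ∀ k, k ≤ n → cc a k = cc a' k := by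
      intro k
      induction k with
      | zero => intro _; rfl
      | succ k ih => intro hkn; rw [ccs, ccs, ih (by omega), hk k (by omega)]
    have h1 := hπ a (n + 1)
    have h2 := hπ a' (n + 1)
    rw [ccs] at h1 h2
    rw [hcc n le_rfl] at h1
    have h3 := (hch n _ (hgood a' n)).2 _ _ hn
    generalize R * cc a' n = w at *
    generalize ch n (cc a' n) (a n) = e1 at *
    generalize ch n (cc a' n) (a' n) = e2 at *
    unfold gI at h1 h2
    obtain ⟨h1a, h1b⟩ := h1
    obtain ⟨h2a, h2b⟩ := h2
    have hQ : (0 : ℝ) < (R : ℝ) ^ (n + 1) := by positivity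
    have hk : 0 < lam / (R : ℝ) ^ (n + 1) := by positivity
    rw [mul_div_right_comm] at h1a h1b h2a h2b
    push_cast at *
    generalize lam / (R : ℝ) ^ (n + 1) = y at *
    rcases h3 with h3 | h3
    · have h3' : (e1 : ℝ) + 2 ≤ e2 := by exact_mod_cast h3
      rw [abs_sub_comm]
      refine le_trans ?_ (le_abs_self _)
      nlinarith
    · have h3' : (e2 : ℝ) + 2 ≤ e1 := by exact_mod_cast h3
      refine le_trans ?_ (le_abs_self _)
      nlinarith
  have hpr : (0 : ℝ) < p := by exact_mod_cast (by omega : 0 < p)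
  have hp3 : (4 : ℝ) ≤ p := by exact_mod_cast hp
  set r : NNReal := Real.toNNReal (((p : ℝ) - 3) / p) with hr
  have hr0 : 0 < ((p : ℝ) - 3) / p := by apply div_pos <;> linarith
  have hrr : (r : ℝ) = ((p : ℝ) - 3) / p := by rw [hr, Real.coe_toNNReal _ hr0.le]
  have hbR : ∀ n : ℕ, ((b : ℝ)⁻¹) ^ n = (((R : ℝ) ^ n)⁻¹) ^ (r : ℝ) := by
    intro n
    have hbb : (b : ℝ) = (R : ℝ) ^ (r : ℝ) := by
      rw [hbdef, hRdef, hrr]; push_cast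
      rw [← Real.rpow_natCast, ← Real.rpow_natCast, ← Real.rpow_mul (by norm_num)]
      congr 1
      rw [Nat.cast_sub (by omega)]
      field_simp
      norm_num
    rw [hbb, inv_pow, Real.inv_rpow (by positivity), ← Real.rpow_natCast, ← Real.rpow_natCast,
      ← Real.rpow_mul hRr.le, ← Real.rpow_mul hRr.le, mul_comm]
  let E : Set ℝ := range π
  have hEsub : E ⊆ {x | ∀ n, ∃ c, Good n c ∧ x ∈ gI x0 lam R n c} := by
    rintro _ ⟨a, rfl⟩ n
    exact ⟨cc a n, hgood a n, hπ a n⟩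
  let f : ℝ → ℝ := fun x => if h : ∃ a, π a = x then Real.ofDigits h.choose else 0
  have hdist : ∀ a a', |Real.ofDigits a - Real.ofDigits a'| ≤
      (R / lam : ℝ) ^ (r : ℝ) * |π a - π a'| ^ (r : ℝ) := by
    intro a a'
    by_cases h : a = a'
    · subst h
      simp only [sub_self, abs_zero]
      positivity
    · have hne : ∃ n, a n ≠ a' n := by
        by_contra hcon; push Not at hcon; exact h (funext hcon)
      have hn := Nat.find_spec hne
      have hm : ∀ k < Nat.find hne, a k = a' k := fun k hk => by
        have := Nat.find_min hne hk; simpa using this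
      generalize Nat.find hne = n at *
      have h1 := Real.abs_ofDigits_sub_ofDigits_le hm
      refine h1.trans ?_
      rw [← inv_pow, hbR, ← Real.mul_rpow (by positivity) (by positivity)]
      apply Real.rpow_le_rpow (by positivity) _ (by positivity)
      have h2 := hsep a a' n hm hn
      calc ((R : ℝ) ^ n)⁻¹ = R / lam * (lam / (R : ℝ) ^ (n + 1)) := by rw [pow_succ]; field_simp
        _ ≤ _ := by gcongr
  have hinj : ∀ a a', π a = π a' → a = a' := by
    intro a a' hp
    by_contra h
    have hne : ∃ n, a n ≠ a' n := by
      by_contra hcon; push Not at hcon; exact h (funext hcon)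
    have hn := Nat.find_spec hne
    have hm : ∀ k < Nat.find hne, a k = a' k := fun k hk => by
      have := Nat.find_min hne hk; simpa using this
    have := hsep a a' _ hm hn
    rw [hp, sub_self, abs_zero] at this
    have : 0 < lam / (R : ℝ) ^ (Nat.find hne + 1) := by positivity
    linarith
  have hf : ∀ a, f (π a) = Real.ofDigits a := by
    intro a
    have h : ∃ a', π a' = π a := ⟨a, rfl⟩
    simp only [f, dif_pos h]
    rw [hinj _ _ h.choose_spec]
  have hH : HolderOnWith (Real.toNNReal ((R / lam : ℝ) ^ (r : ℝ))) r f E := by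
    rintro _ ⟨a, rfl⟩ _ ⟨a', rfl⟩
    rw [hf, hf, edist_dist, edist_dist, Real.dist_eq, Real.dist_eq,
      ENNReal.ofReal_rpow_of_nonneg (abs_nonneg _) (by positivity),
      ← ENNReal.ofReal, ← ENNReal.ofReal_mul (by positivity)]
    exact ENNReal.ofReal_le_ofReal (hdist a a')
  have hrpos : 0 < r := by
    rw [← NNReal.coe_pos, hrr]; exact hr0
  have h1 := hH.dimH_image_le hrpos
  have h2 : Icc (0 : ℝ) 1 ⊆ f '' E := by
    intro y hy
    obtain ⟨a, -, ha⟩ := Real.ofDigits_SurjOn hb1 hy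
    exact ⟨π a, ⟨a, rfl⟩, by rw [hf, ha]⟩
  have h3 : dimH (Icc (0 : ℝ) 1) = 1 := by
    rw [Real.dimH_of_nonempty_interior]
    · simp
    · rw [interior_Icc]; exact ⟨1/2, by norm_num, by norm_num⟩
  have h4 : (1 : ENNReal) ≤ dimH E / r := by
    rw [← h3]; exact (dimH_mono h2).trans h1
  have h5 : (r : ENNReal) ≤ dimH E := by
    rw [ENNReal.le_div_iff_mul_le (Or.inl (by exact_mod_cast hrpos.ne')) (Or.inl ENNReal.coe_ne_top), one_mul] at h4
    exact h4
  exact h5.trans (dimH_mono hEsub)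


open Classical in
/-- Number of level `n + d` descendants of the interval `(n, c)` which meet `B`. -/
noncomputable def gcnt (x0 lam : ℝ) (R : ℕ) (B : Set ℝ) (n d c : ℕ) : ENNReal :=
  ∑ e ∈ Finset.range (R ^ d), if (gI x0 lam R (n + d) (R ^ d * c + e) ∩ B).Nonempty then 1 else 0

theorem sum_range_mul_aux (g : ℕ → ENNReal) (D r : ℕ) :
    ∑ e ∈ Finset.range r, ∑ e' ∈ Finset.range D, g (D * e + e') = ∑ x ∈ Finset.range (D * r), g x := by
  induction r with
  | zero => simp
  | succ r ih => rw [Finset.sum_range_succ, ih, mul_add, mul_one, Finset.sum_range_add]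

theorem gcnt_succ (x0 lam : ℝ) (R : ℕ) (B : Set ℝ) (n d c : ℕ) :
    ∑ e ∈ Finset.range R, gcnt x0 lam R B (n + 1) d (R * c + e) = gcnt x0 lam R B n (d + 1) c := by
  unfold gcnt
  rw [pow_succ, ← sum_range_mul_aux]
  refine Finset.sum_congr rfl fun e _ => Finset.sum_congr rfl fun e' _ => ?_
  rw [show n + 1 + d = n + (d + 1) by ring,
    show R ^ d * (R * c + e) + e' = R ^ d * R * c + (R ^ d * e + e') by ring]

theorem gcnt_zero_disj {x0 lam : ℝ} {R : ℕ} {B : Set ℝ} {n c : ℕ}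
    (h : gcnt x0 lam R B n 0 c < 1) : Disjoint (gI x0 lam R n c) B := by
  unfold gcnt at h
  rw [pow_zero, Finset.range_one, Finset.sum_singleton, ← pow_zero R] at h
  rw [Set.disjoint_iff_inter_eq_empty]
  by_contra hc
  rw [← Ne, ← Set.nonempty_iff_ne_empty] at hc
  have hc' : (gI x0 lam R (n + 0) (R ^ 0 * c + 0) ∩ B).Nonempty := by simpa using hc
  rw [if_pos hc'] at h
  exact lt_irrefl _ h

theorem cantor_potential {K : Type} (p : ℕ) (hp : 4 ≤ p) (x0 lam : ℝ) (hl : 0 < lam)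
    (Bad : K → Set ℝ) (m n : K → ℕ) (hmn : ∀ k, m k < n k) (N : K → ENNReal)
    (H1 : ∀ k c, c < (2 ^ p) ^ (m k) →
      (∀ k', n k' ≤ m k → Disjoint (gI x0 lam (2 ^ p) (m k) c) (Bad k')) →
      gcnt x0 lam (2 ^ p) (Bad k) (m k) (n k - m k) c ≤ N k)
    (H2 : ∀ m0, ∑' k, (if m k = m0 then N k * (2 / (2 ^ p : ℕ) : ENNReal) ^ (n k - m k) else 0)
      ≤ 1 / 6) :
    ENNReal.ofReal (((p : ℝ) - 3) / p) ≤ dimH (Icc x0 (x0 + lam) \ ⋃ k, Bad k) := by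
  classical
  generalize hRdef : 2 ^ p = R at *
  have hR : 0 < R := by rw [← hRdef]; positivity
  have hR0 : (R : ENNReal) ≠ 0 := by exact_mod_cast hR.ne'
  have hRt : (R : ENNReal) ≠ ⊤ := ENNReal.natCast_ne_top R
  have e6 : (1 / 6 : ENNReal) = ENNReal.ofReal (1 / 6) := by
    rw [ENNReal.ofReal_div_of_pos (by norm_num)]; simp
  have e23 : (2 / 3 : ENNReal) = ENNReal.ofReal (2 / 3) := by
    rw [ENNReal.ofReal_div_of_pos (by norm_num)]; simp
  have e12 : (1 / 2 : ENNReal) = ENNReal.ofReal (1 / 2) := by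
    rw [ENNReal.ofReal_div_of_pos (by norm_num)]; simp
  set τ : ENNReal := 2 / R with hτ
  have hτR : (R / 2 : ENNReal) * τ = 1 := by
    rw [hτ, ENNReal.div_eq_inv_mul, ENNReal.div_eq_inv_mul]
    calc (2⁻¹ * R : ENNReal) * ((R : ENNReal)⁻¹ * 2) = (2⁻¹ * 2) * (R * (R : ENNReal)⁻¹) := by ring
      _ = 1 := by
        rw [ENNReal.inv_mul_cancel (by norm_num) (by norm_num), ENNReal.mul_inv_cancel hR0 hRt, one_mul]
  let cnt : K → ℕ → ℕ → ENNReal := fun k nn c => gcnt x0 lam R (Bad k) nn (n k - nn) c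
  let φ : ℕ → ℕ → ENNReal := fun nn c => ∑' k, if m k ≤ nn ∧ nn ≤ n k then cnt k nn c * τ ^ (n k - nn) else 0
  let old : ℕ → ℕ → ENNReal := fun nn c =>
    ∑' k, if m k ≤ nn ∧ nn + 1 ≤ n k then cnt k (nn + 1) c * τ ^ (n k - (nn + 1)) else 0
  let alive : ℕ → ℕ → Prop := fun nn c => ∀ k', n k' ≤ nn → Disjoint (gI x0 lam R nn c) (Bad k')
  let Good : ℕ → ℕ → Prop := fun nn c => c < R ^ nn ∧ φ nn c ≤ 2 / 3 ∧ alive nn c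
  -- new part
  have hnew : ∀ nn c, c < R ^ nn → alive nn c →
      ∑' k, (if m k = nn then cnt k nn c * τ ^ (n k - nn) else 0) ≤ 1 / 6 := by
    intro nn c hc ha
    refine le_trans (ENNReal.tsum_le_tsum fun k => ?_) (H2 nn)
    split_ifs with h
    · subst h
      gcongr
      exact H1 k c hc ha
    · exact le_rfl
  have h0 : Good 0 0 := by
    have ha : alive 0 0 := by
      intro k' hk'
      have := hmn k'
      omega
    refine ⟨by simp, ?_, ha⟩
    refine le_trans (le_trans (ENNReal.tsum_le_tsum fun k => ?_) (hnew 0 0 (by simp) ha)) ?_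
    · by_cases hk : m k = 0
      · simp [hk]
      · have : ¬ m k ≤ 0 := by omega
        simp [hk]
    · rw [e6, e23]; exact ENNReal.ofReal_le_ofReal (by norm_num)
  have hs : ∀ nn c, Good nn c → R ≤ 3 * ((Finset.range R).filter (fun e => Good (nn + 1) (R * c + e))).card := by
    rintro nn c ⟨hc, hφ, ha⟩
    have hsum : ∑ e ∈ Finset.range R, old nn (R * c + e) ≤ R / 3 := by
      have e1 : ∑ e ∈ Finset.range R, old nn (R * c + e) =
          ∑' k, ∑ e ∈ Finset.range R, (if m k ≤ nn ∧ nn + 1 ≤ n k then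
            cnt k (nn + 1) (R * c + e) * τ ^ (n k - (nn + 1)) else 0) := by
        rw [Summable.tsum_finsetSum (fun _ _ => ENNReal.summable)]
      rw [e1]
      have e2 : ∀ k, ∑ e ∈ Finset.range R, (if m k ≤ nn ∧ nn + 1 ≤ n k then
            cnt k (nn + 1) (R * c + e) * τ ^ (n k - (nn + 1)) else 0) ≤
          (R / 2 : ENNReal) * (if m k ≤ nn ∧ nn ≤ n k then cnt k nn c * τ ^ (n k - nn) else 0) := by
        intro k
        by_cases h : m k ≤ nn ∧ nn + 1 ≤ n k
        · have h' : m k ≤ nn ∧ nn ≤ n k := ⟨h.1, by omega⟩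
          simp only [if_pos h, if_pos h']
          rw [← Finset.sum_mul]
          obtain ⟨d, hd⟩ : ∃ d, n k = nn + 1 + d := ⟨n k - (nn + 1), by omega⟩
          have hd1 : n k - (nn + 1) = d := by omega
          have hd2 : n k - nn = d + 1 := by omega
          simp only [cnt, hd1, hd2]
          rw [gcnt_succ, pow_succ]
          apply le_of_eq
          calc gcnt x0 lam R (Bad k) nn (d + 1) c * τ ^ d
              = (R / 2 * τ) * (gcnt x0 lam R (Bad k) nn (d + 1) c * τ ^ d) := by rw [hτR, one_mul]
            _ = _ := by ring
        · simp only [if_neg h, Finset.sum_const_zero]; exact zero_le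
      refine (ENNReal.tsum_le_tsum e2).trans ?_
      rw [ENNReal.tsum_mul_left]
      calc (R / 2 : ENNReal) * φ nn c ≤ R / 2 * (2 / 3) := by gcongr
        _ = R / 3 := by
          rw [ENNReal.div_eq_inv_mul, ENNReal.div_eq_inv_mul, ENNReal.div_eq_inv_mul]
          calc (2⁻¹ * R * (3⁻¹ * 2) : ENNReal) = (2⁻¹ * 2) * (3⁻¹ * R) := by ring
            _ = _ := by rw [ENNReal.inv_mul_cancel (by norm_num) (by norm_num), one_mul]
    have hgood : ∀ e < R, old nn (R * c + e) ≤ 1 / 2 → Good (nn + 1) (R * c + e) := by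
      intro e he ho
      have hlt : R * c + e < R ^ (nn + 1) := by
        rw [pow_succ]; nlinarith
      have hal : alive (nn + 1) (R * c + e) := by
        intro k' hk'
        rcases Nat.lt_or_ge nn (n k') with h | h
        · have hk : n k' = nn + 1 := by omega
          apply gcnt_zero_disj
          have h1 : cnt k' (nn + 1) (R * c + e) * τ ^ (n k' - (nn + 1)) ≤ old nn (R * c + e) := by
            have := ENNReal.le_tsum (f := fun k => if m k ≤ nn ∧ nn + 1 ≤ n k then
              cnt k (nn + 1) (R * c + e) * τ ^ (n k - (nn + 1)) else 0) k'
            have hh : m k' ≤ nn ∧ nn + 1 ≤ n k' := ⟨by have := hmn k'; omega, by omega⟩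
            simp only [if_pos hh] at this
            exact this
          simp only [cnt, hk, Nat.sub_self, pow_zero, mul_one] at h1
          refine lt_of_le_of_lt (h1.trans ho) ?_
          norm_num
        · exact (ha k' h).mono_left (gI_child hl hR nn c e he)
      refine ⟨hlt, ?_, hal⟩
      have := hnew (nn + 1) _ hlt hal
      calc φ (nn + 1) (R * c + e) ≤ old nn (R * c + e) +
            ∑' k, (if m k = nn + 1 then cnt k (nn + 1) (R * c + e) * τ ^ (n k - (nn + 1)) else 0) := by
            rw [← ENNReal.tsum_add]
            refine ENNReal.tsum_le_tsum fun k => ?_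
            by_cases h1 : m k ≤ nn + 1 ∧ nn + 1 ≤ n k
            · rcases Nat.lt_or_ge nn (m k) with h | h
              · have : m k = nn + 1 := by omega
                rw [if_pos h1, if_pos this]; exact le_add_self
              · rw [if_pos h1, if_pos ⟨h, h1.2⟩]; exact le_self_add
            · rw [if_neg h1]; exact zero_le
        _ ≤ 1 / 2 + 1 / 6 := by gcongr
        _ = 2 / 3 := by
          rw [e6, e23, e12, ← ENNReal.ofReal_add (by norm_num) (by norm_num)]; norm_num
    have hcard : R ≤ ((Finset.range R).filter (fun e => Good (nn + 1) (R * c + e))).card +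
        ((Finset.range R).filter (fun e => ¬ old nn (R * c + e) ≤ 1 / 2)).card := by
      calc R = (Finset.range R).card := by simp
        _ ≤ (((Finset.range R).filter (fun e => Good (nn + 1) (R * c + e))) ∪
            ((Finset.range R).filter (fun e => ¬ old nn (R * c + e) ≤ 1 / 2))).card := by
            apply Finset.card_le_card
            intro e he
            rw [Finset.mem_union, Finset.mem_filter, Finset.mem_filter]
            by_cases ho : old nn (R * c + e) ≤ 1 / 2
            · exact Or.inl ⟨he, hgood e (Finset.mem_range.1 he) ho⟩
            · exact Or.inr ⟨he, ho⟩
        _ ≤ _ := Finset.card_union_le _ _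
    have hmarkov : 3 * ((Finset.range R).filter (fun e => ¬ old nn (R * c + e) ≤ 1 / 2)).card ≤ 2 * R := by
      set F := (Finset.range R).filter (fun e => ¬ old nn (R * c + e) ≤ 1 / 2) with hF
      have h1 : (F.card : ENNReal) * (1 / 2) ≤ R / 3 := by
        refine le_trans ?_ hsum
        calc (F.card : ENNReal) * (1 / 2) = ∑ e ∈ F, (1 / 2 : ENNReal) := by simp
          _ ≤ ∑ e ∈ F, old nn (R * c + e) := Finset.sum_le_sum fun e he =>
              (not_le.1 (Finset.mem_filter.1 he).2).le
          _ ≤ _ := Finset.sum_le_sum_of_subset (Finset.filter_subset _ _)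
      have h2 : ((F.card : ℝ)) * (1 / 2) ≤ R / 3 := by
        have := ENNReal.toReal_mono (ENNReal.div_ne_top hRt (by norm_num)) h1
        simpa using this
      have h3 : (3 * F.card : ℝ) ≤ 2 * R := by linarith
      exact_mod_cast h3
    omega
  subst hRdef
  refine (tree_dim p hp x0 lam hl Good h0 (by intro nn c h; convert hs nn c h)).trans (dimH_mono ?_)
  intro x hx
  refine ⟨?_, ?_⟩
  · obtain ⟨c, hc, hx⟩ := hx 0
    have hc0 : c = 0 := by have := hc.1; simp at this; exact this
    subst hc0
    unfold gI at hx
    simpa using hx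
  · rw [mem_iUnion]
    rintro ⟨k, hk⟩
    obtain ⟨c, hc, hx⟩ := hx (n k)
    exact Set.disjoint_left.1 (hc.2.2 k le_rfl) hx hk


theorem gcnt_le_three (x0 lam : ℝ) (hl : 0 < lam) (R : ℕ) (hR : 0 < R) (B : Set ℝ) (n d c : ℕ) (l N : ℝ)
    (hln : l ≤ lam / (R : ℝ) ^ (n + d))
    (hN : ∀ S : Finset ℝ, (S : Set ℝ) ⊆ gI x0 lam R n c ∩ B →
      (∀ s ∈ S, ∀ s' ∈ S, s ≠ s' → l < |s - s'|) → (S.card : ℝ) ≤ N) :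
    gcnt x0 lam R B n d c ≤ ENNReal.ofReal (3 * N) := by
  classical
  have hRr : (0 : ℝ) < R := by exact_mod_cast hR
  have hN0 : 0 ≤ N := by simpa using hN ∅ (by simp) (by simp)
  set T := (Finset.range (R ^ d)).filter
    (fun e => (gI x0 lam R (n + d) (R ^ d * c + e) ∩ B).Nonempty) with hT
  have hcnt : gcnt x0 lam R B n d c = (T.card : ENNReal) := by
    unfold gcnt
    rw [Finset.sum_ite]
    simp only [Finset.sum_const, nsmul_eq_mul, mul_one, mul_zero, add_zero]
    rw [hT]
  have hdesc : ∀ d' c' e, e < R ^ d' → gI x0 lam R (n + d') (R ^ d' * c' + e) ⊆ gI x0 lam R n c' := by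
    intro d'
    induction d' with
    | zero => intro c' e he; simp at he; subst he; simp
    | succ d' ih =>
      intro c' e he
      have h1 := gI_child (x0 := x0) hl hR (n + d') (R ^ d' * c' + e / R) (e % R) (Nat.mod_lt _ hR)
      have h2 : R * (R ^ d' * c' + e / R) + e % R = R ^ (d' + 1) * c' + e := by
        have := Nat.div_add_mod e R
        rw [mul_add, add_assoc, this]; ring
      rw [h2] at h1
      refine h1.trans (ih _ _ ?_)
      rw [Nat.div_lt_iff_lt_mul hR, ← pow_succ]; exact he
  have hch : ∀ e, ∃ s, e ∈ T → s ∈ gI x0 lam R (n + d) (R ^ d * c + e) ∩ B := by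
    intro e
    by_cases h : e ∈ T
    · obtain ⟨s, hs⟩ := (Finset.mem_filter.1 h).2
      exact ⟨s, fun _ => hs⟩
    · exact ⟨0, fun h' => absurd h' h⟩
  choose g hg using hch
  have hy : 0 < lam / (R : ℝ) ^ (n + d) := by positivity
  have hfar : ∀ e ∈ T, ∀ e' ∈ T, e + 3 ≤ e' → l < |g e - g e'| := by
    intro e he e' he' hee
    have h1 := (hg e he).1
    have h2 := (hg e' he').1
    unfold gI at h1 h2
    obtain ⟨h1a, h1b⟩ := h1
    obtain ⟨h2a, h2b⟩ := h2
    rw [mul_div_right_comm] at h1a h1b h2a h2b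
    push_cast at *
    generalize lam / (R : ℝ) ^ (n + d) = y at *
    have h3 : (e : ℝ) + 3 ≤ e' := by exact_mod_cast hee
    rw [abs_sub_comm]
    refine lt_of_lt_of_le ?_ (le_abs_self _)
    nlinarith
  have hz : ∀ z, ((T.filter (fun e => e % 3 = z)).card : ℝ) ≤ N := by
    intro z
    have hsep : ∀ e ∈ T.filter (fun e => e % 3 = z), ∀ e' ∈ T.filter (fun e => e % 3 = z), e ≠ e' →
        l < |g e - g e'| ∧ g e ≠ g e' := by
      intro e he e' he' hne
      rw [Finset.mem_filter] at he he'
      have hl0 : ∀ e ∈ T, ∀ e' ∈ T, e + 3 ≤ e' → g e ≠ g e' := by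
        intro e he e' he' hee
        have h1 := (hg e he).1
        have h2 := (hg e' he').1
        unfold gI at h1 h2
        obtain ⟨h1a, h1b⟩ := h1
        obtain ⟨h2a, h2b⟩ := h2
        rw [mul_div_right_comm] at h1a h1b h2a h2b
        push_cast at *
        generalize lam / (R : ℝ) ^ (n + d) = y at *
        have h3 : (e : ℝ) + 3 ≤ e' := by exact_mod_cast hee
        intro h
        nlinarith
      rcases Nat.lt_or_gt_of_ne hne with h | h
      · exact ⟨hfar e he.1 e' he'.1 (by omega), hl0 e he.1 e' he'.1 (by omega)⟩
      · rw [abs_sub_comm]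
        exact ⟨hfar e' he'.1 e he.1 (by omega), (hl0 e' he'.1 e he.1 (by omega)).symm⟩
    have hinj : Set.InjOn g (T.filter (fun e => e % 3 = z)) := by
      intro e he e' he' h
      by_contra hne
      exact (hsep e he e' he' hne).2 h
    rw [← Finset.card_image_of_injOn hinj]
    apply hN
    · intro s hs
      rw [Finset.mem_coe, Finset.mem_image] at hs
      obtain ⟨e, he, rfl⟩ := hs
      have heT := (Finset.mem_filter.1 he).1
      exact ⟨hdesc d c e (Finset.mem_range.1 (Finset.mem_filter.1 heT).1) (hg e heT).1, (hg e heT).2⟩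
    · intro s hs s' hs' hne
      rw [Finset.mem_image] at hs hs'
      obtain ⟨e, he, rfl⟩ := hs
      obtain ⟨e', he', rfl⟩ := hs'
      exact (hsep e he e' he' (fun h => hne (by rw [h]))).1
  have hsum : T.card = ∑ z ∈ Finset.range 3, (T.filter (fun e => e % 3 = z)).card :=
    Finset.card_eq_sum_card_fiberwise (fun e _ => by
      simp only [Finset.coe_range, Set.mem_Iio]; exact Nat.mod_lt _ (by norm_num))
  have hreal : (T.card : ℝ) ≤ 3 * N := by
    rw [hsum]
    push_cast
    calc ∑ z ∈ Finset.range 3, ((T.filter (fun e => e % 3 = z)).card : ℝ) ≤ ∑ z ∈ Finset.range 3, N :=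
          Finset.sum_le_sum fun z _ => hz z
      _ = 3 * N := by simp
  rw [hcnt, ← ENNReal.ofReal_natCast]
  exact ENNReal.ofReal_le_ofReal hreal

theorem cantor_real {K : Type} (p : ℕ) (hp : 10 ≤ p) (x0 lam : ℝ) (hl : 0 < lam)
    (Bad : K → Set ℝ) (X l N : K → ℝ) (hX : ∀ k, 0 < X k) (hl0 : ∀ k, 0 < l k)
    (hXl : ∀ k, X k ≤ lam) (hRX : ∀ k, (2 ^ p) ^ 2 * l k < X k) (hN : ∀ k, 0 ≤ N k)
    (A2 : ∀ k y L, 0 < L → L ≤ X k → x0 ≤ y → y + L ≤ x0 + lam →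
      (∀ k', L ≤ l k' → Disjoint (Icc y (y + L)) (Bad k')) →
      ∀ S : Finset ℝ, (S : Set ℝ) ⊆ Icc y (y + L) ∩ Bad k →
        (∀ s ∈ S, ∀ s' ∈ S, s ≠ s' → l k < |s - s'|) → (S.card : ℝ) ≤ N k)
    (A3 : ∀ L : ℝ, 0 < L → ∑' k, (if L < X k ∧ X k ≤ 2 ^ p * L then
        ENNReal.ofReal (N k * (l k / X k) ^ (9 / 10 : ℝ)) else 0)
      ≤ ENNReal.ofReal (1 / (18 * (2 ^ p) ^ 2))) :
    ENNReal.ofReal (((p : ℝ) - 3) / p) ≤ dimH (Icc x0 (x0 + lam) \ ⋃ k, Bad k) := by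
  classical
  obtain ⟨R, hRdef⟩ : ∃ R : ℕ, R = 2 ^ p := ⟨_, rfl⟩
  have hRr : (R : ℝ) = 2 ^ p := by rw [hRdef]; push_cast; rfl
  have hR1024 : (1 : ℝ) < R := by rw [hRr]; exact one_lt_pow₀ (by norm_num) (by omega)
  have hR0 : (0 : ℝ) < R := by linarith
  have hR : 0 < R := by exact_mod_cast hR0
  rw [← hRr] at A3 hRX
  set r : ℝ := (R : ℝ)⁻¹ with hr
  have hr0 : 0 < r := by positivity
  have hr1 : r < 1 := inv_lt_one_of_one_lt₀ hR1024
  have hrR : r * R = 1 := inv_mul_cancel₀ hR0.ne'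
  have hlX : ∀ k, l k ≤ X k := fun k => by
    have := hRX k
    have h1 : (1 : ℝ) ≤ R ^ 2 := one_le_pow₀ hR1024.le
    nlinarith [hl0 k]
  have hm : ∀ k, ∃ m : ℕ, r ^ (m + 1) < X k / lam ∧ X k / lam ≤ r ^ m := fun k =>
    exists_nat_pow_near_of_lt_one (div_pos (hX k) hl) ((div_le_one hl).2 (hXl k)) hr0 hr1
  have hn : ∀ k, ∃ m : ℕ, r ^ (m + 1) < l k / lam ∧ l k / lam ≤ r ^ m := fun k =>
    exists_nat_pow_near_of_lt_one (div_pos (hl0 k) hl)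
      ((div_le_one hl).2 ((hlX k).trans (hXl k))) hr0 hr1
  choose m' hm1 hm2 using hm
  choose n hn1 hn2 using hn
  have hmn : ∀ k, m' k + 1 < n k := by
    intro k
    have h1 : r ^ (n k + 1) < r ^ (m' k + 2) := by
      calc r ^ (n k + 1) < l k / lam := hn1 k
        _ = r ^ 2 * ((R ^ 2 * l k) / lam) := by rw [hr]; field_simp
        _ ≤ r ^ 2 * (X k / lam) := by
            have := (hRX k).le
            gcongr
        _ ≤ r ^ 2 * r ^ (m' k) := by have := hm2 k; gcongr
        _ = _ := by ring
    have := (pow_lt_pow_iff_right_of_lt_one₀ hr0 hr1).1 h1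
    omega
  have hgI : ∀ nn c, gI x0 lam R nn c =
      Icc (x0 + lam * r ^ nn * c) (x0 + lam * r ^ nn * c + lam * r ^ nn) := by
    intro nn c
    unfold gI
    rw [hr, inv_pow]
    congr 1 <;> ring
  refine cantor_potential p (by omega) x0 lam hl Bad (fun k => m' k + 1) n hmn
    (fun k => ENNReal.ofReal (3 * N k)) ?_ ?_
  · rw [← hRdef]
    intro k c hc hal
    obtain ⟨d, hd⟩ : ∃ d, n k = m' k + 1 + d := ⟨n k - (m' k + 1), by have := hmn k; omega⟩
    have hd' : n k - (m' k + 1) = d := by omega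
    rw [hd']
    refine gcnt_le_three x0 lam hl R hR (Bad k) (m' k + 1) d c (l k) (N k) ?_ ?_
    · rw [← hd]
      have := hn2 k
      rw [div_le_iff₀ hl] at this
      rw [div_eq_mul_inv, ← inv_pow, mul_comm]
      exact this
    · rw [hgI]
      have hm1' := hm1 k
      rw [lt_div_iff₀ hl] at hm1'
      refine A2 k _ _ (by positivity) (by linarith) ?_ ?_ ?_
      · have : 0 ≤ lam * r ^ (m' k + 1) * c := by positivity
        linarith
      · have hc' : (c : ℝ) + 1 ≤ (R : ℝ) ^ (m' k + 1) := by
          exact_mod_cast hc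
        have : lam * r ^ (m' k + 1) * (c + 1) ≤ lam * r ^ (m' k + 1) * (R : ℝ) ^ (m' k + 1) := by
          gcongr
        have h2 : lam * r ^ (m' k + 1) * (R : ℝ) ^ (m' k + 1) = lam := by
          rw [mul_assoc, ← mul_pow, hrR, one_pow, mul_one]
        linarith
      · intro k' hk'
        rw [← hgI]
        apply hal
        have h1 := hn2 k'
        rw [div_le_iff₀ hl] at h1
        have h2 : r ^ (m' k + 1) ≤ r ^ (n k') := by
          have : lam * r ^ (m' k + 1) ≤ lam * r ^ (n k') := by linarith
          exact le_of_mul_le_mul_left this hl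
        exact (pow_le_pow_iff_right_of_lt_one₀ hr0 hr1).1 h2
  · intro m0
    rw [← hRdef]
    have hτ : ∀ d : ℕ, (2 / (R : ENNReal)) ^ d = ENNReal.ofReal ((2 / R : ℝ) ^ d) := by
      intro d
      rw [ENNReal.ofReal_pow (by positivity), ENNReal.ofReal_div_of_pos hR0]
      simp
    have hterm : ∀ k, (if m' k + 1 = m0 then
          ENNReal.ofReal (3 * N k) * (2 / (R : ENNReal)) ^ (n k - (m' k + 1)) else 0) ≤
        ENNReal.ofReal (3 * R ^ 2) * (if lam * r ^ m0 < X k ∧ X k ≤ R * (lam * r ^ m0) then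
        ENNReal.ofReal (N k * (l k / X k) ^ (9 / 10 : ℝ)) else 0) := by
      intro k
      by_cases hk : m' k + 1 = m0
      · have hm1' := hm1 k
        rw [lt_div_iff₀ hl, hk] at hm1'
        have hm2' := hm2 k
        rw [div_le_iff₀ hl] at hm2'
        have hpow : r ^ (m' k) = R * r ^ m0 := by
          rw [← hk, pow_succ]
          calc r ^ m' k = r ^ m' k * (r * R) := by rw [hrR, mul_one]
            _ = _ := by ring
        have hcond : lam * r ^ m0 < X k ∧ X k ≤ R * (lam * r ^ m0) := by
          refine ⟨by linarith, ?_⟩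
          rw [hpow] at hm2'; linarith
        rw [if_pos hk, if_pos hcond, hτ, ← ENNReal.ofReal_mul (by have := hN k; positivity),
          ← ENNReal.ofReal_mul (by positivity)]
        apply ENNReal.ofReal_le_ofReal
        obtain ⟨d, hd⟩ : ∃ d, n k = m' k + 1 + d := ⟨n k - (m' k + 1), by have := hmn k; omega⟩
        have hd' : n k - (m' k + 1) = d := by omega
        rw [hd']
        have hXk := hX k
        have hlk := hl0 k
        have hrd : r ^ d ≤ R ^ 2 * (l k / X k) := by
          have h1 := (hn1 k).le
          rw [hd, hk, le_div_iff₀ hl] at h1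
          have h2 : r ^ d * r ^ m0 * lam ≤ R * l k := by
            have : r ^ (m0 + d + 1) * lam * R ≤ l k * R := by gcongr
            have e : r ^ (m0 + d + 1) * lam * R = r ^ d * r ^ m0 * lam * (r * R) := by ring
            rw [e, hrR] at this
            linarith
          rw [← mul_div_assoc, le_div_iff₀ hXk]
          calc r ^ d * X k ≤ r ^ d * (R * (lam * r ^ m0)) := by gcongr; exact hcond.2
            _ = R * (r ^ d * r ^ m0 * lam) := by ring
            _ ≤ R * (R * l k) := by gcongr
            _ = _ := by ring
        have hrd1 : r ^ d ≤ 1 := pow_le_one₀ hr0.le hr1.le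
        have hpr : (10 : ℝ) ≤ p := by exact_mod_cast hp
        have h2R : (2 / R : ℝ) ^ d = (r ^ d) ^ (1 - 1 / (p : ℝ)) := by
          have h1 : (2 / R : ℝ) = r ^ (1 - 1 / (p : ℝ)) := by
            have h2 : (R : ℝ) ^ (1 / (p : ℝ)) = 2 := by
              rw [hRr, ← Real.rpow_natCast, ← Real.rpow_mul (by norm_num)]
              have : (p : ℝ) * (1 / p) = 1 := by field_simp
              rw [this, Real.rpow_one]
            rw [Real.rpow_sub hr0, Real.rpow_one, hr, Real.inv_rpow hR0.le, h2]
            field_simp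
          rw [h1, ← Real.rpow_natCast, ← Real.rpow_natCast, ← Real.rpow_mul hr0.le,
            ← Real.rpow_mul hr0.le, mul_comm]
        have hfin : (2 / R : ℝ) ^ d ≤ R ^ 2 * (l k / X k) ^ (9 / 10 : ℝ) := by
          rw [h2R]
          calc (r ^ d) ^ (1 - 1 / (p : ℝ)) ≤ (r ^ d) ^ (9 / 10 : ℝ) := by
                apply Real.rpow_le_rpow_of_exponent_ge (by positivity) hrd1
                have : 1 / (p : ℝ) ≤ 1 / 10 := by gcongr
                linarith
            _ ≤ (R ^ 2 * (l k / X k)) ^ (9 / 10 : ℝ) := by gcongr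
            _ = ((R : ℝ) ^ 2) ^ (9 / 10 : ℝ) * (l k / X k) ^ (9 / 10 : ℝ) :=
                Real.mul_rpow (by positivity) (by positivity)
            _ ≤ ((R : ℝ) ^ 2) ^ (1 : ℝ) * (l k / X k) ^ (9 / 10 : ℝ) := by
                have : (1 : ℝ) ≤ (R : ℝ) ^ 2 := one_le_pow₀ hR1024.le
                gcongr
                norm_num
            _ = _ := by rw [Real.rpow_one]
        have hNk := hN k
        calc 3 * N k * (2 / R : ℝ) ^ d ≤ 3 * N k * (R ^ 2 * (l k / X k) ^ (9 / 10 : ℝ)) := by gcongr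
          _ = _ := by ring
      · rw [if_neg hk]; exact zero_le
    refine (ENNReal.tsum_le_tsum hterm).trans ?_
    rw [ENNReal.tsum_mul_left]
    refine (mul_le_mul_right (A3 (lam * r ^ m0) (by positivity)) _).trans ?_
    rw [← ENNReal.ofReal_mul (by positivity)]
    have e6 : (1 / 6 : ENNReal) = ENNReal.ofReal (1 / 6) := by
      rw [ENNReal.ofReal_div_of_pos (by norm_num)]; simp
    rw [e6]
    apply ENNReal.ofReal_le_ofReal
    apply le_of_eq
    field_simp
    norm_num


/-- Analytic data of a nondegenerate planar curve `(u, v)` on `Icc x0 (x0 + lam)`. -/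
structure CurveData (x0 lam M : ℝ) (u v u1 v1 u2 v2 : ℝ → ℝ) : Prop where
  hu : ∀ s ∈ Icc x0 (x0 + lam), HasDerivAt u (u1 s) s
  hv : ∀ s ∈ Icc x0 (x0 + lam), HasDerivAt v (v1 s) s
  hu1 : ∀ s ∈ Icc x0 (x0 + lam), HasDerivAt u1 (u2 s) s
  hv1 : ∀ s ∈ Icc x0 (x0 + lam), HasDerivAt v1 (v2 s) s
  M1 : 1 ≤ M
  lam0 : 0 < lam
  bu1 : ∀ s ∈ Icc x0 (x0 + lam), |u1 s| ≤ M
  bv1 : ∀ s ∈ Icc x0 (x0 + lam), |v1 s| ≤ M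
  bu2 : ∀ s ∈ Icc x0 (x0 + lam), |u2 s| ≤ M
  bv2 : ∀ s ∈ Icc x0 (x0 + lam), |v2 s| ≤ M
  lv1 : ∀ s ∈ Icc x0 (x0 + lam), 1 ≤ M * |v1 s|
  sv1 : (∀ s ∈ Icc x0 (x0 + lam), 0 < v1 s) ∨ (∀ s ∈ Icc x0 (x0 + lam), v1 s < 0)
  lW : ∀ s ∈ Icc x0 (x0 + lam), 1 ≤ M * |u1 s * v2 s - u2 s * v1 s|

/-- mean value theorem in a symmetric form -/
theorem mvt_sym {x0 x1 : ℝ} {g g' : ℝ → ℝ} (hg : ∀ s ∈ Icc x0 x1, HasDerivAt g (g' s) s)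
    {s t : ℝ} (hs : s ∈ Icc x0 x1) (ht : t ∈ Icc x0 x1) :
    ∃ ξ ∈ Icc x0 x1, g s - g t = g' ξ * (s - t) ∧ ξ ∈ uIcc s t := by
  rcases lt_trichotomy s t with h | h | h
  · obtain ⟨ξ, hξ, he⟩ := exists_hasDerivAt_eq_slope g g' h
      (fun z hz => (hg z ⟨hs.1.trans hz.1, hz.2.trans ht.2⟩).continuousAt.continuousWithinAt)
      (fun z hz => hg z ⟨hs.1.trans hz.1.le, hz.2.le.trans ht.2⟩)
    refine ⟨ξ, ⟨hs.1.trans hξ.1.le, hξ.2.le.trans ht.2⟩, ?_, ?_⟩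
    · rw [he]; have : t - s ≠ 0 := by linarith
      field_simp; ring
    · rw [uIcc_of_le h.le]; exact ⟨hξ.1.le, hξ.2.le⟩
  · subst h; exact ⟨s, hs, by simp, by simp⟩
  · obtain ⟨ξ, hξ, he⟩ := exists_hasDerivAt_eq_slope g g' h
      (fun z hz => (hg z ⟨ht.1.trans hz.1, hz.2.trans hs.2⟩).continuousAt.continuousWithinAt)
      (fun z hz => hg z ⟨ht.1.trans hz.1.le, hz.2.le.trans hs.2⟩)
    refine ⟨ξ, ⟨ht.1.trans hξ.1.le, hξ.2.le.trans hs.2⟩, ?_, ?_⟩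
    · rw [he]; have : s - t ≠ 0 := by linarith
      field_simp
    · rw [uIcc_comm, uIcc_of_le h.le]; exact ⟨hξ.1.le, hξ.2.le⟩

theorem mvt_bound {x0 x1 M : ℝ} {g g' : ℝ → ℝ} (hg : ∀ s ∈ Icc x0 x1, HasDerivAt g (g' s) s)
    (hM : ∀ s ∈ Icc x0 x1, |g' s| ≤ M)
    {s t : ℝ} (hs : s ∈ Icc x0 x1) (ht : t ∈ Icc x0 x1) : |g s - g t| ≤ M * |s - t| := by
  obtain ⟨ξ, hξ, he, -⟩ := mvt_sym hg hs ht
  rw [he, abs_mul]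
  have := hM ξ hξ
  gcongr

theorem mvt_lower {x0 x1 M : ℝ} {g g' : ℝ → ℝ} (hg : ∀ s ∈ Icc x0 x1, HasDerivAt g (g' s) s)
    (hM : ∀ s ∈ Icc x0 x1, 1 ≤ M * |g' s|)
    {s t : ℝ} (hs : s ∈ Icc x0 x1) (ht : t ∈ Icc x0 x1) : |s - t| ≤ M * |g s - g t| := by
  obtain ⟨ξ, hξ, he, -⟩ := mvt_sym hg hs ht
  rw [he, abs_mul, ← mul_assoc]
  have := hM ξ hξ
  nlinarith [abs_nonneg (s - t)]

theorem CurveData.bB {x0 lam M : ℝ} {u v u1 v1 u2 v2 : ℝ → ℝ} (h : CurveData x0 lam M u v u1 v1 u2 v2)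
    {s : ℝ} (hs : s ∈ Icc x0 (x0 + lam)) (A B : ℝ) :
    |B| ≤ M * (|A * u1 s + B * v1 s| + M * |A|) := by
  have h1 := h.lv1 s hs
  have h2 := h.bu1 s hs
  have h3 : |B| ≤ M * |B * v1 s| := by
    rw [abs_mul]; nlinarith [abs_nonneg B]
  have h4 : |B * v1 s| ≤ |A * u1 s + B * v1 s| + |A * u1 s| := by
    have e : B * v1 s = (A * u1 s + B * v1 s) - A * u1 s := by ring
    calc |B * v1 s| = |(A * u1 s + B * v1 s) - A * u1 s| := by rw [← e]
      _ ≤ _ := abs_sub _ _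
  have h5 : |A * u1 s| ≤ M * |A| := by
    rw [abs_mul]; nlinarith [abs_nonneg A]
  have := h.M1
  calc |B| ≤ M * |B * v1 s| := h3
    _ ≤ _ := by gcongr; linarith

theorem CurveData.derivF {x0 lam M : ℝ} {u v u1 v1 u2 v2 : ℝ → ℝ}
    (h : CurveData x0 lam M u v u1 v1 u2 v2) (A B C : ℝ) :
    ∀ s ∈ Icc x0 (x0 + lam), HasDerivAt (fun s => A * u s + B * v s + C) (A * u1 s + B * v1 s) s :=
  fun s hs => (((h.hu s hs).const_mul A).add ((h.hv s hs).const_mul B)).add_const C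

theorem CurveData.derivT {x0 lam M : ℝ} {u v u1 v1 u2 v2 : ℝ → ℝ}
    (h : CurveData x0 lam M u v u1 v1 u2 v2) (A B : ℝ) :
    ∀ s ∈ Icc x0 (x0 + lam), HasDerivAt (fun s => A * u1 s + B * v1 s) (A * u2 s + B * v2 s) s :=
  fun s hs => ((h.hu1 s hs).const_mul A).add ((h.hv1 s hs).const_mul B)

theorem CurveData.varT {x0 lam M : ℝ} {u v u1 v1 u2 v2 : ℝ → ℝ}
    (h : CurveData x0 lam M u v u1 v1 u2 v2) (A B : ℝ) {s t : ℝ} (hs : s ∈ Icc x0 (x0 + lam))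
    (ht : t ∈ Icc x0 (x0 + lam)) :
    |(A * u1 s + B * v1 s) - (A * u1 t + B * v1 t)| ≤ M * (|A| + |B|) * |s - t| := by
  refine mvt_bound (h.derivT A B) (fun z hz => ?_) hs ht
  have h1 := h.bu2 z hz
  have h2 := h.bv2 z hz
  calc |A * u2 z + B * v2 z| ≤ |A * u2 z| + |B * v2 z| := abs_add_le _ _
    _ = |A| * |u2 z| + |B| * |v2 z| := by rw [abs_mul, abs_mul]
    _ ≤ |A| * M + |B| * M := by gcongr
    _ = _ := by ring

/-- class 0 -/
def Bad0 (v : ℝ → ℝ) (κ0 : ℝ) (b : ℕ) : Set ℝ :=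
  {s | ∃ B C : ℤ, (2 : ℝ) ^ b ≤ |(B : ℝ)| ∧ |(B : ℝ)| < 2 ^ (b + 1) ∧ |B * v s + C| ≤ κ0 / 2 ^ b}

/-- class T -/
def BadT (u v u1 v1 : ℝ → ℝ) (κT D0 : ℝ) (a : ℕ) : Set ℝ :=
  {s | ∃ A B C : ℤ, (2 : ℝ) ^ a ≤ |(A : ℝ)| ∧ |(A : ℝ)| < 2 ^ (a + 1) ∧
    |A * u s + B * v s + C| ≤ κT / 2 ^ a ∧ |A * u1 s + B * v1 s| ≤ D0}

theorem class0_two {x0 lam M : ℝ} {u v u1 v1 u2 v2 : ℝ → ℝ}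
    (h : CurveData x0 lam M u v u1 v1 u2 v2) {κ0 ε0 : ℝ} (hκ : 0 < κ0) (hc : 4 * κ0 + 4 * M * ε0 < 1)
    (b : ℕ) {s t : ℝ} (hs : s ∈ Icc x0 (x0 + lam)) (ht : t ∈ Icc x0 (x0 + lam))
    (hst : |s - t| ≤ ε0 / 4 ^ b) (hsB : s ∈ Bad0 v κ0 b) (htB : t ∈ Bad0 v κ0 b) :
    |s - t| ≤ 2 * M * κ0 / 4 ^ b := by
  obtain ⟨B, C, hB1, hB2, hF⟩ := hsB
  obtain ⟨B', C', hB1', hB2', hF'⟩ := htB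
  have hv := mvt_bound h.hv h.bv1 hs ht
  have hM := h.M1
  have h4 : (4 : ℝ) ^ b = 2 ^ b * 2 ^ b := by rw [← mul_pow]; norm_num
  rw [pow_succ] at hB2 hB2'
  rw [h4] at hst ⊢
  clear h4
  have hQ : (0 : ℝ) < 2 ^ b := by positivity
  generalize (2 : ℝ) ^ b = Q at *
  rw [le_div_iff₀ hQ] at hF hF'
  rw [le_div_iff₀ (by positivity)] at hst ⊢
  have hdet : B * C' - B' * C = 0 := by
    by_contra hne
    have h1 : (1 : ℝ) ≤ |((B * C' - B' * C : ℤ) : ℝ)| := by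
      rw [← Int.cast_abs]; exact_mod_cast Int.one_le_abs hne
    have h2 : ((B * C' - B' * C : ℤ) : ℝ) =
        B * (B' * v t + C') - B' * (B * v s + C) + B * B' * (v s - v t) := by push_cast; ring
    have h3 : |((B * C' - B' * C : ℤ) : ℝ)| ≤
        |(B : ℝ)| * |B' * v t + C'| + |(B' : ℝ)| * |B * v s + C| + |(B : ℝ)| * |(B' : ℝ)| * |v s - v t| := by
      rw [h2, ← abs_mul, ← abs_mul, ← abs_mul, ← abs_mul]
      refine (abs_add_le _ _).trans ?_
      gcongr
      exact abs_sub _ _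
    have e1 : |(B : ℝ)| * |B' * v t + C'| ≤ 2 * κ0 := by
      calc |(B : ℝ)| * |B' * v t + C'| ≤ (Q * 2) * |B' * v t + C'| := by gcongr
        _ ≤ 2 * κ0 := by linarith
    have e2 : |(B' : ℝ)| * |B * v s + C| ≤ 2 * κ0 := by
      calc |(B' : ℝ)| * |B * v s + C| ≤ (Q * 2) * |B * v s + C| := by gcongr
        _ ≤ 2 * κ0 := by linarith
    have e3 : |(B : ℝ)| * |(B' : ℝ)| * |v s - v t| ≤ 4 * M * ε0 := by
      calc |(B : ℝ)| * |(B' : ℝ)| * |v s - v t| ≤ (Q * 2) * (Q * 2) * (M * |s - t|) := by gcongr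
        _ = 4 * M * (|s - t| * (Q * Q)) := by ring
        _ ≤ _ := by gcongr
    linarith
  have hdet' : (B : ℝ) * C' = B' * C := by
    have : B * C' = B' * C := by linarith
    exact_mod_cast this
  have h5 : |s - t| ≤ M * |v s - v t| := mvt_lower h.hv h.lv1 hs ht
  have h6 : |v s - v t| * (Q * Q) ≤ 2 * κ0 := by
    have e : (B : ℝ) * B' * (v s - v t) = B' * (B * v s + C) - B * (B' * v t + C') := by
      linear_combination hdet'
    have e1 : |(B : ℝ)| * |(B' : ℝ)| * |v s - v t| ≤ |(B' : ℝ)| * |B * v s + C| + |(B : ℝ)| * |B' * v t + C'| := by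
      rw [← abs_mul, ← abs_mul, e, ← abs_mul, ← abs_mul]; exact abs_sub _ _
    have e2 : |v s - v t| ≤ |B * v s + C| / |(B : ℝ)| + |B' * v t + C'| / |(B' : ℝ)| := by
      rw [div_add_div _ _ (by linarith) (by linarith), le_div_iff₀ (mul_pos (by linarith) (by linarith))]
      linarith
    have e3 : |B * v s + C| / |(B : ℝ)| ≤ κ0 / (Q * Q) := by
      rw [div_le_div_iff₀ (by linarith) (by positivity)]
      calc |B * v s + C| * (Q * Q) = (|B * v s + C| * Q) * Q := by ring
        _ ≤ κ0 * |(B : ℝ)| := by gcongr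
    have e4 : |B' * v t + C'| / |(B' : ℝ)| ≤ κ0 / (Q * Q) := by
      rw [div_le_div_iff₀ (by linarith) (by positivity)]
      calc |B' * v t + C'| * (Q * Q) = (|B' * v t + C'| * Q) * Q := by ring
        _ ≤ κ0 * |(B' : ℝ)| := by gcongr
    have e5 : |v s - v t| ≤ 2 * κ0 / (Q * Q) := by
      calc |v s - v t| ≤ κ0 / (Q * Q) + κ0 / (Q * Q) := by linarith
        _ = _ := by ring
    rwa [le_div_iff₀ (by positivity)] at e5
  calc |s - t| * (Q * Q) ≤ M * |v s - v t| * (Q * Q) := by gcongr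
    _ = M * (|v s - v t| * (Q * Q)) := by ring
    _ ≤ M * (2 * κ0) := by gcongr
    _ = _ := by ring


theorem exists_normal {ι : Type} (x y z : ι → ℝ)
    (hdet : ∀ i j k, x i * (y j * z k - z j * y k) - y i * (x j * z k - z j * x k)
      + z i * (x j * y k - y j * x k) = 0) :
    ∃ a b c : ℝ, (a ≠ 0 ∨ b ≠ 0 ∨ c ≠ 0) ∧ ∀ i, a * x i + b * y i + c * z i = 0 := by
  by_cases h1 : ∃ j k, (y j * z k - z j * y k ≠ 0 ∨ x j * z k - z j * x k ≠ 0 ∨ x j * y k - y j * x k ≠ 0)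
  · obtain ⟨j, k, h⟩ := h1
    refine ⟨y j * z k - z j * y k, -(x j * z k - z j * x k), x j * y k - y j * x k, ?_, fun i => ?_⟩
    · rcases h with h | h | h
      · exact Or.inl h
      · exact Or.inr (Or.inl (neg_ne_zero.2 h))
      · exact Or.inr (Or.inr h)
    · linear_combination hdet i j k
  · push Not at h1
    by_cases h2 : ∃ i, (x i ≠ 0 ∨ y i ≠ 0 ∨ z i ≠ 0)
    · obtain ⟨i, h⟩ := h2
      by_cases hx : x i = 0 ∧ y i = 0
      · refine ⟨1, 0, 0, Or.inl one_ne_zero, fun k => ?_⟩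
        have hz : z i ≠ 0 := by
          rcases h with h | h | h
          · exact absurd hx.1 h
          · exact absurd hx.2 h
          · exact h
        have := (h1 i k).2.1
        rw [hx.1] at this
        have h3 : z i * x k = 0 := by linarith
        rcases mul_eq_zero.1 h3 with h3 | h3
        · exact absurd h3 hz
        · rw [h3]; ring
      · refine ⟨y i, - x i, 0, ?_, fun k => ?_⟩
        · by_contra hcon
          push Not at hcon
          exact hx ⟨by linarith [hcon.2.1], hcon.1⟩
        · linear_combination -(h1 i k).2.2
    · push Not at h2
      exact ⟨1, 0, 0, Or.inl one_ne_zero, fun i => by rw [(h2 i).1]; ring⟩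

theorem abs_det_le (x1 y1 z1 x2 y2 z2 x3 y3 z3 P Q Z : ℝ)
    (hx1 : |x1| ≤ P) (hx2 : |x2| ≤ P) (hx3 : |x3| ≤ P)
    (hy1 : |y1| ≤ Q) (hy2 : |y2| ≤ Q) (hy3 : |y3| ≤ Q)
    (hz1 : |z1| ≤ Z) (hz2 : |z2| ≤ Z) (hz3 : |z3| ≤ Z) :
    |x1 * (y2 * z3 - z2 * y3) - y1 * (x2 * z3 - z2 * x3) + z1 * (x2 * y3 - y2 * x3)| ≤ 6 * P * Q * Z := by
  have key : ∀ x y z : ℝ, |x| ≤ P → |y| ≤ Q → |z| ≤ Z → |x * y * z| ≤ P * Q * Z := by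
    intro x y z hx hy hz
    rw [abs_mul, abs_mul]
    have := (abs_nonneg x).trans hx
    have := (abs_nonneg y).trans hy
    gcongr
  have a1 := abs_le.1 (key x1 y2 z3 hx1 hy2 hz3)
  have a2 := abs_le.1 (key x1 y3 z2 hx1 hy3 hz2)
  have a3 := abs_le.1 (key x2 y1 z3 hx2 hy1 hz3)
  have a4 := abs_le.1 (key x3 y1 z2 hx3 hy1 hz2)
  have a5 := abs_le.1 (key x2 y3 z1 hx2 hy3 hz1)
  have a6 := abs_le.1 (key x3 y2 z1 hx3 hy2 hz1)
  rw [abs_le]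
  constructor <;> nlinarith

/-- Vanishing of integer determinants. -/
theorem CurveData.det_zero {x0 lam M : ℝ} {u v u1 v1 u2 v2 : ℝ → ℝ}
    (h : CurveData x0 lam M u v u1 v1 u2 v2) {s0 : ℝ} (hs0 : s0 ∈ Icc x0 (x0 + lam))
    {ι : Type} (A B C : ι → ℤ) (P Q Z : ℝ) (hsmall : M * (6 * P * Q * Z) < 1)
    (hA : ∀ k, |(A k : ℝ)| ≤ P) (hT : ∀ k, |A k * u1 s0 + B k * v1 s0| ≤ Q)
    (hF : ∀ k, |A k * u s0 + B k * v s0 + C k| ≤ Z) (i j k : ι) :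
    (A i : ℝ) * (B j * C k - C j * B k) - B i * (A j * C k - C j * A k)
      + C i * (A j * B k - B j * A k) = 0 := by
  have h1 := abs_det_le _ _ _ _ _ _ _ _ _ P Q Z (hA i) (hA j) (hA k) (hT i) (hT j) (hT k)
    (hF i) (hF j) (hF k)
  set d : ℤ := A i * (B j * C k - C j * B k) - B i * (A j * C k - C j * A k)
      + C i * (A j * B k - B j * A k) with hd
  have hdr : (A i : ℝ) * (B j * C k - C j * B k) - B i * (A j * C k - C j * A k)
      + C i * (A j * B k - B j * A k) = (d : ℝ) := by rw [hd]; push_cast; ring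
  rw [hdr]
  have e : (A i : ℝ) * ((A j * u1 s0 + B j * v1 s0) * (A k * u s0 + B k * v s0 + C k) -
      (A j * u s0 + B j * v s0 + C j) * (A k * u1 s0 + B k * v1 s0)) -
      (A i * u1 s0 + B i * v1 s0) * (A j * (A k * u s0 + B k * v s0 + C k) -
      (A j * u s0 + B j * v s0 + C j) * A k) + (A i * u s0 + B i * v s0 + C i) *
      (A j * (A k * u1 s0 + B k * v1 s0) - (A j * u1 s0 + B j * v1 s0) * A k) = v1 s0 * d := by
    rw [← hdr]; ring
  rw [e, abs_mul] at h1
  by_contra hne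
  have hd0 : d ≠ 0 := by intro h0; exact hne (by rw [h0]; simp)
  have h2 : (1 : ℝ) ≤ |(d : ℝ)| := by
    rw [← Int.cast_abs]; exact_mod_cast Int.one_le_abs hd0
  have h3 := h.lv1 s0 hs0
  have hM := h.M1
  have h4 : M * (|v1 s0| * |(d : ℝ)|) ≤ M * (6 * P * Q * Z) := by gcongr
  nlinarith [abs_nonneg (d : ℝ)]

/-- The auxiliary function and its derivative. -/
theorem CurveData.derivG {x0 lam M : ℝ} {u v u1 v1 u2 v2 : ℝ → ℝ}
    (h : CurveData x0 lam M u v u1 v1 u2 v2) (P1 P2 q : ℝ) :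
    ∀ s ∈ Icc x0 (x0 + lam), HasDerivAt (fun s => (q * u s - P1) - (q * v s - P2) * u1 s / v1 s)
      ((q * v s - P2) * (u1 s * v2 s - u2 s * v1 s) / v1 s ^ 2) s := by
  intro s hs
  have hv0 : v1 s ≠ 0 := by
    intro h0; have := h.lv1 s hs; rw [h0] at this; simp at this; linarith
  have h1 := (((h.hu s hs).const_mul q).sub_const P1).sub
    (((((h.hv s hs).const_mul q).sub_const P2).mul (h.hu1 s hs)).div (h.hv1 s hs) hv0)
  refine h1.congr_deriv ?_
  simp only [Pi.mul_apply]
  field_simp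
  ring

theorem CurveData.Gbound {x0 lam M : ℝ} {u v u1 v1 u2 v2 : ℝ → ℝ}
    (h : CurveData x0 lam M u v u1 v1 u2 v2) {s : ℝ} (hs : s ∈ Icc x0 (x0 + lam))
    (A B C P1 P2 q D0 κT α : ℝ) (hα : 0 < α) (hA : α ≤ |A|) (hP : P1 * A + P2 * B + q * C = 0)
    (hT : |A * u1 s + B * v1 s| ≤ D0) (hF : |A * u s + B * v s + C| ≤ κT / α) (hκ : κT ≤ D0 ^ 2) :
    |(q * u s - P1) - (q * v s - P2) * u1 s / v1 s| ≤
      M * (D0 / α) * |q * v s - P2| + |q| * (D0 / α) ^ 2 := by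
  have hv0 : v1 s ≠ 0 := by
    intro h0; have := h.lv1 s hs; rw [h0] at this; simp at this; linarith
  have hvp : 0 < |v1 s| := abs_pos.2 hv0
  have hD0 : 0 ≤ D0 := (abs_nonneg _).trans hT
  have hA0 : A ≠ 0 := by intro h0; rw [h0] at hA; simp at hA; linarith
  set g := (q * u s - P1) - (q * v s - P2) * u1 s / v1 s with hg
  have e : A * g = q * (A * u s + B * v s + C) - (q * v s - P2) * (A * u1 s + B * v1 s) / v1 s := by
    rw [hg]; field_simp; linear_combination (-(v1 s)) * hP
  have h1 : |A| * |g| ≤ |q| * (κT / α) + |q * v s - P2| * (D0 * M) := by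
    rw [← abs_mul, e]
    refine (abs_sub _ _).trans ?_
    gcongr
    · rw [abs_mul]; gcongr
    · rw [mul_div_assoc, abs_mul, abs_div]
      gcongr
      rw [div_le_iff₀ hvp]
      have := h.lv1 s hs
      calc |A * u1 s + B * v1 s| ≤ D0 * 1 := by linarith
        _ ≤ D0 * (M * |v1 s|) := by gcongr
        _ = _ := by ring
  have h2 : α * |g| ≤ |q| * (D0 ^ 2 / α) + |q * v s - P2| * (D0 * M) := by
    calc α * |g| ≤ |A| * |g| := by gcongr
      _ ≤ _ := h1
      _ ≤ _ := by gcongr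
  calc |g| = α * |g| / α := by field_simp
    _ ≤ (|q| * (D0 ^ 2 / α) + |q * v s - P2| * (D0 * M)) / α := by gcongr
    _ = _ := by field_simp; ring

theorem CurveData.groupQ0 {x0 lam M : ℝ} {u v u1 v1 u2 v2 : ℝ → ℝ}
    (h : CurveData x0 lam M u v u1 v1 u2 v2) {s t : ℝ} (hs : s ∈ Icc x0 (x0 + lam))
    (ht : t ∈ Icc x0 (x0 + lam)) (P1 P2 δ : ℝ) (hP2 : P2 ≠ 0)
    (hGs : |(0 * u s - P1) - (0 * v s - P2) * u1 s / v1 s| ≤ M * δ * |0 * v s - P2| + |(0:ℝ)| * δ ^ 2)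
    (hGt : |(0 * u t - P1) - (0 * v t - P2) * u1 t / v1 t| ≤ M * δ * |0 * v t - P2| + |(0:ℝ)| * δ ^ 2) :
    |s - t| ≤ 2 * M ^ 4 * δ := by
  have hP : 0 < |P2| := abs_pos.2 hP2
  have h1 := mvt_lower (M := M ^ 3 / |P2|) (h.derivG P1 P2 0) (fun z hz => by
    have hM := h.M1
    have hz1 := h.lW z hz
    have hz2 := h.bv1 z hz
    have hz3 := h.lv1 z hz
    have hvp : 0 < |v1 z| := by
      by_contra hcon
      have : |v1 z| = 0 := le_antisymm (not_lt.1 hcon) (abs_nonneg _)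
      rw [this] at hz3; linarith
    rw [abs_div, abs_mul, abs_pow, zero_mul, zero_sub, abs_neg]
    generalize |u1 z * v2 z - u2 z * v1 z| = w at *
    have e : M ^ 3 / |P2| * (|P2| * w / |v1 z| ^ 2) = M ^ 3 * w / |v1 z| ^ 2 := by field_simp
    rw [e, le_div_iff₀ (by positivity), one_mul]
    calc |v1 z| ^ 2 ≤ M ^ 2 * 1 := by rw [mul_one]; gcongr
      _ ≤ M ^ 2 * (M * w) := by gcongr
      _ = _ := by ring) hs ht
  simp only [zero_mul, zero_sub, abs_neg, abs_zero, add_zero] at *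
  have hM := h.M1
  refine h1.trans ?_
  calc M ^ 3 / |P2| * |(-P1 - -P2 * u1 s / v1 s) - (-P1 - -P2 * u1 t / v1 t)|
      ≤ M ^ 3 / |P2| * (M * δ * |P2| + M * δ * |P2|) := by
        gcongr
        refine (abs_sub _ _).trans ?_
        gcongr
    _ = _ := by field_simp; ring

theorem CurveData.groupSmall {x0 lam M : ℝ} {u v u1 v1 u2 v2 : ℝ → ℝ}
    (h : CurveData x0 lam M u v u1 v1 u2 v2) {s t : ℝ} (hs : s ∈ Icc x0 (x0 + lam))
    (ht : t ∈ Icc x0 (x0 + lam)) (P2 δ : ℝ) (h1 : |v s - P2| ≤ δ) (h2 : |v t - P2| ≤ δ) :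
    |s - t| ≤ 2 * M * δ := by
  have h3 := mvt_lower h.hv h.lv1 hs ht
  have hM := h.M1
  have e : |v s - v t| ≤ 2 * δ := by
    have : v s - v t = (v s - P2) - (v t - P2) := by ring
    rw [this]
    refine (abs_sub _ _).trans ?_
    linarith
  calc |s - t| ≤ M * |v s - v t| := h3
    _ ≤ M * (2 * δ) := by gcongr
    _ = _ := by ring

theorem CurveData.between {x0 lam M : ℝ} {u v u1 v1 u2 v2 : ℝ → ℝ}
    (h : CurveData x0 lam M u v u1 v1 u2 v2) {s t ξ : ℝ} (hs : s ∈ Icc x0 (x0 + lam))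
    (ht : t ∈ Icc x0 (x0 + lam)) (hsξ : s ≤ ξ) (hξt : ξ ≤ t) :
    (v s ≤ v ξ ∧ v ξ ≤ v t) ∨ (v t ≤ v ξ ∧ v ξ ≤ v s) := by
  have hξ : ξ ∈ Icc x0 (x0 + lam) := ⟨hs.1.trans hsξ, hξt.trans ht.2⟩
  obtain ⟨a, ha, hae, -⟩ := mvt_sym h.hv hξ hs
  obtain ⟨b, hb, hbe, -⟩ := mvt_sym h.hv ht hξ
  rcases h.sv1 with h1 | h1
  · left
    have := h1 a ha
    have := h1 b hb
    constructor <;> nlinarith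
  · right
    have := h1 a ha
    have := h1 b hb
    constructor <;> nlinarith

theorem CurveData.groupBig {x0 lam M : ℝ} {u v u1 v1 u2 v2 : ℝ → ℝ}
    (h : CurveData x0 lam M u v u1 v1 u2 v2) {s t : ℝ} (hs : s ∈ Icc x0 (x0 + lam))
    (ht : t ∈ Icc x0 (x0 + lam)) (P1 P2 δ : ℝ) (hδ : 0 < δ) (hst : s < t)
    (hsgn : (δ < v s - P2 ∧ δ < v t - P2) ∨ (v s - P2 < -δ ∧ v t - P2 < -δ))
    (hGs : |(1 * u s - P1) - (1 * v s - P2) * u1 s / v1 s| ≤ M * δ * |1 * v s - P2| + |(1:ℝ)| * δ ^ 2)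
    (hGt : |(1 * u t - P1) - (1 * v t - P2) * u1 t / v1 t| ≤ M * δ * |1 * v t - P2| + |(1:ℝ)| * δ ^ 2) :
    |s - t| ≤ 4 * M ^ 6 * δ := by
  have hM := h.M1
  have hin : ∀ z ∈ Icc s t, z ∈ Icc x0 (x0 + lam) := fun z hz => ⟨hs.1.trans hz.1, hz.2.trans ht.2⟩
  have dH : ∀ z ∈ Icc x0 (x0 + lam), HasDerivAt (fun z => (v z - P2) ^ 2) (2 * (v z - P2) * v1 z) z := by
    intro z hz
    have := ((h.hv z hz).sub_const P2).pow 2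
    refine this.congr_deriv ?_
    push_cast; ring
  obtain ⟨ξ, hξ, he⟩ := exists_ratio_hasDerivAt_eq_ratio_slope _ _ hst
    (fun z hz => (h.derivG P1 P2 1 z (hin z hz)).continuousAt.continuousWithinAt)
    (fun z hz => h.derivG P1 P2 1 z (hin z ⟨hz.1.le, hz.2.le⟩)) _ _
    (fun z hz => (dH z (hin z hz)).continuousAt.continuousWithinAt)
    (fun z hz => dH z (hin z ⟨hz.1.le, hz.2.le⟩))
  have hξI := hin ξ ⟨hξ.1.le, hξ.2.le⟩
  have hξ0 : v ξ - P2 ≠ 0 := by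
    rcases h.between hs ht hξ.1.le hξ.2.le with h1 | h1 <;> rcases hsgn with h2 | h2 <;>
      intro h3 <;> linarith [h1.1, h1.2, h2.1, h2.2]
  have hz1 := h.lW ξ hξI
  have hz2 := h.bv1 ξ hξI
  have hz3 := h.lv1 ξ hξI
  have hvp : 0 < |v1 ξ| := by
    by_contra hcon
    have : |v1 ξ| = 0 := le_antisymm (not_lt.1 hcon) (abs_nonneg _)
    rw [this] at hz3; linarith
  have hv0 : v1 ξ ≠ 0 := abs_pos.1 hvp
  simp only [one_mul, abs_one] at *
  set Gs := (u s - P1) - (v s - P2) * u1 s / v1 s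
  set Gt := (u t - P1) - (v t - P2) * u1 t / v1 t
  set W := u1 ξ * v2 ξ - u2 ξ * v1 ξ
  have he2 : ((v t - P2) ^ 2 - (v s - P2) ^ 2) * W = (Gt - Gs) * (2 * v1 ξ ^ 3) := by
    have e3 : ((v t - P2) ^ 2 - (v s - P2) ^ 2) * ((v ξ - P2) * W / v1 ξ ^ 2) * v1 ξ ^ 2 =
        (Gt - Gs) * (2 * (v ξ - P2) * v1 ξ) * v1 ξ ^ 2 := by rw [he]
    have e4 : ((v t - P2) ^ 2 - (v s - P2) ^ 2) * ((v ξ - P2) * W / v1 ξ ^ 2) * v1 ξ ^ 2 =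
        ((v t - P2) ^ 2 - (v s - P2) ^ 2) * W * (v ξ - P2) := by field_simp
    rw [e4] at e3
    apply mul_right_cancel₀ hξ0
    rw [e3]; ring
  have hΔ : |Gt - Gs| ≤ M * δ * (|v s - P2| + |v t - P2|) + 2 * δ ^ 2 := by
    refine (abs_sub _ _).trans ?_
    linarith
  have hsum : |v s - P2| + |v t - P2| = |(v t - P2) + (v s - P2)| := by
    rcases hsgn with h2 | h2
    · rw [abs_of_pos (by linarith [h2.1]), abs_of_pos (by linarith [h2.2]), abs_of_pos (by linarith [h2.1, h2.2])]; ring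
    · rw [abs_of_neg (by linarith [h2.1]), abs_of_neg (by linarith [h2.2]), abs_of_neg (by linarith [h2.1, h2.2])]; ring
  have hsum2 : 2 * δ ≤ |(v t - P2) + (v s - P2)| := by
    rcases hsgn with h2 | h2
    · rw [abs_of_pos (by linarith [h2.1, h2.2])]; linarith [h2.1, h2.2]
    · rw [abs_of_neg (by linarith [h2.1, h2.2])]; linarith [h2.1, h2.2]
  rw [hsum] at hΔ
  have he5 : |v s - v t| * |(v t - P2) + (v s - P2)| * |W| = |Gt - Gs| * (2 * |v1 ξ| ^ 3) := by
    have e6 : (v s - v t) * ((v t - P2) + (v s - P2)) * W = -((Gt - Gs) * (2 * v1 ξ ^ 3)) := by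
      rw [← he2]; ring
    have := congrArg abs e6
    rw [abs_neg, abs_mul, abs_mul, abs_mul (Gt - Gs), abs_mul 2, abs_pow, abs_two] at this
    exact this
  set m := |(v t - P2) + (v s - P2)|
  have hm : 0 < m := by linarith
  have h6 : |v s - v t| ≤ 4 * M ^ 5 * δ := by
    have e1 : |v s - v t| * m ≤ (4 * M ^ 5 * δ) * m := by
      calc |v s - v t| * m = |v s - v t| * m * 1 := by ring
        _ ≤ |v s - v t| * m * (M * |W|) := by gcongr
        _ = M * (|v s - v t| * m * |W|) := by ring
        _ = M * (|Gt - Gs| * (2 * |v1 ξ| ^ 3)) := by rw [he5]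
        _ ≤ M * ((M * δ * m + 2 * δ ^ 2) * (2 * M ^ 3)) := by gcongr
        _ ≤ M * ((M * δ * m + δ * m) * (2 * M ^ 3)) := by
            have : 2 * δ ^ 2 ≤ δ * m := by nlinarith
            gcongr
        _ ≤ M * ((M * δ * m + M * δ * m) * (2 * M ^ 3)) := by
            gcongr
            nlinarith [mul_pos hδ hm]
        _ = _ := by ring
    exact le_of_mul_le_mul_right e1 hm
  calc |s - t| ≤ M * |v s - v t| := mvt_lower h.hv h.lv1 hs ht
    _ ≤ M * (4 * M ^ 5 * δ) := by gcongr
    _ = _ := by ring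


theorem classT_four {x0 lam M : ℝ} {u v u1 v1 u2 v2 : ℝ → ℝ}
    (h : CurveData x0 lam M u v u1 v1 u2 v2) {κT D0 εT : ℝ} (hD0 : 0 < D0) (hD1 : D0 ≤ 1 / 2)
    (hκ0 : 0 < κT) (hκ : κT ≤ D0 ^ 2) (hε0 : 0 < εT) (hε : 10 * M ^ 3 * εT ≤ 1)
    (hdet : 12 * M * (κT + εT) < 1)
    (a : ℕ) (s : Fin 4 → ℝ) (hs : ∀ k, s k ∈ Icc x0 (x0 + lam))
    (hst : ∀ k k', |s k - s k'| ≤ εT / 2 ^ a) (hsB : ∀ k, s k ∈ BadT u v u1 v1 κT D0 a) :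
    ∃ k k', k ≠ k' ∧ |s k - s k'| ≤ 4 * M ^ 6 * D0 / 2 ^ a := by
  choose A B C hA1 hA2 hF hT using hsB
  have hM := h.M1
  have hα1 : (1 : ℝ) ≤ 2 ^ a := one_le_pow₀ (by norm_num)
  simp only [pow_succ] at hA2
  generalize (2 : ℝ) ^ a = α at *
  have hα : 0 < α := by linarith
  have hM3 : 1 ≤ M ^ 3 := one_le_pow₀ hM
  have hMM : M ≤ M ^ 3 := le_self_pow₀ hM (by norm_num)
  have hMM2 : M ^ 2 ≤ M ^ 3 := pow_le_pow_right₀ hM (by norm_num)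
  have hMB : ∀ k, M * (|(A k : ℝ)| + |(B k : ℝ)|) ≤ 5 * M ^ 3 * α := by
    intro k
    have h1 := h.bB (hs k) (A k) (B k)
    have h2 := hT k
    have h3 := (hA2 k).le
    have h4 : |(B k : ℝ)| ≤ M * (D0 + M * (α * 2)) := h1.trans (by gcongr)
    calc M * (|(A k : ℝ)| + |(B k : ℝ)|) ≤ M * (α * 2 + M * (1 / 2 + M * (α * 2))) := by
          gcongr; exact h4.trans (by gcongr)
      _ = 2 * M * α + M ^ 2 / 2 + 2 * M ^ 3 * α := by ring
      _ ≤ 2 * M ^ 3 * α + M ^ 3 * α + 2 * M ^ 3 * α := by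
          gcongr
          nlinarith
      _ = _ := by ring
  -- everything at the point s 0
  have hTz : ∀ k, ∀ z ∈ Icc x0 (x0 + lam), |z - s k| ≤ εT / α → |A k * u1 z + B k * v1 z| ≤ 1 := by
    intro k z hz hzs
    have h1 := h.varT (A k) (B k) hz (hs k)
    have h2 : M * (|(A k : ℝ)| + |(B k : ℝ)|) * |z - s k| ≤ 1 / 2 := by
      calc M * (|(A k : ℝ)| + |(B k : ℝ)|) * |z - s k| ≤ 5 * M ^ 3 * α * (εT / α) := by
            have := hMB k
            gcongr
        _ = 5 * M ^ 3 * εT := by field_simp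
        _ ≤ _ := by linarith
    have h3 := hT k
    have h4 := abs_sub_abs_le_abs_sub (A k * u1 z + B k * v1 z) (A k * u1 (s k) + B k * v1 (s k))
    linarith
  have hF0 : ∀ k, |A k * u (s 0) + B k * v (s 0) + C k| ≤ (κT + εT) / α := by
    intro k
    obtain ⟨ξ, hξ, he, hξu⟩ := mvt_sym (h.derivF (A k) (B k) (C k)) (hs 0) (hs k)
    have h1 : |ξ - s k| ≤ εT / α := by
      refine le_trans ?_ (hst 0 k)
      have := Set.abs_sub_left_of_mem_uIcc (uIcc_comm (s 0) (s k) ▸ hξu)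
      rw [abs_sub_comm (s 0)]
      rw [abs_sub_comm (s 0)] at this
      exact this
    have h2 := hTz k ξ hξ h1
    have h3 : |(A k * u (s 0) + B k * v (s 0) + C k) - (A k * u (s k) + B k * v (s k) + C k)| ≤ εT / α := by
      rw [he, abs_mul]
      calc |A k * u1 ξ + B k * v1 ξ| * |s 0 - s k| ≤ 1 * (εT / α) := by gcongr; exact hst 0 k
        _ = _ := one_mul _
    have h4 := abs_sub_abs_le_abs_sub (A k * u (s 0) + B k * v (s 0) + C k) (A k * u (s k) + B k * v (s k) + C k)
    have h5 := hF k
    rw [add_div]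
    linarith
  have hT0 : ∀ k, |A k * u1 (s 0) + B k * v1 (s 0)| ≤ 1 := fun k => hTz k (s 0) (hs 0) (hst 0 k)
  obtain ⟨P1, P2, q, hne, hP⟩ := exists_normal (fun k => (A k : ℝ)) (fun k => (B k : ℝ)) (fun k => (C k : ℝ))
    (h.det_zero (hs 0) A B C (2 * α) 1 ((κT + εT) / α) (by
      calc M * (6 * (2 * α) * 1 * ((κT + εT) / α)) = 12 * M * (κT + εT) := by field_simp; ring
        _ < 1 := hdet) (fun k => by have := hA2 k; linarith) hT0 hF0)
  have hδ : 0 < D0 / α := by positivity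
  have hM46 : M ^ 4 ≤ M ^ 6 := pow_le_pow_right₀ hM (by norm_num)
  have hM16 : M ≤ M ^ 6 := le_self_pow₀ hM (by norm_num)
  by_cases hq : q = 0
  · subst hq
    have hP2 : P2 ≠ 0 := by
      intro h0
      subst h0
      have h1 := hP 0
      simp only [zero_mul, add_zero] at h1
      have hA0 : (A 0 : ℝ) ≠ 0 := by
        intro h2; have := hA1 0; rw [h2] at this; simp at this; linarith
      rcases mul_eq_zero.1 h1 with h2 | h2
      · simp [h2] at hne
      · exact hA0 h2
    refine ⟨0, 1, by decide, ?_⟩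
    have hG : ∀ k, _ := fun k => h.Gbound (hs k) (A k) (B k) (C k) P1 P2 0 D0 κT α hα (hA1 k) (hP k) (hT k) (hF k) hκ
    have := h.groupQ0 (hs 0) (hs 1) P1 P2 (D0 / α) hP2 (hG 0) (hG 1)
    refine this.trans ?_
    calc 2 * M ^ 4 * (D0 / α) ≤ 4 * M ^ 6 * (D0 / α) := by gcongr; norm_num
      _ = _ := by ring
  · have hG : ∀ k, _ := fun k => h.Gbound (hs k) (A k) (B k) (C k) (P1 / q) (P2 / q) 1 D0 κT α hα (hA1 k)
      (by have := hP k; field_simp; linarith) (hT k) (hF k) hκ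
    let col : Fin 4 → Fin 3 := fun k =>
      if |v (s k) - P2 / q| ≤ D0 / α then 0 else if D0 / α < v (s k) - P2 / q then 1 else 2
    obtain ⟨k, k', hkk, hcol⟩ := Fintype.exists_ne_map_eq_of_card_lt col (by simp)
    have main : ∀ k k', col k = col k' → s k < s k' → |s k - s k'| ≤ 4 * M ^ 6 * D0 / α := by
      intro k k' hcol hlt
      have e : 4 * M ^ 6 * D0 / α = 4 * M ^ 6 * (D0 / α) := by ring
      rw [e]
      by_cases c1 : |v (s k) - P2 / q| ≤ D0 / α
      · have c2 : |v (s k') - P2 / q| ≤ D0 / α := by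
          by_contra hcon
          simp only [col, if_pos c1, if_neg hcon] at hcol
          split_ifs at hcol <;> exact absurd hcol (by decide)
        refine (h.groupSmall (hs k) (hs k') _ _ c1 c2).trans ?_
        gcongr
        norm_num
      · have c2 : ¬ |v (s k') - P2 / q| ≤ D0 / α := by
          intro hcon
          simp only [col, if_pos hcon, if_neg c1] at hcol
          split_ifs at hcol <;> exact absurd hcol (by decide)
        simp only [col, if_neg c1, if_neg c2] at hcol
        refine h.groupBig (hs k) (hs k') (P1 / q) (P2 / q) (D0 / α) hδ hlt ?_ (hG k) (hG k')
        rw [abs_le, not_and_or, not_le, not_le] at c1 c2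
        by_cases d1 : D0 / α < v (s k) - P2 / q
        · left
          refine ⟨d1, ?_⟩
          by_contra d2
          simp [d1, d2] at hcol
        · right
          have d2 : ¬ D0 / α < v (s k') - P2 / q := by
            intro d2; simp [d1, d2] at hcol
          exact ⟨c1.resolve_right d1, c2.resolve_right d2⟩
    refine ⟨k, k', hkk, ?_⟩
    rcases lt_trichotomy (s k) (s k') with hl | hl | hl
    · exact main k k' hcol hl
    · rw [hl, sub_self, abs_zero]; positivity
    · rw [abs_sub_comm]; exact main k' k hcol.symm hl

theorem card_le_of_no_inj (S : Finset ℝ) (n : ℕ)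
    (h : ∀ g : Fin (n + 1) → ℝ, Function.Injective g → (∀ k, g k ∈ S) → False) : S.card ≤ n := by
  by_contra hcon
  obtain ⟨T, hTS, hT⟩ := Finset.exists_subset_card_eq (show n + 1 ≤ S.card by omega)
  exact h (fun k => T.orderEmbOfFin hT k) (T.orderEmbOfFin hT).injective
    (fun k => hTS (Finset.orderEmbOfFin_mem T hT k))


/-- the gauge function -/
noncomputable def GG (ν μ α D : ℝ) : ℝ := max (α ^ ν) (α ^ (1 / 2 : ℝ) * D ^ μ)

theorem GG_mono {ν μ α D α' D' : ℝ} (hν : 0 ≤ ν) (hμ : 0 ≤ μ) (hα : 0 ≤ α) (hD : 0 ≤ D)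
    (h1 : α ≤ α') (h2 : D ≤ D') : GG ν μ α D ≤ GG ν μ α' D' := by
  unfold GG
  have hα' := hα.trans h1
  apply max_le_max
  · exact Real.rpow_le_rpow hα h1 hν
  · apply mul_le_mul (Real.rpow_le_rpow hα h1 (by norm_num)) (Real.rpow_le_rpow hD h2 hμ)
    · exact Real.rpow_nonneg hD _
    · exact Real.rpow_nonneg hα' _

theorem GG_pos {ν μ α D : ℝ} (hα : 0 < α) : 0 < GG ν μ α D :=
  lt_of_lt_of_le (Real.rpow_pos_of_pos hα _) (le_max_left _ _)

/-- class G -/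
def BadG (u v u1 v1 : ℝ → ℝ) (ν μ κ D0 : ℝ) (a d : ℕ) : Set ℝ :=
  {s | ∃ A B C : ℤ, (2 : ℝ) ^ a ≤ |(A : ℝ)| ∧ |(A : ℝ)| < 2 ^ (a + 1) ∧
    D0 * 2 ^ d ≤ |A * u1 s + B * v1 s| ∧ |A * u1 s + B * v1 s| < D0 * 2 ^ (d + 1) ∧
    |A * u s + B * v s + C| ≤ κ / GG ν μ (2 ^ a) (2 ^ d)}

theorem exists_dyadic {x : ℝ} (hx : 1 ≤ x) : ∃ n : ℕ, (2 : ℝ) ^ n ≤ x ∧ x < 2 ^ (n + 1) :=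
  exists_nat_pow_near hx (by norm_num)

theorem one_le_abs_int {A : ℤ} (h : A ≠ 0) : (1 : ℝ) ≤ |(A : ℝ)| := by
  rw [← Int.cast_abs]; exact_mod_cast Int.one_le_abs h

theorem no_small {x0 lam M : ℝ} {u v u1 v1 u2 v2 : ℝ → ℝ}
    (h : CurveData x0 lam M u v u1 v1 u2 v2) {ν μ κ0 κT κ D0 L y : ℝ} (hν : 0 ≤ ν) (hμ : 0 ≤ μ)
    (hκ0 : 0 < κ0) (hκT : 0 < κT) (hκ : 0 < κ) (hD0 : 0 < D0) (hL : 0 < L)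
    (al0 : ∀ b : ℕ, L ≤ 2 * M * κ0 / 4 ^ b → Disjoint (Icc y (y + L)) (Bad0 v κ0 b))
    (alT : ∀ a : ℕ, L ≤ 4 * M ^ 6 * D0 / 2 ^ a → Disjoint (Icc y (y + L)) (BadT u v u1 v1 κT D0 a))
    (alG : ∀ a d : ℕ, L ≤ 4 * κ / (GG ν μ (2 ^ a) (2 ^ d) * D0 * 2 ^ d) →
      Disjoint (Icc y (y + L)) (BadG u v u1 v1 ν μ κ D0 a d))
    {s0 : ℝ} (hs0 : s0 ∈ Icc x0 (x0 + lam)) (hsJ : s0 ∈ Icc y (y + L)) (A B C : ℤ)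
    (hne : ¬ (A = 0 ∧ B = 0 ∧ C = 0)) {Ab Tb Fb : ℝ}
    (hA : |(A : ℝ)| ≤ Ab) (hT : |A * u1 s0 + B * v1 s0| ≤ Tb) (hF : |A * u s0 + B * v s0 + C| ≤ Fb)
    (c1 : Fb < 1) (c2 : Fb * (M * Tb) ≤ κ0) (c3 : L * (M * Tb) ^ 2 ≤ 2 * M * κ0)
    (c4 : Fb * Ab ≤ κT) (c5 : L * Ab ≤ 4 * M ^ 6 * D0)
    (c6 : Fb * GG ν μ Ab (Tb / D0) ≤ κ) (c7 : L * GG ν μ Ab (Tb / D0) * Tb ≤ 4 * κ) : False := by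
  have hM := h.M1
  have hTb : 0 ≤ Tb := (abs_nonneg _).trans hT
  have hFb : 0 ≤ Fb := (abs_nonneg _).trans hF
  by_cases hA0 : A = 0
  · subst hA0
    have hB := h.bB hs0 0 B
    simp only [Int.cast_zero, zero_mul, zero_add, abs_zero, mul_zero, add_zero] at hB hT hF
    by_cases hB0 : B = 0
    · subst hB0
      have hC0 : C ≠ 0 := by rintro rfl; exact hne ⟨rfl, rfl, rfl⟩
      simp only [Int.cast_zero, zero_mul, zero_add] at hF
      have := one_le_abs_int hC0
      linarith
    · obtain ⟨b, hb1, hb2⟩ := exists_dyadic (one_le_abs_int hB0)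
      have hb3 : (2 : ℝ) ^ b ≤ M * Tb := hb1.trans (hB.trans (by gcongr))
      have hb0 : (0 : ℝ) < 2 ^ b := by positivity
      have h4 : (4 : ℝ) ^ b = (2 ^ b) ^ 2 := by rw [← pow_mul, mul_comm, pow_mul]; norm_num
      refine Set.disjoint_left.1 (al0 b ?_) hsJ ⟨B, C, hb1, hb2, hF.trans ?_⟩
      · rw [le_div_iff₀ (by positivity), h4]
        refine le_trans ?_ c3
        gcongr
      · rw [le_div_iff₀ hb0]
        exact le_trans (by gcongr) c2
  · obtain ⟨a, ha1, ha2⟩ := exists_dyadic (one_le_abs_int hA0)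
    have ha0 : (0 : ℝ) < 2 ^ a := by positivity
    by_cases hTD : |A * u1 s0 + B * v1 s0| ≤ D0
    · refine Set.disjoint_left.1 (alT a ?_) hsJ ⟨A, B, C, ha1, ha2, hF.trans ?_, hTD⟩
      · rw [le_div_iff₀ ha0]
        refine le_trans ?_ c5
        have := ha1.trans hA
        gcongr
      · rw [le_div_iff₀ ha0]
        refine le_trans ?_ c4
        have := ha1.trans hA
        gcongr
    · push Not at hTD
      obtain ⟨d, hd1, hd2⟩ := exists_dyadic (x := |A * u1 s0 + B * v1 s0| / D0)
        (by rw [le_div_iff₀ hD0]; linarith)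
      have hd0 : (0 : ℝ) < 2 ^ d := by positivity
      have hG := GG_mono hν hμ ha0.le hd0.le (ha1.trans hA) (hd1.trans (by gcongr : _ ≤ Tb / D0))
      have hGp : 0 < GG ν μ (2 ^ a) (2 ^ d) := GG_pos ha0
      rw [le_div_iff₀ hD0] at hd1
      rw [div_lt_iff₀ hD0] at hd2
      refine Set.disjoint_left.1 (alG a d ?_) hsJ ⟨A, B, C, ha1, ha2, by linarith, by linarith, hF.trans ?_⟩
      · rw [le_div_iff₀ (by positivity)]
        refine le_trans ?_ c7
        calc L * (GG ν μ (2 ^ a) (2 ^ d) * D0 * 2 ^ d) = L * GG ν μ (2 ^ a) (2 ^ d) * (2 ^ d * D0) := by ring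
          _ ≤ L * GG ν μ Ab (Tb / D0) * Tb := by
            have : 2 ^ d * D0 ≤ Tb := hd1.trans hT
            have := hGp.le.trans hG
            gcongr
      · rw [le_div_iff₀ hGp]
        exact le_trans (by gcongr) c6


/-- box index -/
theorem box_idx {x x' : ℝ} {m : ℕ} (hm : 0 < m) (hx : |x| ≤ 1) (hx' : |x'| ≤ 1)
    (h : min ⌊(x + 1) * m / 2⌋₊ (m - 1) = min ⌊(x' + 1) * m / 2⌋₊ (m - 1)) : |x - x'| ≤ 2 / m := by
  have hm' : (0 : ℝ) < m := by exact_mod_cast hm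
  rw [abs_le] at hx hx'
  have key : ∀ z : ℝ, -1 ≤ z → z ≤ 1 → ((min ⌊(z + 1) * m / 2⌋₊ (m - 1) : ℕ) : ℝ) ≤ (z + 1) * m / 2 ∧
      (z + 1) * m / 2 ≤ (min ⌊(z + 1) * m / 2⌋₊ (m - 1) : ℕ) + 1 := by
    intro z hz hz'
    have h0 : 0 ≤ (z + 1) * m / 2 := by
      have : 0 ≤ z + 1 := by linarith
      positivity
    constructor
    · refine le_trans ?_ (Nat.floor_le h0)
      exact_mod_cast min_le_left _ _
    · rcases le_total ⌊(z + 1) * m / 2⌋₊ (m - 1) with hc | hc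
      · rw [min_eq_left hc]; exact (Nat.lt_floor_add_one _).le
      · rw [min_eq_right hc]
        have : ((m - 1 : ℕ) : ℝ) + 1 = m := by exact_mod_cast Nat.sub_add_cancel hm
        rw [this]
        nlinarith
  have k1 := key x hx.1 hx.2
  have k2 := key x' hx'.1 hx'.2
  rw [h] at k1
  rw [le_div_iff₀ hm', ← abs_of_pos hm', ← abs_mul, abs_le]
  constructor <;> nlinarith

theorem pig2 {ι : Type} [Fintype ι] (x y : ι → ℝ) (m : ℕ) (hm : 0 < m) (hx : ∀ k, |x k| ≤ 1)
    (hy : ∀ k, |y k| ≤ 1) (hc : m ^ 2 < Fintype.card ι) :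
    ∃ k k', k ≠ k' ∧ |x k - x k'| ≤ 2 / m ∧ |y k - y k'| ≤ 2 / m := by
  obtain ⟨k, -, k', -, hne, he⟩ := Finset.exists_ne_map_eq_of_card_lt_of_maps_to
    (s := (Finset.univ : Finset ι)) (t := Finset.range m ×ˢ Finset.range m)
    (f := fun k => (min ⌊(x k + 1) * m / 2⌋₊ (m - 1), min ⌊(y k + 1) * m / 2⌋₊ (m - 1)))
    (by rw [Finset.card_product, Finset.card_range, Finset.card_univ]; nlinarith)
    (fun k _ => by simp only [Finset.coe_product, Finset.coe_range, mem_prod, mem_Iio]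
                   constructor <;> · have := min_le_right ⌊(x k + 1) * m / 2⌋₊ (m - 1)
                                     have := min_le_right ⌊(y k + 1) * m / 2⌋₊ (m - 1)
                                     omega)
  rw [Prod.mk.injEq] at he
  exact ⟨k, k', hne, box_idx hm (hx k) (hx k') he.1, box_idx hm (hy k) (hy k') he.2⟩

theorem plane_aux {a b c dx dy dz e : ℝ} (hc : c ≠ 0) (ha : |a| ≤ |c|) (hb : |b| ≤ |c|)
    (h : a * dx + b * dy + c * dz = 0) (h1 : |dx| ≤ e) (h2 : |dy| ≤ e) : |dz| ≤ 2 * e := by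
  have hc' := abs_pos.2 hc
  have : |c| * |dz| ≤ |c| * (2 * e) := by
    calc |c| * |dz| = |a * dx + b * dy| := by
          rw [← abs_mul, ← abs_neg]; congr 1; linarith
      _ ≤ |a| * |dx| + |b| * |dy| := by rw [← abs_mul, ← abs_mul]; exact abs_add_le _ _
      _ ≤ |c| * e + |c| * e := by gcongr
      _ = _ := by ring
  exact le_of_mul_le_mul_left this hc'

theorem plane_pigeon {ι : Type} [Fintype ι] (x y z : ι → ℝ) (m : ℕ) (hm : 0 < m) (hx : ∀ k, |x k| ≤ 1)
    (hy : ∀ k, |y k| ≤ 1) (hz : ∀ k, |z k| ≤ 1) (hc : m ^ 2 < Fintype.card ι) {a b c : ℝ}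
    (habc : a ≠ 0 ∨ b ≠ 0 ∨ c ≠ 0) (hp : ∀ k, a * x k + b * y k + c * z k = 0) :
    ∃ k k', k ≠ k' ∧ |x k - x k'| ≤ 4 / m ∧ |y k - y k'| ≤ 4 / m ∧ |z k - z k'| ≤ 4 / m := by
  have hm' : (0 : ℝ) < m := by exact_mod_cast hm
  have e1 : (2 : ℝ) / m ≤ 4 / m := by gcongr; norm_num
  have e2 : 2 * ((2 : ℝ) / m) = 4 / m := by ring
  have hd : ∀ k k', a * (x k - x k') + b * (y k - y k') + c * (z k - z k') = 0 := fun k k' => by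
    linarith [hp k, hp k']
  have hpos : ∀ {p q r : ℝ}, (p ≠ 0 ∨ q ≠ 0 ∨ r ≠ 0) → |p| ≤ |r| → |q| ≤ |r| → r ≠ 0 := by
    intro p q r h h1 h2 h3
    subst h3
    rw [abs_zero] at h1 h2
    rcases h with h | h | h
    · exact h (abs_eq_zero.1 (le_antisymm h1 (abs_nonneg _)))
    · exact h (abs_eq_zero.1 (le_antisymm h2 (abs_nonneg _)))
    · exact h rfl
  rcases le_total |a| |b| with h1 | h1
  · rcases le_total |b| |c| with h2 | h2
    · obtain ⟨k, k', hne, hk1, hk2⟩ := pig2 x y m hm hx hy hc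
      refine ⟨k, k', hne, hk1.trans e1, hk2.trans e1, ?_⟩
      rw [← e2]
      exact plane_aux (hpos habc (h1.trans h2) h2) (h1.trans h2) h2 (hd k k') hk1 hk2
    · obtain ⟨k, k', hne, hk1, hk2⟩ := pig2 x z m hm hx hz hc
      refine ⟨k, k', hne, hk1.trans e1, ?_, hk2.trans e1⟩
      rw [← e2]
      exact plane_aux (hpos (p := a) (q := c) (by tauto) h1 h2) h1 h2 (by linarith [hd k k']) hk1 hk2
  · rcases le_total |a| |c| with h2 | h2
    · obtain ⟨k, k', hne, hk1, hk2⟩ := pig2 x y m hm hx hy hc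
      refine ⟨k, k', hne, hk1.trans e1, hk2.trans e1, ?_⟩
      rw [← e2]
      exact plane_aux (hpos habc h2 (h1.trans h2)) h2 (h1.trans h2) (hd k k') hk1 hk2
    · obtain ⟨k, k', hne, hk1, hk2⟩ := pig2 y z m hm hy hz hc
      refine ⟨k, k', hne, ?_, hk1.trans e1, hk2.trans e1⟩
      rw [← e2]
      exact plane_aux (hpos (p := b) (q := c) (by tauto) h1 h2) h1 h2 (by linarith [hd k k']) hk1 hk2

theorem GG_scale {ν μ α D l : ℝ} (hν : 3 / 2 ≤ ν) (hμ : 1 ≤ μ) (hα : 0 < α) (hD : 0 < D) (hl : 0 < l)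
    (hl1 : l ≤ 1) : GG ν μ (l * α) (l * D) ≤ l ^ (3 / 2 : ℝ) * GG ν μ α D := by
  unfold GG
  have hp : 0 ≤ l ^ (3 / 2 : ℝ) := by positivity
  rw [mul_max_of_nonneg _ _ hp]
  apply max_le_max
  · rw [Real.mul_rpow hl.le hα.le]
    gcongr ?_ * _
    exact Real.rpow_le_rpow_of_exponent_ge hl hl1 hν
  · rw [Real.mul_rpow hl.le hα.le, Real.mul_rpow hl.le hD.le]
    calc l ^ (1 / 2 : ℝ) * α ^ (1 / 2 : ℝ) * (l ^ μ * D ^ μ)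
        = l ^ (1 / 2 + μ : ℝ) * (α ^ (1 / 2 : ℝ) * D ^ μ) := by rw [Real.rpow_add hl]; ring
      _ ≤ _ := by
        gcongr ?_ * _
        exact Real.rpow_le_rpow_of_exponent_ge hl hl1 (by linarith)


theorem det_scale (A B C A' B' C' A'' B'' C'' u1 v1 u v p q r : ℝ)
    (h : A * (B' * C'' - C' * B'') - B * (A' * C'' - C' * A'') + C * (A' * B'' - B' * A'') = 0) :
    A / p * ((A' * u1 + B' * v1) / q * ((A'' * u + B'' * v + C'') / r) -
      (A' * u + B' * v + C') / r * ((A'' * u1 + B'' * v1) / q)) -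
    (A * u1 + B * v1) / q * (A' / p * ((A'' * u + B'' * v + C'') / r) -
      (A' * u + B' * v + C') / r * (A'' / p)) +
    (A * u + B * v + C) / r * (A' / p * ((A'' * u1 + B'' * v1) / q) -
      (A' * u1 + B' * v1) / q * (A'' / p)) = 0 := by
  simp only [div_eq_mul_inv]
  generalize p⁻¹ = p
  generalize q⁻¹ = q
  generalize r⁻¹ = r
  linear_combination (p * q * r * v1) * h

set_option maxHeartbeats 2000000 in
theorem classG_count {x0 lam M : ℝ} {u v u1 v1 u2 v2 : ℝ → ℝ}
    (h : CurveData x0 lam M u v u1 v1 u2 v2) {ν μ κ0 κT κ D0 L y ε : ℝ} (hν : 3 / 2 ≤ ν) (hμ : 1 ≤ μ)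
    (hκ0 : 0 < κ0) (hκT : 0 < κT) (hκ : 0 < κ) (hD0 : 0 < D0) (hL : 0 < L)
    (al0 : ∀ b : ℕ, L ≤ 2 * M * κ0 / 4 ^ b → Disjoint (Icc y (y + L)) (Bad0 v κ0 b))
    (alT : ∀ a : ℕ, L ≤ 4 * M ^ 6 * D0 / 2 ^ a → Disjoint (Icc y (y + L)) (BadT u v u1 v1 κT D0 a))
    (alG : ∀ a d : ℕ, L ≤ 4 * κ / (GG ν μ (2 ^ a) (2 ^ d) * D0 * 2 ^ d) →
      Disjoint (Icc y (y + L)) (BadG u v u1 v1 ν μ κ D0 a d))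
    (hy0 : x0 ≤ y) (hy1 : y + L ≤ x0 + lam) (a d : ℕ) (hLX : L ≤ ε / (2 ^ a * (2 ^ d) ^ 2))
    (hε0 : 0 < ε) (hD1 : D0 ≤ 1) (hκε : κ ≤ ε) (e1 : 12 * M ^ 3 * ε ≤ D0) (e2 : 200 * M * ε < 1)
    (e3 : 192 * M * ε ≤ κ0) (e4 : 128 * ε ≤ κT)
    (hG : (2 : ℝ) ^ a * 2 ^ d ≤ GG ν μ (2 ^ a) (2 ^ d))
    (S : Finset ℝ) (hS : ↑S ⊆ Icc y (y + L) ∩ BadG u v u1 v1 ν μ κ D0 a d)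
    (hsep : ∀ s ∈ S, ∀ s' ∈ S, s ≠ s' → 4 * κ / (GG ν μ (2 ^ a) (2 ^ d) * D0 * 2 ^ d) < |s - s'|) :
    (S.card : ℝ) ≤ (24 / D0) ^ 2 *
      (2 * (ε * GG ν μ (2 ^ a) (2 ^ d) / (2 ^ a * 2 ^ d * κ))) ^ (4 / 5 : ℝ) := by
  have hM := h.M1
  have hα1 : (1 : ℝ) ≤ 2 ^ a := one_le_pow₀ (by norm_num)
  have hDD1 : (1 : ℝ) ≤ 2 ^ d := one_le_pow₀ (by norm_num)
  have hmem : ∀ k : S, (k : ℝ) ∈ Icc y (y + L) ∩ BadG u v u1 v1 ν μ κ D0 a d := fun k => hS k.2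
  have hbad := fun k : S => (hmem k).2
  choose A B C hA1 hA2 hT1 hT2 hF using hbad
  simp only [pow_succ] at hA2 hT2
  set α : ℝ := 2 ^ a with hα_def
  set D : ℝ := 2 ^ d with hD_def
  have hα : 0 < α := by linarith
  have hD : 0 < D := by linarith
  set G := GG ν μ α D with hG_def
  have hGp : 0 < G := GG_pos hα
  have hJ : ∀ t, t ∈ Icc y (y + L) → t ∈ Icc x0 (x0 + lam) := fun t ht =>
    ⟨hy0.trans ht.1, ht.2.trans hy1⟩
  have hdist : ∀ s ∈ Icc y (y + L), ∀ t ∈ Icc y (y + L), |s - t| ≤ ε / (α * D ^ 2) := fun s hs t ht => by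
    refine le_trans ?_ hLX
    rw [abs_le]; constructor <;> linarith [hs.1, hs.2, ht.1, ht.2]
  -- variation of T
  have hvar : ∀ k : S, ∀ t ∈ Icc y (y + L),
      |(A k * u1 k + B k * v1 k) - (A k * u1 t + B k * v1 t)| ≤ D0 * D / 2 := by
    intro k t ht
    have hk := hJ _ (hmem k).1
    have hb := h.bB hk (A k) (B k)
    have hAk := (hA2 k).le
    have hTk := (hT2 k).le
    have hMM : 1 ≤ M ^ 2 := one_le_pow₀ hM
    have hMM2 : M ≤ M ^ 2 := le_self_pow₀ hM two_ne_zero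
    have hαD : α ≤ α * D := le_mul_of_one_le_right hα.le hDD1
    have hαD2 : D ≤ α * D := le_mul_of_one_le_left hD.le hα1
    have hb2 : |(A k : ℝ)| + |(B k : ℝ)| ≤ 6 * M ^ 2 * (α * D) := by
      calc |(A k : ℝ)| + |(B k : ℝ)| ≤ α * 2 + M * (D0 * (D * 2) + M * (α * 2)) := by
            refine add_le_add hAk (hb.trans ?_)
            gcongr
        _ ≤ (α * D) * 2 + M * (1 * ((α * D) * 2) + M * ((α * D) * 2)) := by gcongr
        _ = (2 + 2 * M + 2 * M ^ 2) * (α * D) := by ring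
        _ ≤ _ := by gcongr; linarith
    calc _ ≤ M * (|(A k : ℝ)| + |(B k : ℝ)|) * |(k : ℝ) - t| := h.varT _ _ hk (hJ t ht)
      _ ≤ M * (6 * M ^ 2 * (α * D)) * (ε / (α * D ^ 2)) := by
        gcongr
        exact hdist _ (hmem k).1 _ ht
      _ = (12 * M ^ 3 * ε) / (2 * D) := by field_simp; ring
      _ ≤ D0 / (2 * D) := by gcongr
      _ ≤ D0 * D / 2 := by
        rw [div_le_div_iff₀ (by positivity) (by norm_num)]
        have q1 : D0 ≤ D0 * D := le_mul_of_one_le_right hD0.le hDD1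
        have q2 : D0 * D ≤ D0 * D * D := le_mul_of_one_le_right (by positivity) hDD1
        linarith
  have hTlow : ∀ k : S, ∀ t ∈ Icc y (y + L), D0 * D / 2 ≤ |A k * u1 t + B k * v1 t| := fun k t ht => by
    have h1 := hvar k t ht
    have h2 := abs_sub_abs_le_abs_sub (A k * u1 k + B k * v1 k) (A k * u1 t + B k * v1 t)
    linarith [hT1 k]
  have hTup : ∀ k : S, ∀ t ∈ Icc y (y + L), |A k * u1 t + B k * v1 t| ≤ 3 * D0 * D := fun k t ht => by
    have h1 := hvar k t ht
    rw [abs_sub_comm] at h1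
    have h2 := abs_sub_abs_le_abs_sub (A k * u1 t + B k * v1 t) (A k * u1 k + B k * v1 k)
    have := mul_pos hD0 hD
    linarith [hT2 k]
  -- same coefficients
  have hdiff : ∀ k k' : S, k ≠ k' → ¬ (A k - A k' = 0 ∧ B k - B k' = 0 ∧ C k - C k' = 0) := by
    rintro k k' hne ⟨h1, h2, h3⟩
    have h1 : A k' = A k := by omega
    have h2 : B k' = B k := by omega
    have h3 : C k' = C k := by omega
    have hF' := hF k'
    rw [h1, h2, h3] at hF'
    have hs := hsep k k.2 k' k'.2 (fun e => hne (Subtype.ext e))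
    obtain ⟨ξ, hξ, he, hu⟩ := mvt_sym (x0 := y) (x1 := y + L)
      (fun s hs => h.derivF (A k) (B k) (C k) s (hJ s hs)) (hmem k).1 (hmem k').1
    have hl := hTlow k ξ hξ
    have hle : |A k * u k + B k * v k + C k - (A k * u k' + B k * v k' + C k)| ≤ 2 * (κ / G) := by
      refine (abs_sub _ _).trans ?_
      linarith [hF k]
    rw [he, abs_mul] at hle
    have : D0 * D / 2 * |(k : ℝ) - k'| ≤ 2 * (κ / G) := le_trans (by gcongr) hle
    rw [div_lt_iff₀ (by positivity)] at hs
    rw [← mul_div_assoc, le_div_iff₀ hGp] at this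
    linarith
  -- the base point
  have hyJ : y ∈ Icc y (y + L) := ⟨le_rfl, by linarith⟩
  have hy := hJ y hyJ
  have hFy : ∀ k : S, |A k * u y + B k * v y + C k| ≤ 4 * ε / (α * D) := fun k => by
    have h1 := mvt_bound (x0 := y) (x1 := y + L)
      (fun s hs => h.derivF (A k) (B k) (C k) s (hJ s hs)) (hTup k) hyJ (hmem k).1
    have h2 : |y - (k : ℝ)| ≤ _ := hdist y hyJ k (hmem k).1
    have h3 : 3 * D0 * D * |y - (k : ℝ)| ≤ 3 * ε / (α * D) := by
      calc 3 * D0 * D * |y - (k : ℝ)| ≤ 3 * 1 * D * (ε / (α * D ^ 2)) := by gcongr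
        _ = _ := by field_simp
    have h4 : κ / G ≤ ε / (α * D) := by gcongr
    have h5 := abs_sub_abs_le_abs_sub (A k * u y + B k * v y + C k) (A k * u k + B k * v k + C k)
    have h6 := hF k
    have e : 4 * ε / (α * D) = 3 * ε / (α * D) + ε / (α * D) := by ring
    rw [e]; linarith
  have hTy : ∀ k : S, |A k * u1 y + B k * v1 y| ≤ 3 * D := fun k => by
    have := hTup k y hyJ
    have q : D0 * D ≤ D := mul_le_of_le_one_left hD.le hD1
    linarith
  have hAy : ∀ k : S, |(A k : ℝ)| ≤ 2 * α := fun k => by linarith [hA2 k]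
  have hdet := h.det_zero hy A B C (2 * α) (3 * D) (4 * ε / (α * D))
    (by
      have : M * (6 * (2 * α) * (3 * D) * (4 * ε / (α * D))) = 144 * M * ε := by field_simp; ring
      have q := mul_pos (by linarith : 0 < M) hε0
      rw [this]; linarith) hAy hTy hFy
  obtain ⟨na, nb, nc, hn, hpl⟩ := exists_normal (ι := S) (fun k => (A k : ℝ) / (2 * α))
    (fun k => (A k * u1 y + B k * v1 y) / (3 * D))
    (fun k => (A k * u y + B k * v y + C k) / (4 * ε / (α * D)))
    (fun i j k => by
      exact det_scale _ _ _ _ _ _ _ _ _ _ _ _ _ _ _ _ (hdet i j k))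
  -- choice of m
  set ϱ := ε * G / (α * D * κ) with hϱ
  have hϱ1 : 1 ≤ ϱ := by
    rw [hϱ, le_div_iff₀ (by positivity), one_mul, mul_comm ε]
    gcongr
  set w : ℝ := (2 * ϱ) ^ (2 / 5 : ℝ) with hw
  have hw1 : 1 ≤ w := Real.one_le_rpow (by linarith) (by norm_num)
  set m := ⌈12 / D0 * w⌉₊ with hm
  have h12 : 12 ≤ 12 / D0 * w := by
    have : 12 ≤ 12 / D0 := by rw [le_div_iff₀ hD0]; linarith
    exact this.trans (le_mul_of_one_le_right (by positivity) hw1)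
  have hm1 : 12 / D0 * w ≤ m := Nat.le_ceil _
  have hm2 : (m : ℝ) ≤ 24 / D0 * w := by
    have := (Nat.ceil_lt_add_one (by linarith : 0 ≤ 12 / D0 * w)).le
    have e : 24 / D0 * w = 12 / D0 * w + 12 / D0 * w := by ring
    rw [e]; linarith
  have hmR : (0 : ℝ) < m := by linarith
  have hmR1 : (1 : ℝ) ≤ m := by linarith
  have hm0 : 0 < m := by exact_mod_cast hmR
  have hw2 : w ^ 2 = (2 * ϱ) ^ (4 / 5 : ℝ) := by
    rw [hw, ← Real.rpow_natCast, ← Real.rpow_mul (by linarith)]; norm_num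
  have hcard : S.card ≤ m ^ 2 := by
    by_contra hcon
    push Not at hcon
    obtain ⟨k, k', hne, hx, hyy, hz⟩ := plane_pigeon (ι := S) (fun k => (A k : ℝ) / (2 * α))
      (fun k => (A k * u1 y + B k * v1 y) / (3 * D))
      (fun k => (A k * u y + B k * v y + C k) / (4 * ε / (α * D))) m hm0
      (fun k => by rw [abs_div, abs_of_pos (by positivity : 0 < 2 * α), div_le_one (by positivity)]; exact hAy k)
      (fun k => by rw [abs_div, abs_of_pos (by positivity : 0 < 3 * D), div_le_one (by positivity)]; exact hTy k)
      (fun k => by rw [abs_div, abs_of_pos (by positivity : 0 < 4 * ε / (α * D)), div_le_one (by positivity)]; exact hFy k)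
      (by rw [Fintype.card_coe]; exact hcon) hn hpl
    rw [← sub_div, abs_div, abs_of_pos (by positivity : 0 < 2 * α), div_le_iff₀ (by positivity)] at hx
    rw [← sub_div, abs_div, abs_of_pos (by positivity : 0 < 3 * D), div_le_iff₀ (by positivity)] at hyy
    rw [← sub_div, abs_div, abs_of_pos (by positivity : 0 < 4 * ε / (α * D)), div_le_iff₀ (by positivity)] at hz
    set l := 12 / (D0 * m) with hl
    have hl0 : 0 < l := by positivity
    have hlw : l * w ≤ 1 := by
      rw [hl, div_mul_eq_mul_div, div_le_one (by positivity)]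
      rw [div_mul_eq_mul_div, div_le_iff₀ hD0] at hm1
      linarith
    have hl1 : l ≤ 1 := (le_mul_of_one_le_right hl0.le hw1).trans hlw
    have hsc := GG_scale (ν := ν) (μ := μ) hν hμ hα hD hl0 hl1
    rw [← hG_def] at hsc
    have hl32 : 0 < l ^ (3 / 2 : ℝ) := by positivity
    have hkey : l * l ^ (3 / 2 : ℝ) * (2 * ϱ) ≤ 1 := by
      have e5 : (l * w) ^ (5 / 2 : ℝ) ≤ 1 := Real.rpow_le_one (by positivity) hlw (by norm_num)
      rw [Real.mul_rpow hl0.le (by positivity), hw, ← Real.rpow_mul (by linarith)] at e5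
      norm_num at e5
      have : l * l ^ (3 / 2 : ℝ) = l ^ (5 / 2 : ℝ) := by
        nth_rw 1 [← Real.rpow_one l]
        rw [← Real.rpow_add hl0]; norm_num
      rw [this]; exact e5
    have hGmono : GG ν μ (4 / m * (2 * α)) (4 / m * (3 * D) / D0) ≤ l ^ (3 / 2 : ℝ) * G := by
      refine le_trans (GG_mono (by linarith) (by linarith) (by positivity) (by positivity) ?_ (le_of_eq ?_)) hsc
      · rw [hl, div_mul_eq_mul_div, div_mul_eq_mul_div, div_le_div_iff₀ (by positivity) (by positivity)]
        have := mul_pos hα hmR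
        have q : α * m * D0 ≤ α * m := mul_le_of_le_one_right this.le hD1
        linarith
      · rw [hl]; field_simp; norm_num
    have hGn : 0 ≤ GG ν μ (4 / m * (2 * α)) (4 / m * (3 * D) / D0) := (GG_pos (by positivity)).le
    have hMε : 0 < M * ε := by positivity
    have hlm : 4 / (m : ℝ) ≤ l / 3 := by
      rw [hl, div_div, div_le_div_iff₀ hmR (by positivity)]
      have q : D0 * m ≤ m := mul_le_of_le_one_left hmR.le hD1
      linarith
    have hm4 : 4 / (m : ℝ) ≤ 1 := by linarith
    have hm40 : 0 < 4 / (m : ℝ) := by positivity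
    have hα1' : ε / α ≤ ε := div_le_self hε0.le hα1
    have hD1' : ε / D ≤ ε := div_le_self hε0.le hDD1
    have hϱG : ε * G / (α * D) = ϱ * κ := by rw [hϱ]; field_simp
    refine no_small h (ν := ν) (μ := μ) (by linarith) (by linarith) hκ0 hκT hκ hD0 hL al0 alT alG hy hyJ
      (A k - A k') (B k - B k') (C k - C k') (hdiff k k' hne)
      (Ab := 4 / m * (2 * α)) (Tb := 4 / m * (3 * D)) (Fb := 4 / m * (4 * ε / (α * D)))
      ?_ ?_ ?_ ?_ ?_ ?_ ?_ ?_ ?_ ?_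
    · push_cast; exact hx
    · refine le_trans (le_of_eq ?_) hyy; congr 1; push_cast; ring
    · refine le_trans (le_of_eq ?_) hz; congr 1; push_cast; ring
    · have : 4 * ε / (α * D) ≤ 4 * ε := div_le_self (by positivity) (one_le_mul_of_one_le_of_one_le hα1 hDD1)
      have q : ε ≤ M * ε := le_mul_of_one_le_left hε0.le hM
      have q2 : 4 / (m : ℝ) * (4 * ε / (α * D)) ≤ 1 * (4 * ε) := by gcongr
      linarith
    · have : 4 / (m : ℝ) * (4 * ε / (α * D)) * (M * (4 / m * (3 * D))) = (4 / m) ^ 2 * (12 * M * (ε / α)) := by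
        field_simp; ring
      rw [this]
      calc (4 / (m : ℝ)) ^ 2 * (12 * M * (ε / α)) ≤ 1 ^ 2 * (12 * M * ε) := by gcongr
        _ ≤ κ0 := by linarith
    · calc L * (M * (4 / m * (3 * D))) ^ 2 ≤ ε / (α * D ^ 2) * (M * (4 / m * (3 * D))) ^ 2 := by gcongr
        _ = (4 / m) ^ 2 * (9 * M * M * (ε / α)) := by field_simp; ring
        _ ≤ 1 ^ 2 * (9 * M * M * ε) := by gcongr
        _ = M * (9 * M * ε) := by ring
        _ ≤ M * (2 * κ0) := mul_le_mul_of_nonneg_left (by linarith) (by linarith)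
        _ = 2 * M * κ0 := by ring
    · have : 4 / (m : ℝ) * (4 * ε / (α * D)) * (4 / m * (2 * α)) = (4 / m) ^ 2 * (8 * (ε / D)) := by
        field_simp; ring
      rw [this]
      calc (4 / (m : ℝ)) ^ 2 * (8 * (ε / D)) ≤ 1 ^ 2 * (8 * ε) := by gcongr
        _ ≤ κT := by linarith
    · have hM3 : 1 ≤ M ^ 3 := one_le_pow₀ hM
      have hM6 : 1 ≤ M ^ 6 := one_le_pow₀ hM
      calc L * (4 / m * (2 * α)) ≤ ε / (α * D ^ 2) * (1 * (2 * α)) := by gcongr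
        _ = 2 * (ε / D / D) := by field_simp
        _ ≤ 2 * ε := by
          gcongr
          exact (div_le_self (by positivity) hDD1).trans hD1'
        _ ≤ 4 * M ^ 6 * D0 := by
          have q : ε ≤ M ^ 3 * ε := le_mul_of_one_le_left hε0.le hM3
          have q2 : D0 ≤ M ^ 6 * D0 := le_mul_of_one_le_left hD0.le hM6
          linarith
    · calc 4 / m * (4 * ε / (α * D)) * GG ν μ (4 / m * (2 * α)) (4 / m * (3 * D) / D0)
          ≤ l / 3 * (4 * ε / (α * D)) * (l ^ (3 / 2 : ℝ) * G) := by gcongr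
        _ = 2 / 3 * (l * l ^ (3 / 2 : ℝ) * 2 * (ε * G / (α * D))) := by ring
        _ = 2 / 3 * (l * l ^ (3 / 2 : ℝ) * (2 * ϱ)) * κ := by rw [hϱG]; ring
        _ ≤ 2 / 3 * 1 * κ := by gcongr
        _ ≤ κ := by linarith
    · calc L * GG ν μ (4 / m * (2 * α)) (4 / m * (3 * D) / D0) * (4 / m * (3 * D))
          ≤ ε / (α * D ^ 2) * (l ^ (3 / 2 : ℝ) * G) * (l / 3 * (3 * D)) := by gcongr
        _ = 1 / 2 * (l * l ^ (3 / 2 : ℝ) * 2 * (ε * G / (α * D))) := by field_simp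
        _ = 1 / 2 * (l * l ^ (3 / 2 : ℝ) * (2 * ϱ)) * κ := by rw [hϱG]; ring
        _ ≤ 1 / 2 * 1 * κ := by gcongr
        _ ≤ 4 * κ := by linarith
  calc (S.card : ℝ) ≤ (m : ℝ) ^ 2 := by exact_mod_cast hcard
    _ ≤ (24 / D0 * w) ^ 2 := by gcongr
    _ = _ := by rw [mul_pow, hw2]


theorem pigeon_mod (q : ℕ) (hq : 0 < q) (p r : ℤ) (P R : ℝ) (hP : 0 ≤ P) (hR : 0 ≤ R) (hPR : P * R = q) :
    ∃ A B : ℤ, ¬ (A = 0 ∧ B = 0) ∧ |(A : ℝ)| ≤ P ∧ |(B : ℝ)| ≤ R ∧ (q : ℤ) ∣ A * p + B * r := by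
  haveI : NeZero q := ⟨hq.ne'⟩
  have hcard : q < (⌊P⌋₊ + 1) * (⌊R⌋₊ + 1) := by
    have h1 := Nat.lt_floor_add_one P
    have h2 := Nat.lt_floor_add_one R
    have : (q : ℝ) < ((⌊P⌋₊ + 1) * (⌊R⌋₊ + 1) : ℕ) := by
      rw [← hPR]; push_cast; nlinarith
    exact_mod_cast this
  obtain ⟨x, hx, y, hy, hne, he⟩ := Finset.exists_ne_map_eq_of_card_lt_of_maps_to
    (s := Finset.range (⌊P⌋₊ + 1) ×ˢ Finset.range (⌊R⌋₊ + 1)) (t := (Finset.univ : Finset (ZMod q)))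
    (f := fun z => (((z.1 : ℤ) * p + (z.2 : ℤ) * r : ℤ) : ZMod q))
    (by rw [Finset.card_product, Finset.card_range, Finset.card_range, Finset.card_univ, ZMod.card]; exact hcard)
    (fun _ _ => Finset.mem_coe.2 (Finset.mem_univ _))
  rw [Finset.mem_product, Finset.mem_range, Finset.mem_range] at hx hy
  have key : ∀ (P : ℝ), 0 ≤ P → ∀ a b : ℕ, a < ⌊P⌋₊ + 1 → b < ⌊P⌋₊ + 1 → |(((a : ℤ) - (b : ℤ) : ℤ) : ℝ)| ≤ P := by
    intro P hP a b ha hb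
    have h1 : (a : ℝ) ≤ P := (Nat.le_floor_iff hP).1 (by omega)
    have h2 : (b : ℝ) ≤ P := (Nat.le_floor_iff hP).1 (by omega)
    have h3 : (0 : ℝ) ≤ a := by positivity
    have h4 : (0 : ℝ) ≤ b := by positivity
    push_cast
    rw [abs_le]; constructor <;> linarith
  refine ⟨(x.1 : ℤ) - y.1, (x.2 : ℤ) - y.2, ?_, key P hP _ _ hx.1 hy.1, key R hR _ _ hx.2 hy.2, ?_⟩
  · rintro ⟨h1, h2⟩
    exact hne (Prod.ext (by omega) (by omega))
  · have := (ZMod.intCast_eq_intCast_iff_dvd_sub _ _ _).1 he.symm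
    convert this using 1
    ring

theorem GG_IJ {i j x Cc : ℝ} (hi : 0 < i) (hj : 0 < j) (hij : i + j = 1) (hle : i ≤ j) (hx : 1 ≤ x) (hC : 1 ≤ Cc) :
    GG (1 / i) ((1 + j) / (2 * j)) (x ^ i) (Cc * x ^ j) ≤ Cc ^ 2 * x := by
  have hx0 : 0 < x := by linarith
  unfold GG
  apply max_le
  · rw [← Real.rpow_mul hx0.le, mul_one_div_cancel hi.ne', Real.rpow_one]
    have : 1 ≤ Cc ^ 2 := one_le_pow₀ hC
    nlinarith
  · rw [Real.mul_rpow (by linarith) (by positivity), ← Real.rpow_mul hx0.le, ← Real.rpow_mul hx0.le]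
    have e1 : x ^ (i * (1 / 2)) * (Cc ^ ((1 + j) / (2 * j)) * x ^ (j * ((1 + j) / (2 * j)))) =
        Cc ^ ((1 + j) / (2 * j)) * x := by
      have : x ^ (i * (1 / 2)) * x ^ (j * ((1 + j) / (2 * j))) = x := by
        rw [← Real.rpow_add hx0]
        have : i * (1 / 2) + j * ((1 + j) / (2 * j)) = 1 := by
          field_simp; linarith
        rw [this, Real.rpow_one]
      calc _ = Cc ^ ((1 + j) / (2 * j)) * (x ^ (i * (1 / 2)) * x ^ (j * ((1 + j) / (2 * j)))) := by ring
        _ = _ := by rw [this]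
    rw [e1]
    gcongr
    rw [← Real.rpow_natCast]
    apply Real.rpow_le_rpow_of_exponent_le hC
    rw [div_le_iff₀ (by positivity)]
    push_cast
    linarith

theorem rat_contra {x0 lam M : ℝ} {u v u1 v1 u2 v2 : ℝ → ℝ}
    (h : CurveData x0 lam M u v u1 v1 u2 v2) {i j κ0 κT κ D0 L y εI e : ℝ}
    (hi : 0 < i) (hj : 0 < j) (hij : i + j = 1) (hle : i ≤ j)
    (hκ0 : 0 < κ0) (hκT : 0 < κT) (hκ : 0 < κ) (hD0 : 0 < D0) (hD1 : D0 ≤ 1) (hL : 0 < L)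
    (al0 : ∀ b : ℕ, L ≤ 2 * M * κ0 / 4 ^ b → Disjoint (Icc y (y + L)) (Bad0 v κ0 b))
    (alT : ∀ a : ℕ, L ≤ 4 * M ^ 6 * D0 / 2 ^ a → Disjoint (Icc y (y + L)) (BadT u v u1 v1 κT D0 a))
    (alG : ∀ a d : ℕ, L ≤ 4 * κ / (GG (1 / i) ((1 + j) / (2 * j)) (2 ^ a) (2 ^ d) * D0 * 2 ^ d) →
      Disjoint (Icc y (y + L)) (BadG u v u1 v1 (1 / i) ((1 + j) / (2 * j)) κ D0 a d))
    (hεI : 0 < εI) (he : 0 < e)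
    (c1 : 2 * e < 1) (c2 : 4 * M ^ 2 * e ≤ κ0) (c3 : 2 * M ^ 3 * εI ≤ κ0) (c4 : 2 * e ≤ κT)
    (c5 : εI ≤ 4 * M ^ 6 * D0) (c6 : 2 * e * (2 * M / D0) ^ 2 ≤ κ) (c7 : M * (2 * M / D0) ^ 2 * εI ≤ 2 * κ)
    {s : ℝ} (hs : s ∈ Icc x0 (x0 + lam)) (hsJ : s ∈ Icc y (y + L)) (q : ℕ) (hq : 0 < q) (p r : ℤ)
    (hLq : L ≤ εI / (q * (q : ℝ) ^ j))
    (h1 : |q * u s - p| ≤ e / (q : ℝ) ^ i) (h2 : |q * v s - r| ≤ e / (q : ℝ) ^ j) : False := by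
  have hM := h.M1
  have hx : (1 : ℝ) ≤ q := by exact_mod_cast hq
  have hG := GG_IJ (Cc := 2 * M / D0) hi hj hij hle hx
    (by rw [le_div_iff₀ hD0]; linarith)
  have hxij : (q : ℝ) ^ i * (q : ℝ) ^ j = q := by
    rw [← Real.rpow_add (by linarith), hij, Real.rpow_one]
  have hi1 : 1 ≤ (q : ℝ) ^ i := Real.one_le_rpow hx hi.le
  have hijx : (q : ℝ) ^ i ≤ (q : ℝ) ^ j := Real.rpow_le_rpow_of_exponent_le hx hle
  obtain ⟨A, B, hne, hA, hB, Cm, hC⟩ := pigeon_mod q hq p r _ _ (by positivity) (by positivity) hxij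
  set x : ℝ := (q : ℝ) with hxdef
  generalize hXi : x ^ i = Xi at *
  generalize hXj : x ^ j = Xj at *
  have hx0 : 0 < x := by linarith
  have hXi0 : 0 < Xi := by linarith
  have hXj0 : 0 < Xj := by linarith
  have hXj1 : Xj ≤ x := by rw [← hxij]; exact le_mul_of_one_le_left hXj0.le hi1
  have hXi1 : Xi ≤ x := hijx.trans hXj1
  have hCr : (A : ℝ) * p + B * r = x * Cm := by
    have : ((A * p + B * r : ℤ) : ℝ) = ((q * Cm : ℤ) : ℝ) := by rw [hC]
    push_cast at this
    exact this
  have hGn : 0 ≤ GG (1 / i) ((1 + j) / (2 * j)) Xi (2 * M / D0 * Xj) := (GG_pos hXi0).le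
  have hGe : GG (1 / i) ((1 + j) / (2 * j)) Xi (2 * M * Xj / D0) ≤ (2 * M / D0) ^ 2 * x := by
    rw [mul_div_right_comm]; exact hG
  have hGn' : 0 ≤ GG (1 / i) ((1 + j) / (2 * j)) Xi (2 * M * Xj / D0) := (GG_pos hXi0).le
  have hT : |A * u1 s + B * v1 s| ≤ 2 * M * Xj := by
    have b1 := h.bu1 s hs
    have b2 := h.bv1 s hs
    calc |A * u1 s + B * v1 s| ≤ |A * u1 s| + |B * v1 s| := abs_add_le _ _
      _ = |(A : ℝ)| * |u1 s| + |(B : ℝ)| * |v1 s| := by rw [abs_mul, abs_mul]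
      _ ≤ Xj * M + Xj * M := by
        have := hA.trans hijx
        gcongr
      _ = _ := by ring
  have hF : |A * u s + B * v s + ((-Cm : ℤ) : ℝ)| ≤ 2 * e / x := by
    rw [le_div_iff₀ hx0]
    have e1 : (A * u s + B * v s + ((-Cm : ℤ) : ℝ)) * x = A * (x * u s - p) + B * (x * v s - r) := by
      push_cast; linarith
    calc |A * u s + B * v s + ((-Cm : ℤ) : ℝ)| * x = |A * (x * u s - p) + B * (x * v s - r)| := by
          rw [← e1, abs_mul, abs_of_pos hx0]
      _ ≤ |(A : ℝ)| * |x * u s - p| + |(B : ℝ)| * |x * v s - r| := by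
          rw [← abs_mul, ← abs_mul]; exact abs_add_le _ _
      _ ≤ Xi * (e / Xi) + Xj * (e / Xj) := by gcongr
      _ = 2 * e := by field_simp; ring
  have hν : (0 : ℝ) ≤ 1 / i := by positivity
  have hμ : (0 : ℝ) ≤ (1 + j) / (2 * j) := by positivity
  have hrat : Xj / x ≤ 1 := by rw [div_le_one hx0]; exact hXj1
  have hrat2 : Xi / x ≤ 1 := by rw [div_le_one hx0]; exact hXi1
  refine no_small h hν hμ hκ0 hκT hκ hD0 hL al0 alT alG hs hsJ A B (-Cm)
    (fun hz => hne ⟨hz.1, hz.2.1⟩) hA hT hF ?_ ?_ ?_ ?_ ?_ ?_ ?_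
  · exact lt_of_le_of_lt (div_le_self (by positivity) hx) c1
  · calc 2 * e / x * (M * (2 * M * Xj)) = 4 * M ^ 2 * e * (Xj / x) := by ring
      _ ≤ 4 * M ^ 2 * e * 1 := by gcongr
      _ ≤ κ0 := by linarith
  · calc L * (M * (2 * M * Xj)) ^ 2 ≤ εI / (x * Xj) * (M * (2 * M * Xj)) ^ 2 := by gcongr
      _ = 2 * M * (2 * M ^ 3 * εI) * (Xj / x) := by field_simp
      _ ≤ 2 * M * κ0 * 1 := by gcongr
      _ = _ := by ring
  · calc 2 * e / x * Xi = 2 * e * (Xi / x) := by ring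
      _ ≤ 2 * e * 1 := by gcongr
      _ ≤ κT := by linarith
  · calc L * Xi ≤ εI / (x * Xj) * Xi := by gcongr
      _ ≤ εI / (x * Xj) * Xj := by gcongr
      _ = εI / x := by field_simp
      _ ≤ εI := div_le_self hεI.le hx
      _ ≤ _ := c5
  · calc 2 * e / x * GG (1 / i) ((1 + j) / (2 * j)) Xi (2 * M * Xj / D0)
        ≤ 2 * e / x * ((2 * M / D0) ^ 2 * x) := by gcongr
      _ = 2 * e * (2 * M / D0) ^ 2 := by field_simp
      _ ≤ κ := c6
  · calc L * GG (1 / i) ((1 + j) / (2 * j)) Xi (2 * M * Xj / D0) * (2 * M * Xj)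
        ≤ εI / (x * Xj) * ((2 * M / D0) ^ 2 * x) * (2 * M * Xj) := by gcongr
      _ = 2 * (M * (2 * M / D0) ^ 2 * εI) := by field_simp
      _ ≤ 4 * κ := by linarith

/-- class I -/
def BadI (u v : ℝ → ℝ) (i j γ δ c : ℝ) (n : ℕ) : Set ℝ :=
  {s | ∃ (q : ℕ) (p r : ℤ), (2 : ℝ) ^ n ≤ q ∧ (q : ℝ) < 2 ^ (n + 1) ∧
    |q * u s - p - γ| ≤ c / ((2 : ℝ) ^ n) ^ i ∧ |q * v s - r - δ| ≤ c / ((2 : ℝ) ^ n) ^ j}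

theorem diff_est {x y p p' γ q q' a d Q e1 : ℝ} (h1 : |q * x - p - γ| ≤ a) (h2 : |q' * y - p' - γ| ≤ a)
    (hxy : |x - y| ≤ d) (hq0 : 0 ≤ q') (hq : q' ≤ Q) (_hd : 0 ≤ d) (hres : 2 * a + Q * d ≤ e1) :
    |(q - q') * x - (p - p')| ≤ e1 := by
  have e : (q - q') * x - (p - p') = (q * x - p - γ) - (q' * y - p' - γ) - q' * (x - y) := by ring
  rw [e]
  calc _ ≤ |q * x - p - γ| + |q' * y - p' - γ| + |q' * (x - y)| :=
        (abs_sub _ _).trans (add_le_add_left (abs_sub _ _) _)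
    _ ≤ a + a + Q * d := by
      rw [abs_mul, abs_of_nonneg hq0]
      have := hq0.trans hq
      gcongr
    _ ≤ e1 := by linarith

theorem classI_two {x0 lam M : ℝ} {u v u1 v1 u2 v2 : ℝ → ℝ}
    (h : CurveData x0 lam M u v u1 v1 u2 v2) {i j κ0 κT κ D0 L y εI c γ δ : ℝ}
    (hi : 0 < i) (hj : 0 < j) (hij : i + j = 1) (hle : i ≤ j)
    (hκ0 : 0 < κ0) (hκT : 0 < κT) (hκ : 0 < κ) (hD0 : 0 < D0) (hD1 : D0 ≤ 1) (hL : 0 < L)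
    (al0 : ∀ b : ℕ, L ≤ 2 * M * κ0 / 4 ^ b → Disjoint (Icc y (y + L)) (Bad0 v κ0 b))
    (alT : ∀ a : ℕ, L ≤ 4 * M ^ 6 * D0 / 2 ^ a → Disjoint (Icc y (y + L)) (BadT u v u1 v1 κT D0 a))
    (alG : ∀ a d : ℕ, L ≤ 4 * κ / (GG (1 / i) ((1 + j) / (2 * j)) (2 ^ a) (2 ^ d) * D0 * 2 ^ d) →
      Disjoint (Icc y (y + L)) (BadG u v u1 v1 (1 / i) ((1 + j) / (2 * j)) κ D0 a d))
    (hy0 : x0 ≤ y) (hy1 : y + L ≤ x0 + lam)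
    (hεI : 0 < εI) (hc0 : 0 < c) (hc : c ≤ εI)
    (c1 : 8 * M * εI < 1) (c2 : 16 * M ^ 3 * εI ≤ κ0) (c4 : 8 * M * εI ≤ κT)
    (c5 : εI ≤ 4 * M ^ 6 * D0) (c6 : 8 * M * εI * (2 * M / D0) ^ 2 ≤ κ)
    (n : ℕ) (hLX : L ≤ εI / (2 ^ n * ((2 : ℝ) ^ n) ^ j))
    {s t : ℝ} (hs : s ∈ Icc y (y + L)) (ht : t ∈ Icc y (y + L))
    (hsB : s ∈ BadI u v i j γ δ c n) (htB : t ∈ BadI u v i j γ δ c n) :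
    |s - t| ≤ 2 * M * c / (2 ^ n * ((2 : ℝ) ^ n) ^ j) := by
  obtain ⟨q, p, r, hq1, hq2, hqu, hqv⟩ := hsB
  obtain ⟨q', p', r', hq1', hq2', hqu', hqv'⟩ := htB
  wlog hqq : q' ≤ q generalizing s t q q' p p' r r'
  · rw [abs_sub_comm]
    exact this ht hs q' p' r' hq1' hq2' hqu' hqv' q p r hq1 hq2 hqu hqv (le_of_not_ge hqq)
  have hM := h.M1
  have hQ1 : (1 : ℝ) ≤ 2 ^ n := one_le_pow₀ (by norm_num)
  rw [pow_succ] at hq2 hq2'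
  generalize (2 : ℝ) ^ n = Q at *
  have hQ0 : 0 < Q := by linarith
  have hQi1 : 1 ≤ Q ^ i := Real.one_le_rpow hQ1 hi.le
  have hQij : Q ^ i ≤ Q ^ j := Real.rpow_le_rpow_of_exponent_le hQ1 hle
  have hQj1 : 1 ≤ Q ^ j := hQi1.trans hQij
  have hsI : s ∈ Icc x0 (x0 + lam) := ⟨hy0.trans hs.1, hs.2.trans hy1⟩
  have htI : t ∈ Icc x0 (x0 + lam) := ⟨hy0.trans ht.1, ht.2.trans hy1⟩
  have hst : |s - t| ≤ εI / (Q * Q ^ j) := by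
    refine le_trans ?_ hLX
    rw [abs_le]; constructor <;> linarith [hs.1, hs.2, ht.1, ht.2]
  have hu := (mvt_bound h.hu h.bu1 hsI htI).trans (mul_le_mul_of_nonneg_left hst (by linarith))
  have hv := (mvt_bound h.hv h.bv1 hsI htI).trans (mul_le_mul_of_nonneg_left hst (by linarith))
  have hMε : εI ≤ M * εI := le_mul_of_one_le_left hεI.le hM
  have hdv : 2 * (c / Q ^ j) + (Q * 2) * (M * (εI / (Q * Q ^ j))) ≤ 4 * M * εI / Q ^ j := by
    have : 2 * (c / Q ^ j) + (Q * 2) * (M * (εI / (Q * Q ^ j))) = (2 * c + 2 * (M * εI)) / Q ^ j := by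
      field_simp
    rw [this]; gcongr; linarith
  have hdu : 2 * (c / Q ^ i) + (Q * 2) * (M * (εI / (Q * Q ^ j))) ≤ 4 * M * εI / Q ^ i := by
    calc 2 * (c / Q ^ i) + (Q * 2) * (M * (εI / (Q * Q ^ j)))
        ≤ 2 * (c / Q ^ i) + (Q * 2) * (M * (εI / (Q * Q ^ i))) := by gcongr
      _ = (2 * c + 2 * (M * εI)) / Q ^ i := by field_simp
      _ ≤ _ := by gcongr; linarith
  have hdu' := diff_est hqu hqu' hu (by positivity) hq2'.le (by positivity) hdu
  have hdv' := diff_est hqv hqv' hv (by positivity) hq2'.le (by positivity) hdv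
  by_cases hz : q = q'
  · subst hz
    rw [sub_self, zero_mul, zero_sub, abs_neg] at hdu' hdv'
    have z1 : 4 * M * εI / Q ^ i < 1 := by
      refine lt_of_le_of_lt (div_le_self (by positivity) hQi1) (by linarith)
    have z2 : 4 * M * εI / Q ^ j < 1 := by
      refine lt_of_le_of_lt (div_le_self (by positivity) hQj1) (by linarith)
    have zz : ∀ a b : ℤ, |(a : ℝ) - b| < 1 → a = b := fun a b hab => by
      by_contra hne
      have := one_le_abs_int (sub_ne_zero.2 hne)
      push_cast at this
      linarith
    have hr := zz _ _ (hdv'.trans_lt z2)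
    subst hr
    have hl := mvt_lower h.hv h.lv1 hsI htI
    have e : q * (v s - v t) = (q * v s - r - δ) - (q * v t - r - δ) := by ring
    have h3 : Q * |v s - v t| ≤ 2 * (c / Q ^ j) := by
      calc Q * |v s - v t| ≤ q * |v s - v t| := by gcongr
        _ = |q * (v s - v t)| := by rw [abs_mul, Nat.abs_cast]
        _ ≤ |q * v s - r - δ| + |q * v t - r - δ| := by rw [e]; exact abs_sub _ _
        _ ≤ _ := by linarith
    calc |s - t| ≤ M * |v s - v t| := hl
      _ = M / Q * (Q * |v s - v t|) := by field_simp
      _ ≤ M / Q * (2 * (c / Q ^ j)) := by gcongr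
      _ = _ := by field_simp
  · exfalso
    have hlt : q' < q := lt_of_le_of_ne hqq (Ne.symm hz)
    have hcast : ((q - q' : ℕ) : ℝ) = (q : ℝ) - q' := by push_cast [hqq]; ring
    have hd1 : (1 : ℝ) ≤ ((q - q' : ℕ) : ℝ) := by exact_mod_cast (by omega : 1 ≤ q - q')
    have hdQ : ((q - q' : ℕ) : ℝ) ≤ Q := by rw [hcast]; linarith
    rw [← hcast] at hdu' hdv'
    have hM2 : 1 ≤ M ^ 2 := one_le_pow₀ hM
    refine rat_contra h (e := 4 * M * εI) hi hj hij hle hκ0 hκT hκ hD0 hD1 hL al0 alT alG hεI (by positivity)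
      (by linarith) (le_trans (le_of_eq (by ring)) c2) (le_trans ?_ c2) (by linarith) c5
      (le_trans (le_of_eq (by ring)) c6) ?_ hsI hs (q - q') (by omega) (p - p') (r - r') ?_ ?_ ?_
    · gcongr; norm_num
    · have : 0 ≤ M * (2 * M / D0) ^ 2 * εI := by positivity
      linarith
    · refine hLX.trans ?_
      gcongr
    · push_cast [hqq] at hdu' ⊢
      refine hdu'.trans ?_
      rw [← hcast]
      gcongr
    · push_cast [hqq] at hdv' ⊢
      refine hdv'.trans ?_
      rw [← hcast]
      gcongr


theorem window_sum (X : ℕ → ℝ) (hX : ∀ n, 0 < X n) (hh : ∀ n, X (n + 1) ≤ X n / 2) (p : ℕ) (L : ℝ)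
    (W : ENNReal) :
    ∑' n, (if L < X n ∧ X n ≤ 2 ^ p * L then W else 0) ≤ p * W := by
  classical
  by_cases hex : ∃ n, L < X n ∧ X n ≤ 2 ^ p * L
  · set n0 := Nat.find hex with hn0
    have h0 := Nat.find_spec hex
    rw [← hn0] at h0
    have hdec : ∀ k, X (n0 + k) ≤ X n0 / 2 ^ k := by
      intro k
      induction k with
      | zero => simp
      | succ k ih =>
        have := hh (n0 + k)
        rw [← add_assoc, pow_succ, ← div_div]
        linarith
    rw [tsum_eq_sum (s := Finset.Ico n0 (n0 + p))]
    · refine (Finset.sum_le_card_nsmul _ _ W (fun n _ => ?_)).trans ?_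
      · split_ifs
        · exact le_rfl
        · exact zero_le
      · rw [Nat.card_Ico]; simp
    · intro n hn
      rw [if_neg]
      intro hw
      apply hn
      rw [Finset.mem_Ico]
      refine ⟨Nat.find_min' hex hw, ?_⟩
      by_contra hge
      push Not at hge
      obtain ⟨k, rfl⟩ := Nat.exists_eq_add_of_le (le_trans (Nat.le_add_right n0 p) hge)
      have hk : p ≤ k := by omega
      have h1 := hdec k
      have h2 : X n0 / 2 ^ k ≤ X n0 / 2 ^ p := by
        have := (hX n0).le
        gcongr
        norm_num
      have h3 : X n0 / 2 ^ p ≤ L := by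
        rw [div_le_iff₀ (by positivity)]; linarith [h0.2]
      linarith [hw.1]
  · push Not at hex
    rw [ENNReal.tsum_eq_zero.2]
    · exact zero_le
    · intro n
      rw [if_neg]
      rintro ⟨h1, h2⟩
      exact absurd h2 (not_le.2 (hex n h1))

/-- decay base -/
noncomputable def rr : ℝ := 2 ^ (-(1 / 20) : ℝ)
theorem rr_pos : 0 < rr := by unfold rr; positivity
theorem rr_lt : rr < 1 := by
  unfold rr
  exact Real.rpow_lt_one_of_one_lt_of_neg (by norm_num) (by norm_num)

/-- two-sided geometric total -/
noncomputable def HH : ℝ := 2 * (1 - rr)⁻¹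

theorem HH_pos : 0 < HH := by unfold HH; have := rr_lt; have : 0 < 1 - rr := by linarith
                              positivity

theorem geom_total : ∑' n : ℕ, ENNReal.ofReal (rr ^ n) = ENNReal.ofReal ((1 - rr)⁻¹) := by
  have := rr_lt
  rw [← ENNReal.ofReal_tsum_of_nonneg (fun n => pow_nonneg rr_pos.le n)
    (summable_geometric_of_lt_one rr_pos.le rr_lt), tsum_geometric_of_lt_one rr_pos.le rr_lt]

theorem rr_rpow_le {z : ℝ} {n : ℕ} (h : (n : ℝ) ≤ z) : (2 : ℝ) ^ (-(1 / 20) * z) ≤ rr ^ n := by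
  rw [Real.rpow_mul (by norm_num)]
  change rr ^ z ≤ _
  rw [← Real.rpow_natCast]
  exact Real.rpow_le_rpow_of_exponent_ge rr_pos rr_lt.le h

theorem two_sided (S τ : ℝ) (hS : 0 ≤ S) (hτ : 1 ≤ τ) :
    ∑' d : ℕ, ENNReal.ofReal ((2 : ℝ) ^ (-(1 / 20) * |S - d * τ|)) ≤ ENNReal.ofReal HH := by
  have hτ0 : 0 < τ := by linarith
  set d0 := ⌊S / τ⌋₊ with hd0
  have h1 : (d0 : ℝ) * τ ≤ S := by
    rw [← le_div_iff₀ hτ0]; exact Nat.floor_le (by positivity)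
  have h2 : S ≤ ((d0 : ℝ) + 1) * τ := by
    rw [← div_le_iff₀ hτ0]; exact (Nat.lt_floor_add_one _).le
  rw [← Summable.sum_add_tsum_nat_add' (k := d0 + 1) ENNReal.summable]
  have e : ENNReal.ofReal HH = ENNReal.ofReal ((1 - rr)⁻¹) + ENNReal.ofReal ((1 - rr)⁻¹) := by
    have := rr_lt
    have : 0 ≤ (1 - rr)⁻¹ := inv_nonneg.2 (by linarith)
    rw [← ENNReal.ofReal_add this this, HH]; congr 1; ring
  rw [e]
  apply add_le_add
  · rw [← geom_total, ← Finset.sum_range_reflect]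
    refine le_trans (Finset.sum_le_sum (fun k hk => ?_)) (ENNReal.sum_le_tsum (Finset.range (d0 + 1)))
    apply ENNReal.ofReal_le_ofReal
    apply rr_rpow_le
    rw [Finset.mem_range] at hk
    have hk' : k ≤ d0 := by omega
    have : ((d0 + 1 - 1 - k : ℕ) : ℝ) = d0 - k := by
      rw [Nat.add_sub_cancel, Nat.cast_sub hk']
    rw [this]
    refine le_trans ?_ (le_abs_self _)
    have : (k : ℝ) ≤ k * τ := le_mul_of_one_le_right (by positivity) hτ
    nlinarith
  · rw [← geom_total]
    refine ENNReal.tsum_le_tsum (fun k => ?_)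
    apply ENNReal.ofReal_le_ofReal
    apply rr_rpow_le
    rw [abs_sub_comm]
    refine le_trans ?_ (le_abs_self _)
    push_cast
    have : (k : ℝ) ≤ k * τ := le_mul_of_one_le_right (by positivity) hτ
    nlinarith

theorem classG_sum (ε τ K : ℝ) (hε : 0 < ε) (hτ : 0 ≤ τ) (hK : 0 ≤ K) (p : ℕ) (L : ℝ)
    (W : ℕ × ℕ → ENNReal)
    (hW : ∀ k : ℕ × ℕ, W k ≤ ENNReal.ofReal (K * (2 : ℝ) ^ (-(1 / 20) * |(k.1 : ℝ) - k.2 * τ|))) :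
    ∑' k : ℕ × ℕ, (if L < ε / (2 ^ k.1 * (2 ^ k.2) ^ 2) ∧ ε / (2 ^ k.1 * (2 ^ k.2) ^ 2) ≤ 2 ^ p * L then W k else 0)
      ≤ ENNReal.ofReal (p * (K * HH)) := by
  classical
  let g : ℕ × ℕ → ENNReal := fun z => if L < ε / 2 ^ z.1 ∧ ε / 2 ^ z.1 ≤ 2 ^ p * L then
    ENNReal.ofReal (K * (2 : ℝ) ^ (-(1 / 20) * |(z.1 : ℝ) - z.2 * (2 + τ)|)) else 0
  let φ : ℕ × ℕ → ℕ × ℕ := fun k => (k.1 + 2 * k.2, k.2)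
  have hφ : Function.Injective φ := by
    rintro ⟨a, d⟩ ⟨a', d'⟩ he
    simp only [φ, Prod.mk.injEq] at he
    ext <;> simp <;> omega
  calc _ ≤ ∑' k, g (φ k) := by
        refine ENNReal.tsum_le_tsum (fun k => ?_)
        have e1 : (2 : ℝ) ^ k.1 * (2 ^ k.2) ^ 2 = 2 ^ (k.1 + 2 * k.2) := by
          rw [← pow_mul, ← pow_add, mul_comm k.2]
        rw [e1]
        simp only [g, φ]
        split_ifs
        · refine (hW k).trans (le_of_eq ?_)
          have e2 : (((k.1 + 2 * k.2 : ℕ) : ℝ) - k.2 * (2 + τ)) = (k.1 : ℝ) - k.2 * τ := by push_cast; ring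
          rw [e2]
        · exact le_rfl
    _ ≤ ∑' z, g z := ENNReal.tsum_comp_le_tsum_of_injective hφ g
    _ = ∑' S : ℕ, ∑' d : ℕ, g (S, d) := ENNReal.tsum_prod'
    _ ≤ ∑' S : ℕ, (if L < ε / 2 ^ S ∧ ε / 2 ^ S ≤ 2 ^ p * L then ENNReal.ofReal (K * HH) else 0) := by
        refine ENNReal.tsum_le_tsum (fun S => ?_)
        simp only [g]
        split_ifs
        · simp_rw [ENNReal.ofReal_mul hK]
          rw [ENNReal.tsum_mul_left]
          gcongr
          exact two_sided S (2 + τ) (by positivity) (by linarith)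
        · simp
    _ ≤ p * ENNReal.ofReal (K * HH) := window_sum (fun n => ε / 2 ^ n) (fun n => by positivity)
        (fun n => by rw [pow_succ, div_div]) p L _
    _ = _ := by
      rw [ENNReal.ofReal_mul (p := (p : ℝ)) (by positivity), ENNReal.ofReal_natCast]

theorem GG_decay {i j : ℝ} (hi : 0 < i) (hj : 0 < j) (hij : i + j = 1) (hle : i ≤ j) (a d : ℕ) :
    (2 : ℝ) ^ a * 2 ^ d ≤ (2 : ℝ) ^ (-(1 / 2) * |(a : ℝ) - d * (i / j)|) *
      GG (1 / i) ((1 + j) / (2 * j)) (2 ^ a) (2 ^ d) := by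
  unfold GG
  have h2 : (0 : ℝ) < 2 := by norm_num
  rw [← Real.rpow_natCast 2 a, ← Real.rpow_natCast 2 d, mul_max_of_nonneg _ _ (by positivity),
    ← Real.rpow_mul h2.le, ← Real.rpow_mul h2.le, ← Real.rpow_mul h2.le, ← Real.rpow_add h2,
    ← Real.rpow_add h2, ← Real.rpow_add h2, ← Real.rpow_add h2]
  have hd0 : (0 : ℝ) ≤ d := by positivity
  have ha0 : (0 : ℝ) ≤ a := by positivity
  have hji : 1 ≤ j / i := by rw [le_div_iff₀ hi]; linarith
  have e1 : 1 / i = 1 + j / i := by field_simp; linarith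
  have e2 : (1 + j) / (2 * j) = 1 + i / j / 2 := by field_simp; linarith
  have e3 : i / j * (j / i) = 1 := by field_simp
  rcases le_total 0 ((a : ℝ) - d * (i / j)) with hy | hy
  · apply le_max_of_le_left
    apply Real.rpow_le_rpow_of_exponent_le (by norm_num)
    rw [abs_of_nonneg hy, e1]
    have : (a : ℝ) * (j / i) - d = (a - d * (i / j)) * (j / i) := by linear_combination (d : ℝ) * e3
    nlinarith
  · apply le_max_of_le_right
    apply Real.rpow_le_rpow_of_exponent_le (by norm_num)
    rw [abs_of_nonpos hy, e2]
    apply le_of_eq; ring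

theorem GG_ge {i j : ℝ} (hi : 0 < i) (hj : 0 < j) (hij : i + j = 1) (hle : i ≤ j) (a d : ℕ) :
    (2 : ℝ) ^ a * 2 ^ d ≤ GG (1 / i) ((1 + j) / (2 * j)) (2 ^ a) (2 ^ d) := by
  refine (GG_decay hi hj hij hle a d).trans ?_
  have hG : 0 < GG (1 / i) ((1 + j) / (2 * j)) (2 ^ a) (2 ^ d) := GG_pos (by positivity)
  refine mul_le_of_le_one_left hG.le ?_
  apply Real.rpow_le_one_of_one_le_of_nonpos (by norm_num)
  have := abs_nonneg ((a : ℝ) - d * (i / j))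
  linarith

theorem classG_weight {i j ε κ D0 : ℝ} (hi : 0 < i) (hj : 0 < j) (hij : i + j = 1) (hle : i ≤ j)
    (hε : 0 < ε) (hκ : 0 < κ) (hD0 : 0 < D0) (hD1 : D0 ≤ 1) (a d : ℕ) :
    (24 / D0) ^ 2 * (2 * (ε * GG (1 / i) ((1 + j) / (2 * j)) (2 ^ a) (2 ^ d) / (2 ^ a * 2 ^ d * κ))) ^ (4 / 5 : ℝ)
      * (4 * κ / (GG (1 / i) ((1 + j) / (2 * j)) (2 ^ a) (2 ^ d) * D0 * 2 ^ d) /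
        (ε / (2 ^ a * (2 ^ d) ^ 2))) ^ (9 / 10 : ℝ)
      ≤ 4608 / D0 ^ 3 * (κ / ε) ^ (1 / 10 : ℝ) * (2 : ℝ) ^ (-(1 / 20) * |(a : ℝ) - d * (i / j)|) := by
  have hdec := GG_decay hi hj hij hle a d
  have hα : (0 : ℝ) < 2 ^ a := by positivity
  have hD : (0 : ℝ) < 2 ^ d := by positivity
  have hG : 0 < GG (1 / i) ((1 + j) / (2 * j)) (2 ^ a) (2 ^ d) := GG_pos (by positivity)
  generalize GG (1 / i) ((1 + j) / (2 * j)) (2 ^ a) (2 ^ d) = G at *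
  generalize |(a : ℝ) - d * (i / j)| = z at *
  generalize (2 : ℝ) ^ a = α at *
  generalize (2 : ℝ) ^ d = D at *
  set ϱ := ε * G / (α * D * κ) with hϱ
  have hϱ0 : 0 < ϱ := by positivity
  have e1 : 4 * κ / (G * D0 * D) / (ε / (α * D ^ 2)) = 4 / D0 * ϱ⁻¹ := by
    rw [hϱ]; field_simp
  rw [e1, Real.mul_rpow (by norm_num) hϱ0.le, Real.mul_rpow (by positivity) (by positivity)]
  have e2 : ϱ ^ (4 / 5 : ℝ) * ϱ⁻¹ ^ (9 / 10 : ℝ) = (ϱ⁻¹) ^ (1 / 10 : ℝ) := by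
    rw [Real.inv_rpow hϱ0.le, Real.inv_rpow hϱ0.le, ← Real.rpow_neg hϱ0.le, ← Real.rpow_neg hϱ0.le,
      ← Real.rpow_add hϱ0]
    norm_num
  have e3 : ϱ⁻¹ ≤ κ / ε * (2 : ℝ) ^ (-(1 / 2) * z) := by
    have : ϱ⁻¹ = κ / ε * (α * D / G) := by rw [hϱ]; field_simp
    rw [this]
    gcongr
    rw [div_le_iff₀ hG]; exact hdec
  have e4 : (ϱ⁻¹) ^ (1 / 10 : ℝ) ≤ (κ / ε) ^ (1 / 10 : ℝ) * (2 : ℝ) ^ (-(1 / 20) * z) := by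
    calc (ϱ⁻¹) ^ (1 / 10 : ℝ) ≤ (κ / ε * (2 : ℝ) ^ (-(1 / 2) * z)) ^ (1 / 10 : ℝ) :=
          Real.rpow_le_rpow (by positivity) e3 (by norm_num)
      _ = (κ / ε) ^ (1 / 10 : ℝ) * ((2 : ℝ) ^ (-(1 / 2) * z)) ^ (1 / 10 : ℝ) :=
          Real.mul_rpow (by positivity) (by positivity)
      _ = _ := by
        congr 1
        rw [← Real.rpow_mul (by norm_num)]; congr 1; ring
  have f1 : (2 : ℝ) ^ (4 / 5 : ℝ) ≤ 2 := by
    nth_rw 2 [← Real.rpow_one 2]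
    exact Real.rpow_le_rpow_of_exponent_le (by norm_num) (by norm_num)
  have f2 : (4 / D0) ^ (9 / 10 : ℝ) ≤ 4 / D0 := by
    nth_rw 2 [← Real.rpow_one (4 / D0)]
    refine Real.rpow_le_rpow_of_exponent_le ?_ (by norm_num)
    rw [le_div_iff₀ hD0]; linarith
  calc (24 / D0) ^ 2 * (2 ^ (4 / 5 : ℝ) * ϱ ^ (4 / 5 : ℝ)) * ((4 / D0) ^ (9 / 10 : ℝ) * ϱ⁻¹ ^ (9 / 10 : ℝ))
      = (24 / D0) ^ 2 * 2 ^ (4 / 5 : ℝ) * (4 / D0) ^ (9 / 10 : ℝ) * (ϱ ^ (4 / 5 : ℝ) * ϱ⁻¹ ^ (9 / 10 : ℝ)) := by ring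
    _ ≤ (24 / D0) ^ 2 * 2 * (4 / D0) * ((κ / ε) ^ (1 / 10 : ℝ) * (2 : ℝ) ^ (-(1 / 20) * z)) := by
      rw [e2]; gcongr
    _ = _ := by field_simp; ring


theorem ev_le (c : ℝ) {d : ℝ} (hd : 0 < d) : ∀ᶠ x in nhdsWithin (0 : ℝ) (Ioi 0), c * x ≤ d := by
  have h : Tendsto (fun x : ℝ => c * x) (nhds 0) (nhds (c * 0)) := (continuous_const_mul c).tendsto 0
  rw [mul_zero] at h
  exact (h.mono_left nhdsWithin_le_nhds).eventually_le_const hd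

theorem ev_lt (c : ℝ) {d : ℝ} (hd : 0 < d) : ∀ᶠ x in nhdsWithin (0 : ℝ) (Ioi 0), c * x < d := by
  have h : Tendsto (fun x : ℝ => c * x) (nhds 0) (nhds (c * 0)) := (continuous_const_mul c).tendsto 0
  rw [mul_zero] at h
  exact (h.mono_left nhdsWithin_le_nhds).eventually_lt_const hd

theorem ev_pow (k c : ℝ) {w d : ℝ} (hw : 0 < w) (hd : 0 < d) :
    ∀ᶠ x in nhdsWithin (0 : ℝ) (Ioi 0), k * (c * x) ^ w ≤ d := by
  have h : Tendsto (fun x : ℝ => k * (c * x) ^ w) (nhds 0) (nhds (k * (c * 0) ^ w)) := by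
    have h1 : Continuous (fun x : ℝ => k * (c * x) ^ w) :=
      continuous_const.mul ((continuous_const_mul c).rpow_const (fun _ => Or.inr hw.le))
    exact h1.tendsto 0
  rw [mul_zero, Real.zero_rpow hw.ne', mul_zero] at h
  exact (h.mono_left nhdsWithin_le_nhds).eventually_le_const hd

theorem ev_pos : ∀ᶠ x in nhdsWithin (0 : ℝ) (Ioi 0), 0 < x := self_mem_nhdsWithin

/-- all constants -/
structure Consts (M lam η : ℝ) (p : ℕ) where
  (ε0 εT κ0 D0 ε κ εI c : ℝ)
  hε0 : 0 < ε0
  hεzl : ε0 ≤ lam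
  hεzM : 16 * M * ε0 ≤ 1
  hεT : 0 < εT
  hεTl : εT ≤ lam
  hεT1 : 10 * M ^ 3 * εT ≤ 1
  hεT2 : 30 * M * εT ≤ 1
  hκ0 : 0 < κ0
  hκ01 : 16 * κ0 ≤ 1
  hκ02 : (2 ^ p) ^ 2 * (2 * M) * κ0 < ε0
  hκ03 : p * (2 * M / ε0 * κ0) ^ (9 / 10 : ℝ) ≤ η / 4
  hD0 : 0 < D0
  hD1 : 2 * D0 ≤ 1
  hD2 : 30 * M * D0 ≤ 1
  hD3 : (2 ^ p) ^ 2 * (4 * M ^ 6) * D0 < εT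
  hD4 : (p * 3) * (4 * M ^ 6 / εT * D0) ^ (9 / 10 : ℝ) ≤ η / 4
  hε : 0 < ε
  hεl : ε ≤ lam
  hε1 : 12 * M ^ 3 * ε ≤ D0
  hε2 : 200 * M * ε < 1
  hε3 : 192 * M * ε ≤ κ0
  hε4 : 128 * ε ≤ D0 ^ 2
  hκ : 0 < κ
  hκ1 : κ ≤ ε
  hκ2 : (2 ^ p) ^ 2 * 4 * κ < ε * D0
  hκ3 : (p * (4608 / D0 ^ 3 * HH)) * (1 / ε * κ) ^ (1 / 10 : ℝ) ≤ η / 4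
  hεI : 0 < εI
  hεIl : εI ≤ lam
  hεI1 : 8 * M * εI < 1
  hεI2 : 16 * M ^ 3 * εI ≤ κ0
  hεI3 : 8 * M * εI ≤ D0 ^ 2
  hεI4 : εI ≤ 4 * M ^ 6 * D0
  hεI5 : 8 * M * (2 * M / D0) ^ 2 * εI ≤ κ
  hc : 0 < c
  hc1 : c ≤ εI
  hc2 : (2 ^ p) ^ 2 * (2 * M) * c < εI
  hc3 : p * (2 * M / εI * c) ^ (9 / 10 : ℝ) ≤ η / 4

theorem exists_consts {M lam η : ℝ} (p : ℕ) (hM : 1 ≤ M) (hlam : 0 < lam) (hη : 0 < η) :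
    Nonempty (Consts M lam η p) := by
  have hM0 : 0 < M := by linarith
  have hη4 : 0 < η / 4 := by positivity
  have h910 : (0 : ℝ) < 9 / 10 := by norm_num
  obtain ⟨ε0, hε0, hεzl, hεzM⟩ := (ev_pos.and ((ev_le 1 hlam).and (ev_le (16 * M) one_pos))).exists
  obtain ⟨εT, hεT, hεTl, hεT1, hεT2⟩ := (ev_pos.and ((ev_le 1 hlam).and
    ((ev_le (10 * M ^ 3) one_pos).and (ev_le (30 * M) one_pos)))).exists
  obtain ⟨κ0, hκ0, hκ01, hκ02, hκ03⟩ := (ev_pos.and ((ev_le 16 one_pos).and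
    ((ev_lt ((2 ^ p) ^ 2 * (2 * M)) hε0).and (ev_pow p (2 * M / ε0) h910 hη4)))).exists
  obtain ⟨D0, hD0, hD1, hD2, hD3, hD4⟩ := (ev_pos.and ((ev_le 2 one_pos).and ((ev_le (30 * M) one_pos).and
    ((ev_lt ((2 ^ p) ^ 2 * (4 * M ^ 6)) hεT).and (ev_pow (p * 3) (4 * M ^ 6 / εT) h910 hη4))))).exists
  have hD02 : 0 < D0 ^ 2 := by positivity
  obtain ⟨ε, hε, hεl, hε1, hε2, hε3, hε4⟩ := (ev_pos.and ((ev_le 1 hlam).and ((ev_le (12 * M ^ 3) hD0).and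
    ((ev_lt (200 * M) one_pos).and ((ev_le (192 * M) hκ0).and (ev_le 128 hD02)))))).exists
  obtain ⟨κ, hκ, hκ1, hκ2, hκ3⟩ := (ev_pos.and ((ev_le 1 hε).and
    ((ev_lt ((2 ^ p) ^ 2 * 4) (mul_pos hε hD0)).and
    (ev_pow (p * (4608 / D0 ^ 3 * HH)) (1 / ε) (by norm_num : (0 : ℝ) < 1 / 10) hη4)))).exists
  have hMD : 0 < 4 * M ^ 6 * D0 := by positivity
  obtain ⟨εI, hεI, hεIl, hεI1, hεI2, hεI3, hεI4, hεI5⟩ := (ev_pos.and ((ev_le 1 hlam).and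
    ((ev_lt (8 * M) one_pos).and ((ev_le (16 * M ^ 3) hκ0).and ((ev_le (8 * M) hD02).and
    ((ev_le 1 hMD).and (ev_le (8 * M * (2 * M / D0) ^ 2) hκ))))))).exists
  obtain ⟨c, hc, hc1, hc2, hc3⟩ := (ev_pos.and ((ev_le 1 hεI).and
    ((ev_lt ((2 ^ p) ^ 2 * (2 * M)) hεI).and (ev_pow p (2 * M / εI) h910 hη4)))).exists
  rw [one_mul] at hεzl hεTl hεl hκ1 hεIl hεI4 hc1
  exact ⟨⟨ε0, εT, κ0, D0, ε, κ, εI, c, hε0, hεzl, hεzM, hεT, hεTl, hεT1, hεT2, hκ0, hκ01, hκ02, hκ03,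
    hD0, hD1, hD2, hD3, hD4, hε, hεl, hε1, hε2, hε3, hε4, hκ, hκ1, hκ2, hκ3, hεI, hεIl, hεI1, hεI2, hεI3,
    hεI4, hεI5, hc, hc1, hc2, hc3⟩⟩

/-- index set of the bad sets -/
abbrev Cls : Type := ℕ ⊕ ℕ ⊕ (ℕ × ℕ) ⊕ ℕ

theorem tsum_cls (F : Cls → ENNReal) : ∑' k, F k = (∑' b, F (.inl b)) + ((∑' a, F (.inr (.inl a))) +
    ((∑' k, F (.inr (.inr (.inl k)))) + ∑' n, F (.inr (.inr (.inr n))))) := by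
  rw [Summable.tsum_sum ENNReal.summable ENNReal.summable,
    Summable.tsum_sum (f := fun z => F (.inr z)) ENNReal.summable ENNReal.summable,
    Summable.tsum_sum (f := fun z => F (.inr (.inr z))) ENNReal.summable ENNReal.summable]

set_option maxHeartbeats 4000000 in
theorem per_t {x0 lam M : ℝ} {u v u1 v1 u2 v2 : ℝ → ℝ}
    (h : CurveData x0 lam M u v u1 v1 u2 v2) {i j γ δ : ℝ}
    (hi : 0 < i) (hj : 0 < j) (hij : i + j = 1) (hle : i ≤ j) (p : ℕ) {η : ℝ} (hη : 0 < η) :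
    ∃ (Bad : Cls → Set ℝ) (X l N : Cls → ℝ), (∀ k, 0 < X k) ∧ (∀ k, 0 < l k) ∧ (∀ k, X k ≤ lam) ∧
      (∀ k, (2 ^ p) ^ 2 * l k < X k) ∧ (∀ k, 0 ≤ N k) ∧
      (∀ k y L, 0 < L → L ≤ X k → x0 ≤ y → y + L ≤ x0 + lam →
        (∀ k', L ≤ l k' → Disjoint (Icc y (y + L)) (Bad k')) →
        ∀ S : Finset ℝ, (S : Set ℝ) ⊆ Icc y (y + L) ∩ Bad k →
          (∀ s ∈ S, ∀ s' ∈ S, s ≠ s' → l k < |s - s'|) → (S.card : ℝ) ≤ N k) ∧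
      (∀ L : ℝ, 0 < L → ∑' k, (if L < X k ∧ X k ≤ 2 ^ p * L then
        ENNReal.ofReal (N k * (l k / X k) ^ (9 / 10 : ℝ)) else 0) ≤ ENNReal.ofReal η) ∧
      ∃ c > 0, ∀ s, s ∉ ⋃ k, Bad k → ∀ (q : ℕ) (p' r : ℤ), 0 < q →
        ¬ (|q * u s - p' - γ| ≤ c / (q : ℝ) ^ i ∧ |q * v s - r - δ| ≤ c / (q : ℝ) ^ j) := by
  have hM := h.M1
  have hM0 : 0 < M := by linarith
  obtain ⟨ε0, εT, κ0, D0, ε, κ, εI, c, hε0, hεzl, hεzM, hεT, hεTl, hεT1, hεT2, hκ0, hκ01, hκ02, hκ03,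
    hD0, hD1, hD2, hD3, hD4, hε, hεl, hε1, hε2, hε3, hε4, hκ, hκ1, hκ2, hκ3, hεI, hεIl, hεI1, hεI2, hεI3,
    hεI4, hεI5, hc, hc1, hc2, hc3⟩ := (exists_consts p hM h.lam0 hη).some
  have hν : 3 / 2 ≤ 1 / i := by rw [le_div_iff₀ hi]; linarith
  have hμ : 1 ≤ (1 + j) / (2 * j) := by rw [le_div_iff₀ (by positivity)]; linarith
  have hD02 : 0 < D0 ^ 2 := by positivity
  have hGp : ∀ a d : ℕ, 0 < GG (1 / i) ((1 + j) / (2 * j)) (2 ^ a) (2 ^ d) := fun a d => GG_pos (by positivity)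
  have hGge := GG_ge hi hj hij hle
  have hdist : ∀ {y L s t : ℝ}, s ∈ Icc y (y + L) → t ∈ Icc y (y + L) → |s - t| ≤ L := by
    intro y L s t hs ht
    rw [abs_le]; constructor <;> linarith [hs.1, hs.2, ht.1, ht.2]
  refine ⟨Sum.elim (Bad0 v κ0) (Sum.elim (BadT u v u1 v1 (D0 ^ 2) D0) (Sum.elim
      (fun k => BadG u v u1 v1 (1 / i) ((1 + j) / (2 * j)) κ D0 k.1 k.2) (BadI u v i j γ δ c))),
    Sum.elim (fun b => ε0 / 4 ^ b) (Sum.elim (fun a => εT / 2 ^ a) (Sum.elim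
      (fun k => ε / (2 ^ k.1 * (2 ^ k.2) ^ 2)) (fun n => εI / (2 ^ n * ((2 : ℝ) ^ n) ^ j)))),
    Sum.elim (fun b => 2 * M * κ0 / 4 ^ b) (Sum.elim (fun a => 4 * M ^ 6 * D0 / 2 ^ a) (Sum.elim
      (fun k => 4 * κ / (GG (1 / i) ((1 + j) / (2 * j)) (2 ^ k.1) (2 ^ k.2) * D0 * 2 ^ k.2))
      (fun n => 2 * M * c / (2 ^ n * ((2 : ℝ) ^ n) ^ j)))),
    Sum.elim (fun _ => 1) (Sum.elim (fun _ => 3) (Sum.elim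
      (fun k => (24 / D0) ^ 2 * (2 * (ε * GG (1 / i) ((1 + j) / (2 * j)) (2 ^ k.1) (2 ^ k.2) /
        (2 ^ k.1 * 2 ^ k.2 * κ))) ^ (4 / 5 : ℝ)) (fun _ => 1))), ?_, ?_, ?_, ?_, ?_, ?_, ?_, ?_⟩
  · rintro (b | a | k | n) <;> simp only [Sum.elim_inl, Sum.elim_inr] <;> positivity
  · rintro (b | a | k | n) <;> simp only [Sum.elim_inl, Sum.elim_inr]
    · positivity
    · positivity
    · have := hGp k.1 k.2
      positivity
    · positivity
  · rintro (b | a | k | n) <;> simp only [Sum.elim_inl, Sum.elim_inr]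
    · exact (div_le_self hε0.le (one_le_pow₀ (by norm_num))).trans hεzl
    · exact (div_le_self hεT.le (one_le_pow₀ (by norm_num))).trans hεTl
    · refine (div_le_self hε.le ?_).trans hεl
      exact one_le_mul_of_one_le_of_one_le (one_le_pow₀ (by norm_num))
        (one_le_pow₀ (one_le_pow₀ (by norm_num)))
    · refine (div_le_self hεI.le ?_).trans hεIl
      exact one_le_mul_of_one_le_of_one_le (one_le_pow₀ (by norm_num))
        (Real.one_le_rpow (one_le_pow₀ (by norm_num)) hj.le)
  · rintro (b | a | k | n) <;> simp only [Sum.elim_inl, Sum.elim_inr]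
    · rw [← mul_div_assoc]; gcongr; linarith
    · rw [← mul_div_assoc]; gcongr; linarith
    · have h1 := hGge k.1 k.2
      have h2 := hGp k.1 k.2
      rw [← mul_div_assoc, div_lt_div_iff₀ (by positivity) (by positivity)]
      calc (2 ^ p) ^ 2 * (4 * κ) * (2 ^ k.1 * (2 ^ k.2) ^ 2)
          = ((2 ^ p) ^ 2 * 4 * κ) * ((2 ^ k.1 * 2 ^ k.2) * 2 ^ k.2) := by ring
        _ < (ε * D0) * ((2 ^ k.1 * 2 ^ k.2) * 2 ^ k.2) := by gcongr
        _ ≤ (ε * D0) * (GG (1 / i) ((1 + j) / (2 * j)) (2 ^ k.1) (2 ^ k.2) * 2 ^ k.2) := by gcongr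
        _ = _ := by ring
    · rw [← mul_div_assoc]; gcongr; linarith
  · rintro (b | a | k | n) <;> simp only [Sum.elim_inl, Sum.elim_inr]
    · norm_num
    · norm_num
    · have := hGp k.1 k.2
      positivity
    · norm_num
  · intro k y L hL hLX hy0 hy1 hal S hS hsep
    have al0 : ∀ b : ℕ, L ≤ 2 * M * κ0 / 4 ^ b → Disjoint (Icc y (y + L)) (Bad0 v κ0 b) :=
      fun b => hal (.inl b)
    have alT : ∀ a : ℕ, L ≤ 4 * M ^ 6 * D0 / 2 ^ a →
      Disjoint (Icc y (y + L)) (BadT u v u1 v1 (D0 ^ 2) D0 a) := fun a => hal (.inr (.inl a))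
    have alG : ∀ a d : ℕ, L ≤ 4 * κ / (GG (1 / i) ((1 + j) / (2 * j)) (2 ^ a) (2 ^ d) * D0 * 2 ^ d) →
      Disjoint (Icc y (y + L)) (BadG u v u1 v1 (1 / i) ((1 + j) / (2 * j)) κ D0 a d) :=
      fun a d => hal (.inr (.inr (.inl (a, d))))
    clear hal
    have hJ : ∀ t, t ∈ Icc y (y + L) → t ∈ Icc x0 (x0 + lam) := fun t ht =>
      ⟨hy0.trans ht.1, ht.2.trans hy1⟩
    rcases k with b | a | k | n <;> simp only [Sum.elim_inl, Sum.elim_inr] at hLX hS hsep ⊢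
    · have : S.card ≤ 1 := by
        rw [Finset.card_le_one]
        intro s hs s' hs'
        by_contra hne
        have h1 := hS hs
        have h2 := hS hs'
        have h3 := class0_two h hκ0 (by linarith) b (hJ _ h1.1) (hJ _ h2.1)
          ((hdist h1.1 h2.1).trans hLX) h1.2 h2.2
        linarith [hsep s hs s' hs' hne]
      exact_mod_cast this
    · have : S.card ≤ 3 := by
        apply card_le_of_no_inj
        intro g hg hgS
        obtain ⟨k, k', hne, hk⟩ := classT_four h hD0 (by linarith) hD02 le_rfl hεT hεT1
          (by
            have e1 : D0 ^ 2 ≤ D0 := by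
              rw [pow_two]; exact mul_le_of_le_one_left hD0.le (by linarith)
            have e2 : M * D0 ^ 2 ≤ M * D0 := by gcongr
            have e3 : 12 * M * (D0 ^ 2 + εT) = 12 * (M * D0 ^ 2) + 12 * (M * εT) := by ring
            rw [e3]
            linarith) a g (fun k => hJ _ (hS (hgS k)).1)
          (fun k k' => (hdist (hS (hgS k)).1 (hS (hgS k')).1).trans hLX) (fun k => (hS (hgS k)).2)
        linarith [hsep _ (hgS k) _ (hgS k') (fun e => hne (hg e))]
      exact_mod_cast this
    · exact classG_count h hν hμ hκ0 hD02 hκ hD0 hL al0 alT alG hy0 hy1 k.1 k.2 hLX hε (by linarith)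
        hκ1 hε1 hε2 hε3 hε4 (hGge k.1 k.2) S hS hsep
    · have : S.card ≤ 1 := by
        rw [Finset.card_le_one]
        intro s hs s' hs'
        by_contra hne
        have h1 := hS hs
        have h2 := hS hs'
        have h3 := classI_two h hi hj hij hle hκ0 hD02 hκ hD0 (by linarith) hL al0 alT alG hy0 hy1 hεI hc hc1
          hεI1 hεI2 hεI3 hεI4 (le_trans (le_of_eq (by ring)) hεI5) n hLX h1.1 h2.1 h1.2 h2.2
        linarith [hsep s hs s' hs' hne]
      exact_mod_cast this
  · intro L hL
    rw [tsum_cls]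
    simp only [Sum.elim_inl, Sum.elim_inr]
    have hη4 : ENNReal.ofReal η = ENNReal.ofReal (η / 4) + (ENNReal.ofReal (η / 4) +
        (ENNReal.ofReal (η / 4) + ENNReal.ofReal (η / 4))) := by
      have h4 : 0 ≤ η / 4 := by positivity
      rw [← ENNReal.ofReal_add h4 h4, ← ENNReal.ofReal_add h4 (by positivity),
        ← ENNReal.ofReal_add h4 (by positivity)]
      congr 1; ring
    have hpm : ∀ {x : ℝ}, (p : ENNReal) * ENNReal.ofReal x = ENNReal.ofReal (p * x) := by
      intro x
      rw [ENNReal.ofReal_mul (p := (p : ℝ)) (by positivity), ENNReal.ofReal_natCast]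
    rw [hη4]
    refine add_le_add ?_ (add_le_add ?_ (add_le_add ?_ ?_))
    · have e : ∀ b : ℕ, 1 * (2 * M * κ0 / 4 ^ b / (ε0 / 4 ^ b)) ^ (9 / 10 : ℝ) =
          (2 * M / ε0 * κ0) ^ (9 / 10 : ℝ) := fun b => by
        rw [one_mul]; congr 1; field_simp
      simp_rw [e]
      refine (window_sum (fun b => ε0 / 4 ^ b) (fun b => by positivity) (fun b => ?_) p L _).trans ?_
      · rw [pow_succ, div_div]; gcongr; norm_num
      · rw [hpm]; exact ENNReal.ofReal_le_ofReal hκ03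
    · have e : ∀ a : ℕ, 3 * (4 * M ^ 6 * D0 / 2 ^ a / (εT / 2 ^ a)) ^ (9 / 10 : ℝ) =
          3 * (4 * M ^ 6 / εT * D0) ^ (9 / 10 : ℝ) := fun a => by
        congr 2; field_simp
      simp_rw [e]
      refine (window_sum (fun a => εT / 2 ^ a) (fun a => by positivity) (fun a => ?_) p L _).trans ?_
      · rw [pow_succ, div_div]
      · rw [hpm]; exact ENNReal.ofReal_le_ofReal (le_trans (le_of_eq (by ring)) hD4)
    · have hij0 : 0 ≤ i / j := by positivity
      refine (classG_sum ε (i / j) (4608 / D0 ^ 3 * (κ / ε) ^ (1 / 10 : ℝ)) hε hij0 (by positivity) p L _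
        (fun k => ENNReal.ofReal_le_ofReal
          (classG_weight hi hj hij hle hε hκ hD0 (by linarith) k.1 k.2))).trans ?_
      refine ENNReal.ofReal_le_ofReal (le_trans (le_of_eq ?_) hκ3)
      rw [one_div_mul_eq_div]; ring
    · have e : ∀ n : ℕ, 1 * (2 * M * c / (2 ^ n * ((2 : ℝ) ^ n) ^ j) / (εI / (2 ^ n * ((2 : ℝ) ^ n) ^ j))) ^ (9 / 10 : ℝ) =
          (2 * M / εI * c) ^ (9 / 10 : ℝ) := fun n => by
        rw [one_mul]; congr 1; field_simp
      simp_rw [e]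
      refine (window_sum (fun n => εI / (2 ^ n * ((2 : ℝ) ^ n) ^ j)) (fun n => by positivity)
        (fun n => ?_) p L _).trans ?_
      · rw [div_div]
        refine div_le_div_of_nonneg_left hεI.le (by positivity) ?_
        rw [pow_succ]
        have : ((2 : ℝ) ^ n) ^ j ≤ (2 ^ n * 2) ^ j := Real.rpow_le_rpow (by positivity)
          (by have : (0 : ℝ) < 2 ^ n := by positivity
              linarith) hj.le
        calc (2 : ℝ) ^ n * (2 ^ n) ^ j * 2 = 2 ^ n * 2 * (2 ^ n) ^ j := by ring
          _ ≤ _ := by gcongr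
      · rw [hpm]; exact ENNReal.ofReal_le_ofReal hc3
  · refine ⟨c, hc, fun s hs q p' r hq hcon => hs ?_⟩
    have hq1 : (1 : ℝ) ≤ q := by exact_mod_cast hq
    obtain ⟨n, hn1, hn2⟩ := exists_dyadic hq1
    refine mem_iUnion.2 ⟨.inr (.inr (.inr n)), ?_⟩
    simp only [Sum.elim_inr]
    refine ⟨q, p', r, hn1, hn2, hcon.1.trans ?_, hcon.2.trans ?_⟩
    · gcongr
    · gcongr


theorem per_t_any {x0 lam M : ℝ} {u v u1 v1 u2 v2 : ℝ → ℝ}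
    (h : CurveData x0 lam M u v u1 v1 u2 v2) (h' : CurveData x0 lam M v u v1 u1 v2 u2) {i j γ δ : ℝ}
    (hi : 0 < i) (hj : 0 < j) (hij : i + j = 1) (p : ℕ) {η : ℝ} (hη : 0 < η) :
    ∃ (Bad : Cls → Set ℝ) (X l N : Cls → ℝ), (∀ k, 0 < X k) ∧ (∀ k, 0 < l k) ∧ (∀ k, X k ≤ lam) ∧
      (∀ k, (2 ^ p) ^ 2 * l k < X k) ∧ (∀ k, 0 ≤ N k) ∧
      (∀ k y L, 0 < L → L ≤ X k → x0 ≤ y → y + L ≤ x0 + lam →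
        (∀ k', L ≤ l k' → Disjoint (Icc y (y + L)) (Bad k')) →
        ∀ S : Finset ℝ, (S : Set ℝ) ⊆ Icc y (y + L) ∩ Bad k →
          (∀ s ∈ S, ∀ s' ∈ S, s ≠ s' → l k < |s - s'|) → (S.card : ℝ) ≤ N k) ∧
      (∀ L : ℝ, 0 < L → ∑' k, (if L < X k ∧ X k ≤ 2 ^ p * L then
        ENNReal.ofReal (N k * (l k / X k) ^ (9 / 10 : ℝ)) else 0) ≤ ENNReal.ofReal η) ∧
      ∃ c > 0, ∀ s, s ∉ ⋃ k, Bad k → ∀ (q : ℕ) (p' r : ℤ), 0 < q →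
        ¬ (|q * u s - p' - γ| ≤ c / (q : ℝ) ^ i ∧ |q * v s - r - δ| ≤ c / (q : ℝ) ^ j) := by
  rcases le_total i j with hle | hle
  · exact per_t h hi hj hij hle p hη
  · obtain ⟨Bad, X, l, N, a1, a2, a3, a4, a5, a6, a7, c, hc, a8⟩ :=
      per_t h' (γ := δ) (δ := γ) hj hi (by linarith) hle p hη
    exact ⟨Bad, X, l, N, a1, a2, a3, a4, a5, a6, a7, c, hc,
      fun s hs q p' r hq hh => a8 s hs q r p' hq ⟨hh.2, hh.1⟩⟩

theorem all_t {x0 lam M : ℝ} {u v u1 v1 u2 v2 : ℝ → ℝ}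
    (h : CurveData x0 lam M u v u1 v1 u2 v2) (h' : CurveData x0 lam M v u v1 u1 v2 u2)
    {i j γ δ : ℕ → ℝ}
    (hi : ∀ t, 0 < i t) (hj : ∀ t, 0 < j t) (hij : ∀ t, i t + j t = 1) (p : ℕ) (hp : 10 ≤ p) :
    ENNReal.ofReal (((p : ℝ) - 3) / p) ≤ dimH {s : ℝ | s ∈ Icc x0 (x0 + lam) ∧ ∀ t : ℕ, ∃ c > 0,
      ∀ (q : ℕ) (p' r : ℤ), 0 < q →
        ¬ (|q * u s - p' - γ t| ≤ c / (q : ℝ) ^ (i t) ∧ |q * v s - r - δ t| ≤ c / (q : ℝ) ^ (j t))} := by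
  have key := fun t : ℕ => per_t_any h h' (γ := γ t) (δ := δ t) (hi t) (hj t) (hij t) p
    (η := 1 / (18 * (2 ^ p) ^ 2) * (1 / 2) ^ (t + 1)) (by positivity)
  choose Bad X l N a1 a2 a3 a4 a5 a6 a7 a8 using key
  have := cantor_real (K := ℕ × Cls) p hp x0 lam h.lam0 (fun k => Bad k.1 k.2) (fun k => X k.1 k.2)
    (fun k => l k.1 k.2) (fun k => N k.1 k.2) (fun k => a1 _ _) (fun k => a2 _ _) (fun k => a3 _ _)
    (fun k => a4 _ _) (fun k => a5 _ _)
    (fun k y L h1 h2 h3 h4 h5 => a6 k.1 k.2 y L h1 h2 h3 h4 (fun k' hk' => h5 (k.1, k') hk')) ?_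
  · refine this.trans (dimH_mono ?_)
    rintro s ⟨hs, hs2⟩
    refine ⟨hs, fun t => ?_⟩
    obtain ⟨c, hc, hc2⟩ := a8 t
    refine ⟨c, hc, hc2 s (fun hh => hs2 ?_)⟩
    obtain ⟨k, hk⟩ := mem_iUnion.1 hh
    exact mem_iUnion.2 ⟨(t, k), hk⟩
  · intro L hL
    rw [ENNReal.tsum_prod']
    refine (ENNReal.tsum_le_tsum (fun t => a7 t L hL)).trans (le_of_eq ?_)
    rw [← ENNReal.ofReal_tsum_of_nonneg (fun t => by positivity)]
    · rw [tsum_mul_left]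
      congr 1
      have : ∑' t : ℕ, (1 / 2 : ℝ) ^ (t + 1) = 1 := by
        simp_rw [pow_succ]
        rw [tsum_mul_right, tsum_geometric_two]
        norm_num
      rw [this, mul_one]
    · apply Summable.mul_left
      exact (summable_nat_add_iff 1).2 summable_geometric_two

theorem good_bad {i j γ δ x y : ℝ} (hi : 0 < i) (hj : 0 < j) (hij : i + j = 1)
    (h : ∃ c > 0, ∀ (q : ℕ) (p' r : ℤ), 0 < q →
        ¬ (|q * x - p' - γ| ≤ c / (q : ℝ) ^ i ∧ |q * y - r - δ| ≤ c / (q : ℝ) ^ j)) :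
    ∃ c : ℝ, 0 < c ∧ ∀ q : ℕ, 0 < q →
    c / (q : ℝ) < max (|q * x - γ - round (q * x - γ)| ^ (1 / i))
                      (|q * y - δ - round (q * y - δ)| ^ (1 / j)) := by
  obtain ⟨c, hc, h⟩ := h
  have hm : 0 < min c 1 := by positivity
  refine ⟨min (min c 1 ^ (1 / i)) (min c 1 ^ (1 / j)), by positivity, fun q hq => ?_⟩
  by_contra hcon
  rw [not_lt, max_le_iff] at hcon
  have hq' : (0 : ℝ) < q := by exact_mod_cast hq
  have aux : ∀ {i d : ℝ}, 0 < i → 0 ≤ d →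
      d ^ (1 / i) ≤ min c 1 ^ (1 / i) / q → d ≤ c / (q : ℝ) ^ i := by
    intro i d hi hd hle
    have h1 := Real.rpow_le_rpow (by positivity) hle hi.le
    rw [← Real.rpow_mul hd, one_div_mul_cancel hi.ne', Real.rpow_one,
      Real.div_rpow (by positivity) hq'.le, ← Real.rpow_mul hm.le, one_div_mul_cancel hi.ne',
      Real.rpow_one] at h1
    refine h1.trans ?_
    gcongr
    exact min_le_left _ _
  refine h q (round (q * x - γ)) (round (q * y - δ)) hq ⟨?_, ?_⟩
  · rw [sub_right_comm]
    exact aux hi (abs_nonneg _) (hcon.1.trans (by gcongr; exact min_le_left _ _))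
  · rw [sub_right_comm]
    exact aux hj (abs_nonneg _) (hcon.2.trans (by gcongr; exact min_le_right _ _))


theorem exists_curve {a b : ℝ} {f : ℝ → ℝ} (hab : a < b) (hf : ContDiffOn ℝ 2 f (Set.Icc a b))
    (hf'' : ∃ x ∈ Set.Icc a b, iteratedDerivWithin 2 f (Set.Icc a b) x ≠ 0) :
    ∃ x0 lam M : ℝ, a ≤ x0 ∧ x0 + lam ≤ b ∧
      CurveData x0 lam M (fun x => x) f (fun _ => 1) (deriv f) (fun _ => 0) (deriv (deriv f)) ∧
      CurveData x0 lam M f (fun x => x) (deriv f) (fun _ => 1) (deriv (deriv f)) (fun _ => 0) := by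
  have hUD : UniqueDiffOn ℝ (Icc a b) := uniqueDiffOn_Icc hab
  -- a point of the open interval
  have h1 : ∃ x ∈ Ioo a b, iteratedDerivWithin 2 f (Icc a b) x ≠ 0 := by
    by_contra hcon
    push Not at hcon
    obtain ⟨x, hx, hne⟩ := hf''
    have hc := hf.continuousOn_iteratedDerivWithin (m := 2) le_rfl hUD
    have hcl : IsClosed (Icc a b ∩ iteratedDerivWithin 2 f (Icc a b) ⁻¹' {0}) :=
      hc.preimage_isClosed_of_isClosed isClosed_Icc isClosed_singleton
    have hsub : Ioo a b ⊆ Icc a b ∩ iteratedDerivWithin 2 f (Icc a b) ⁻¹' {0} := fun z hz =>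
      ⟨Ioo_subset_Icc_self hz, hcon z hz⟩
    have := closure_minimal hsub hcl
    rw [closure_Ioo hab.ne] at this
    exact hne (this hx).2
  obtain ⟨x1, hx1, hne⟩ := h1
  have hfo : ContDiffOn ℝ 2 f (Ioo a b) := hf.mono Ioo_subset_Icc_self
  have hd1 : ContDiffOn ℝ 1 (deriv f) (Ioo a b) := by
    have := (contDiffOn_succ_iff_deriv_of_isOpen (n := 1) isOpen_Ioo).1 (by simpa [one_add_one_eq_two] using hfo)
    exact this.2.2
  have hd2 : ContinuousOn (deriv (deriv f)) (Ioo a b) :=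
    hd1.continuousOn_deriv_of_isOpen isOpen_Ioo le_rfl
  have hD : ∀ s ∈ Ioo a b, HasDerivAt f (deriv f s) s := fun s hs =>
    ((hfo.differentiableOn (by norm_num)).differentiableAt (isOpen_Ioo.mem_nhds hs)).hasDerivAt
  have hDD : ∀ s ∈ Ioo a b, HasDerivAt (deriv f) (deriv (deriv f) s) s := fun s hs =>
    ((hd1.differentiableOn (by norm_num)).differentiableAt (isOpen_Ioo.mem_nhds hs)).hasDerivAt
  have hne2 : deriv (deriv f) x1 ≠ 0 := by
    rw [iteratedDerivWithin_eq_iteratedDeriv hUD (hfo.contDiffAt (isOpen_Ioo.mem_nhds hx1))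
      (Ioo_subset_Icc_self hx1)] at hne
    simpa [iteratedDeriv_succ, iteratedDeriv_zero] using hne
  have hx1n := isOpen_Ioo.mem_nhds hx1
  have ev1 : ∀ᶠ z in nhdsWithin x1 {x1}ᶜ, deriv f z ≠ 0 := (hDD x1 hx1).eventually_ne hne2
  have ev2 : ∀ᶠ z in nhds x1, deriv (deriv f) z ≠ 0 :=
    (hd2.continuousAt hx1n).eventually_ne hne2
  obtain ⟨x2, hx2, hx2b, hx2c⟩ := (ev1.and ((ev2.filter_mono nhdsWithin_le_nhds).and
    (Eventually.filter_mono nhdsWithin_le_nhds hx1n))).exists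
  have hx2n := isOpen_Ioo.mem_nhds hx2c
  have ev3 := ((hd1.continuousOn.continuousAt hx2n).eventually_ne hx2).and
    (((hd2.continuousAt hx2n).eventually_ne hx2b).and hx2n)
  obtain ⟨r, hr, hball⟩ := Metric.nhds_basis_closedBall.mem_iff.1 ev3
  rw [Real.closedBall_eq_Icc] at hball
  have hI : Icc (x2 - r) (x2 - r + 2 * r) = Icc (x2 - r) (x2 + r) := by congr 1; ring
  rw [← hI] at hball
  have p1 : ∀ s ∈ Icc (x2 - r) (x2 - r + 2 * r), deriv f s ≠ 0 := fun s hs => (hball hs).1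
  have p2 : ∀ s ∈ Icc (x2 - r) (x2 - r + 2 * r), deriv (deriv f) s ≠ 0 := fun s hs => (hball hs).2.1
  have p3 : ∀ s ∈ Icc (x2 - r) (x2 - r + 2 * r), s ∈ Ioo a b := fun s hs => (hball hs).2.2
  have c1 : ContinuousOn (deriv f) (Icc (x2 - r) (x2 - r + 2 * r)) := hd1.continuousOn.mono p3
  have c2 : ContinuousOn (deriv (deriv f)) (Icc (x2 - r) (x2 - r + 2 * r)) := hd2.mono p3
  obtain ⟨M1, hM1⟩ := isCompact_Icc.exists_bound_of_continuousOn c1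
  obtain ⟨M2, hM2⟩ := isCompact_Icc.exists_bound_of_continuousOn c2
  obtain ⟨M3, hM3⟩ := isCompact_Icc.exists_bound_of_continuousOn (c1.inv₀ p1)
  obtain ⟨M4, hM4⟩ := isCompact_Icc.exists_bound_of_continuousOn (c2.inv₀ p2)
  have mem0 : x2 - r ∈ Icc (x2 - r) (x2 - r + 2 * r) := ⟨le_rfl, by linarith⟩
  have mem1 : x2 - r + 2 * r ∈ Icc (x2 - r) (x2 - r + 2 * r) := ⟨by linarith, le_rfl⟩
  have n1 := (norm_nonneg _).trans (hM1 _ mem0)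
  have n2 := (norm_nonneg _).trans (hM2 _ mem0)
  have n3 := (norm_nonneg _).trans (hM3 _ mem0)
  have n4 := (norm_nonneg _).trans (hM4 _ mem0)
  have b1 : ∀ s ∈ Icc (x2 - r) (x2 - r + 2 * r), |deriv f s| ≤ 1 + M1 + M2 + M3 + M4 := fun s hs => by
    have := hM1 s hs
    rw [Real.norm_eq_abs] at this
    linarith
  have b2 : ∀ s ∈ Icc (x2 - r) (x2 - r + 2 * r), |deriv (deriv f) s| ≤ 1 + M1 + M2 + M3 + M4 := fun s hs => by
    have := hM2 s hs
    rw [Real.norm_eq_abs] at this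
    linarith
  have b3 : ∀ s ∈ Icc (x2 - r) (x2 - r + 2 * r), 1 ≤ (1 + M1 + M2 + M3 + M4) * |deriv f s| := fun s hs => by
    have := hM3 s hs
    rw [Pi.inv_apply, norm_inv, Real.norm_eq_abs] at this
    have hp := abs_pos.2 (p1 s hs)
    rw [← div_le_iff₀ hp, one_div]
    linarith
  have b4 : ∀ s ∈ Icc (x2 - r) (x2 - r + 2 * r),
      1 ≤ (1 + M1 + M2 + M3 + M4) * |deriv (deriv f) s| := fun s hs => by
    have := hM4 s hs
    rw [Pi.inv_apply, norm_inv, Real.norm_eq_abs] at this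
    have hp := abs_pos.2 (p2 s hs)
    rw [← div_le_iff₀ hp, one_div]
    linarith
  have sgn : (∀ s ∈ Icc (x2 - r) (x2 - r + 2 * r), 0 < deriv f s) ∨
      (∀ s ∈ Icc (x2 - r) (x2 - r + 2 * r), deriv f s < 0) := by
    by_contra hcon
    push Not at hcon
    obtain ⟨⟨s, hs, hs1⟩, ⟨s', hs', hs1'⟩⟩ := hcon
    obtain ⟨z, hz, hz0⟩ := isPreconnected_Icc.intermediate_value hs hs' c1 ⟨hs1, hs1'⟩
    exact p1 z hz hz0
  refine ⟨x2 - r, 2 * r, 1 + M1 + M2 + M3 + M4, (p3 _ mem0).1.le, (p3 _ mem1).2.le, ?_, ?_⟩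
  · exact
      { hu := fun s _ => hasDerivAt_id s
        hv := fun s hs => hD s (p3 s hs)
        hu1 := fun s _ => hasDerivAt_const s _
        hv1 := fun s hs => hDD s (p3 s hs)
        M1 := by linarith
        lam0 := by linarith
        bu1 := fun s _ => by rw [abs_one]; linarith
        bv1 := b1
        bu2 := fun s _ => by rw [abs_zero]; linarith
        bv2 := b2
        lv1 := b3
        sv1 := sgn
        lW := fun s hs => by simpa using b4 s hs }
  · exact
      { hv := fun s _ => hasDerivAt_id s
        hu := fun s hs => hD s (p3 s hs)
        hv1 := fun s _ => hasDerivAt_const s _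
        hu1 := fun s hs => hDD s (p3 s hs)
        M1 := by linarith
        lam0 := by linarith
        bv1 := fun s _ => by rw [abs_one]; linarith
        bu1 := b1
        bv2 := fun s _ => by rw [abs_zero]; linarith
        bu2 := b2
        lv1 := fun s _ => by rw [abs_one]; linarith
        sv1 := Or.inl fun s _ => one_pos
        lW := fun s hs => by simpa using b4 s hs }

theorem one_le_of_forall_p {d : ENNReal} (h : ∀ p : ℕ, 10 ≤ p → ENNReal.ofReal (((p : ℝ) - 3) / p) ≤ d) :
    1 ≤ d := by
  have ht : Tendsto (fun p : ℕ => ENNReal.ofReal (((p : ℝ) - 3) / p)) atTop (nhds 1) := by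
    rw [← ENNReal.ofReal_one]
    refine ENNReal.tendsto_ofReal ?_
    have h1 : Tendsto (fun p : ℕ => 1 - 3 / (p : ℝ)) atTop (nhds (1 - 0)) :=
      tendsto_const_nhds.sub (tendsto_const_div_atTop_nhds_zero_nat 3)
    rw [sub_zero] at h1
    refine h1.congr' ?_
    filter_upwards [eventually_gt_atTop 0] with p hp
    have : (p : ℝ) ≠ 0 := by exact_mod_cast hp.ne'
    field_simp
  exact le_of_tendsto ht (eventually_atTop.2 ⟨10, h⟩)

theorem stmt1 (i j : ℕ → ℝ) (θ : ℕ → ℝ × ℝ) (a b : ℝ) (f : ℝ → ℝ)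
    (hi0 : ∀ t, 0 < i t) (hi1 : ∀ t, i t < 1)
    (hj0 : ∀ t, 0 < j t) (hj1 : ∀ t, j t < 1)
    (hij : ∀ t, i t + j t = 1)
    (hab : a < b)
    (hf : ContDiffOn ℝ 2 f (Set.Icc a b))
    (hf'' : ∃ x ∈ Set.Icc a b, iteratedDerivWithin 2 f (Set.Icc a b) x ≠ 0) :
    dimH (⋂ t : ℕ, (badPair (i t) (j t) (θ t) ∩
      {p : ℝ × ℝ | ∃ x ∈ Set.Icc a b, p = (x, f x)})) = 1 := by
  apply le_antisymm
  · have hsub : (⋂ t : ℕ, (badPair (i t) (j t) (θ t) ∩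
      {p : ℝ × ℝ | ∃ x ∈ Set.Icc a b, p = (x, f x)})) ⊆ (fun x => (x, f x)) '' Icc a b := by
      intro p hp
      obtain ⟨x, hx, e⟩ := (mem_iInter.1 hp 0).2
      exact ⟨x, hx, e.symm⟩
    refine (dimH_mono hsub).trans ?_
    have hg : ContDiffOn ℝ 1 (fun x => (x, f x)) (Icc a b) :=
      contDiffOn_id.prodMk (hf.of_le (by norm_num))
    refine (hg.dimH_image_le (convex_Icc a b) subset_rfl).trans ?_
    exact (dimH_mono (subset_univ _)).trans Real.dimH_univ.le
  · obtain ⟨x0, lam, M, hx0, hlam, hC, hC'⟩ := exists_curve hab hf hf''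
    apply one_le_of_forall_p
    intro p hp
    refine (all_t hC hC' (γ := fun t => (θ t).1) (δ := fun t => (θ t).2) hi0 hj0 hij p hp).trans ?_
    refine le_trans (dimH_mono ?_) ((LipschitzWith.prod_fst).dimH_image_le _)
    rintro s ⟨hs, hs2⟩
    refine ⟨(s, f s), mem_iInter.2 fun t => ⟨?_, s, ⟨hx0.trans hs.1, hs.2.trans hlam⟩, rfl⟩, rfl⟩
    exact good_bad (hi0 t) (hj0 t) (hij t) (hs2 t)
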